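/- There exists a nonnegative v ∈ C(ℝ^d), not identically zero, that is a distributional solution of Δ_k v = φ(v) in ℝ^d, if and only if φ satisfies the Keller–Osserman condition, i.e. there exists a > 0 such that ∫_a^∞ dt/√(∫_0^t φ(s) ds) = ∞ (with the convention that the integrand equals +∞ where ∫_0^t φ(s) ds = 0). -/

import Mathlib

open MeasureTheory Real Filter
open scoped RealInnerProductSpace ENNReal Topology

noncomputable section

abbrev E (d : ℕ) := EuclideanSpace ℝ (Fin d)

/-- The reflection σ_α in the hyperplane orthogonal to α. -/
def dunklReflect {d : ℕ} (α x : E d) : E d := x - ((2 * ⟪α, x⟫) / ‖α‖ ^ 2) • α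

/-- The Euclidean Laplacian, as the trace of the second derivative. -/
def lap {d : ℕ} (u : E d → ℝ) (x : E d) : ℝ :=
  ∑ i : Fin d, iteratedFDeriv ℝ 2 u x ![EuclideanSpace.single i 1, EuclideanSpace.single i 1]

/-- The Dunkl Laplacian Δ_k associated with the root system `R` and multiplicity `k`. -/
def dunklLap {d : ℕ} (R : Finset (E d)) (k : E d → ℝ) (u : E d → ℝ) (x : E d) : ℝ :=
  lap u x + ∑ α ∈ R, k α * (⟪gradient u x, α⟫ / ⟪α, x⟫ -
    (‖α‖ ^ 2 / 2) * ((u x - u (dunklReflect α x)) / ⟪α, x⟫ ^ 2))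

/-- The weight function w_k. -/
def wk {d : ℕ} (R : Finset (E d)) (k : E d → ℝ) (x : E d) : ℝ :=
  ∏ α ∈ R, |⟪x, α⟫| ^ (k α)

/-- `u` is a distributional solution of Δ_k u = φ(u) on `D`. -/
def IsDunklSol {d : ℕ} (R : Finset (E d)) (k : E d → ℝ) (φ : ℝ → ℝ) (D : Set (E d))
    (u : E d → ℝ) : Prop :=
  ∀ ψ : E d → ℝ, ContDiff ℝ (⊤ : ℕ∞) ψ → HasCompactSupport ψ → tsupport ψ ⊆ D →
    ∫ x in D, u x * dunklLap R k ψ x * wk R k x = ∫ x in D, φ (u x) * ψ x * wk R k x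

/-- The standing assumptions on the root system `R` and on the multiplicity function `k`. -/
structure IsDunklData {d : ℕ} (R : Finset (E d)) (k : E d → ℝ) : Prop where
  ne_zero : ∀ α ∈ R, α ≠ 0
  refl_mem : ∀ α ∈ R, ∀ β ∈ R, dunklReflect α β ∈ R
  pos : ∀ α ∈ R, 0 < k α
  refl_inv : ∀ α ∈ R, ∀ β ∈ R, k (dunklReflect α β) = k β

section Reflections

variable {d : ℕ}

theorem dunklReflect_eq_reflection (α x : E d) :
    dunklReflect α x = (ℝ ∙ α)ᗮ.reflection x := by
  rw [Submodule.reflection_orthogonal_apply, Submodule.reflection_singleton_apply, dunklReflect,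
    neg_sub]
  simp only [RCLike.ofReal_real_eq_id, id, ← Nat.cast_smul_eq_nsmul ℝ, smul_smul]
  congr 2
  push_cast
  ring

theorem dunklReflect_dunklReflect (α x : E d) : dunklReflect α (dunklReflect α x) = x := by
  simp [dunklReflect_eq_reflection]

theorem norm_dunklReflect (α x : E d) : ‖dunklReflect α x‖ = ‖x‖ := by
  simp [dunklReflect_eq_reflection]

theorem inner_dunklReflect_dunklReflect (α x y : E d) :
    ⟪dunklReflect α x, dunklReflect α y⟫ = ⟪x, y⟫ := by
  simp [dunklReflect_eq_reflection]

theorem inner_dunklReflect_left (α x y : E d) :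
    ⟪dunklReflect α x, y⟫ = ⟪x, dunklReflect α y⟫ := by
  rw [← inner_dunklReflect_dunklReflect α x, dunklReflect_dunklReflect]

theorem inner_root_dunklReflect {α : E d} (hα : α ≠ 0) (x : E d) :
    ⟪α, dunklReflect α x⟫ = -⟪α, x⟫ := by
  have : ‖α‖ ≠ 0 := norm_ne_zero_iff.2 hα
  rw [dunklReflect, inner_sub_right, inner_smul_right, real_inner_self_eq_norm_sq]
  field_simp
  ring

theorem contDiff_dunklReflect (α : E d) {n : WithTop ℕ∞} : ContDiff ℝ n (dunklReflect α) := by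
  rw [funext (dunklReflect_eq_reflection α)]
  exact ((ℝ ∙ α)ᗮ.reflection).contDiff

theorem continuous_dunklReflect (α : E d) : Continuous (dunklReflect α) :=
  (contDiff_dunklReflect α (n := 0)).continuous

theorem integral_comp_dunklReflect (α : E d) (f : E d → ℝ) :
    ∫ x, f (dunklReflect α x) = ∫ x, f x := by
  have h := (LinearIsometryEquiv.measurePreserving ((ℝ ∙ α)ᗮ.reflection)).integral_comp
    ((ℝ ∙ α)ᗮ.reflection).toHomeomorph.measurableEmbedding f
  simpa only [dunklReflect_eq_reflection] using h

theorem dist_dunklReflect_self {α : E d} (hα : α ≠ 0) (x : E d) :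
    ‖dunklReflect α x - x‖ = 2 / ‖α‖ * |⟪α, x⟫| := by
  have : ‖α‖ ≠ 0 := norm_ne_zero_iff.2 hα
  rw [dunklReflect, sub_sub_cancel_left, norm_neg, norm_smul, Real.norm_eq_abs, abs_div, abs_mul]
  simp only [abs_two, abs_pow, abs_norm]
  field_simp

theorem wk_dunklReflect {R : Finset (E d)} {k : E d → ℝ} (h : IsDunklData R k) {α : E d}
    (hα : α ∈ R) (x : E d) : wk R k (dunklReflect α x) = wk R k x := by
  unfold wk
  refine Finset.prod_bij' (fun β _ => dunklReflect α β) (fun β _ => dunklReflect α β)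
    (fun β hβ => h.refl_mem α hα β hβ) (fun β hβ => h.refl_mem α hα β hβ)
    (fun β _ => dunklReflect_dunklReflect α β) (fun β _ => dunklReflect_dunklReflect α β) ?_
  intro β hβ
  rw [inner_dunklReflect_left, h.refl_inv α hα β hβ]

end Reflections

section Weight

variable {d : ℕ} {R : Finset (E d)} {k : E d → ℝ}

theorem continuous_wk (h : IsDunklData R k) : Continuous (wk R k) := by
  unfold wk
  refine continuous_finsetProd _ fun α hα => ?_
  exact ((by fun_prop : Continuous fun x : E d => |⟪x, α⟫|)).rpow_const
    fun x => Or.inr (h.pos α hα).le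

theorem wk_nonneg (x : E d) : 0 ≤ wk R k x :=
  Finset.prod_nonneg fun _ _ => Real.rpow_nonneg (abs_nonneg _) _

theorem ae_inner_ne_zero {α : E d} (hα : α ≠ 0) : ∀ᵐ x : E d, ⟪α, x⟫ ≠ 0 := by
  have h : volume (((ℝ ∙ α)ᗮ : Submodule ℝ (E d)) : Set (E d)) = 0 := by
    apply Measure.addHaar_submodule
    intro htop
    have : α ∈ (ℝ ∙ α)ᗮ := htop ▸ Submodule.mem_top
    rw [Submodule.mem_orthogonal_singleton_iff_inner_right] at this
    exact hα (inner_self_eq_zero.1 this)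
  rw [ae_iff]
  convert h using 2
  ext x
  simp [Submodule.mem_orthogonal_singleton_iff_inner_right]

theorem ae_forall_inner_ne_zero (h : IsDunklData R k) : ∀ᵐ x : E d, ∀ α ∈ R, ⟪α, x⟫ ≠ 0 :=
  (ae_ball_iff R.countable_toSet).2 fun α hα => ae_inner_ne_zero (h.ne_zero α hα)

theorem wk_pos {x : E d} (hx : ∀ α ∈ R, ⟪α, x⟫ ≠ 0) : 0 < wk R k x :=
  Finset.prod_pos fun α hα => Real.rpow_pos_of_pos
    (abs_pos.2 (by rw [real_inner_comm]; exact hx α hα)) _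

theorem intervalIntegrable_abs_rpow {s : ℝ} (hs : -1 < s) (a b : ℝ) :
    IntervalIntegrable (fun t : ℝ => |t| ^ s) volume a b := by
  suffices H : ∀ c : ℝ, IntervalIntegrable (fun t : ℝ => |t| ^ s) volume 0 c from
    (H a).symm.trans (H b)
  have H : ∀ c : ℝ, 0 ≤ c → IntervalIntegrable (fun t : ℝ => |t| ^ s) volume 0 c := by
    intro c hc
    refine (intervalIntegral.intervalIntegrable_rpow' hs (a := 0) (b := c)).congr ?_
    intro t ht
    rw [Set.uIoc_of_le hc] at ht
    simp only [abs_of_pos ht.1]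
  intro c
  rcases le_total 0 c with hc | hc
  · exact H c hc
  · rw [IntervalIntegrable.iff_comp_neg]
    simpa using H (-c) (by linarith)

theorem integrableOn_abs_inner_rpow {α : E d} (hα : α ≠ 0) {s : ℝ} (hs : -1 < s) (ρ : ℝ) :
    IntegrableOn (fun x : E d => |⟪α, x⟫| ^ s) (Metric.closedBall 0 ρ) := by
  have hmeas : Measurable fun x : E d => |⟪α, x⟫| ^ s := by fun_prop
  rw [← integrable_indicator_iff Metric.isClosed_closedBall.measurableSet]
  refine ⟨(hmeas.indicator Metric.isClosed_closedBall.measurableSet).aestronglyMeasurable, ?_⟩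
  rw [hasFiniteIntegral_iff_enorm]
  set f : E d → ℝ≥0∞ := fun x => ‖(Metric.closedBall (0 : E d) ρ).indicator
    (fun x : E d => |⟪α, x⟫| ^ s) x‖ₑ with hf
  have hfm : Measurable f :=
    (hmeas.indicator Metric.isClosed_closedBall.measurableSet).enorm
  set e : E d := (‖α‖ ^ 2)⁻¹ • α with he
  have hαe : ⟪α, e⟫ = 1 := by
    rw [he, inner_smul_right, real_inner_self_eq_norm_sq]
    exact inv_mul_cancel₀ (pow_ne_zero _ (norm_ne_zero_iff.2 hα))
  set M : ℝ := ‖α‖ * ρ with hM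
  set H : ℝ → ℝ≥0∞ := (Set.Icc (-M) M).indicator fun t => ‖|t| ^ s‖ₑ with hH
  have hHfin : ∫⁻ t, H t < ⊤ := by
    rw [hH, lintegral_indicator measurableSet_Icc]
    rcases le_or_gt (-M) M with hle | hlt
    · have := (intervalIntegrable_iff_integrableOn_Icc_of_le hle).1
        (intervalIntegrable_abs_rpow hs (-M) M)
      exact this.2
    · simp [Set.Icc_eq_empty (not_le.2 hlt)]
  have hpt : ∀ (x : E d), ∀ t ∈ Set.Ioc (0 : ℝ) 1, f (x + t • e) ≤
      (Metric.closedBall (0 : E d) (ρ + ‖e‖)).indicator (fun _ => H (⟪α, x⟫ + t)) x := by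
    intro x t ht
    by_cases hx : x + t • e ∈ Metric.closedBall (0 : E d) ρ
    · have hx' := mem_closedBall_zero_iff.1 hx
      have h1 : x ∈ Metric.closedBall (0 : E d) (ρ + ‖e‖) := by
        rw [mem_closedBall_zero_iff]
        calc ‖x‖ = ‖(x + t • e) - t • e‖ := by simp
          _ ≤ ‖x + t • e‖ + ‖t • e‖ := norm_sub_le _ _
          _ ≤ ρ + ‖e‖ := by
            gcongr
            rw [norm_smul, Real.norm_eq_abs, abs_of_pos ht.1]
            exact mul_le_of_le_one_left (norm_nonneg _) ht.2
      have h2 : ⟪α, x + t • e⟫ = ⟪α, x⟫ + t := by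
        rw [inner_add_right, inner_smul_right, hαe, mul_one]
      have h3 : ⟪α, x⟫ + t ∈ Set.Icc (-M) M := by
        rw [Set.mem_Icc, ← abs_le, ← h2]
        exact (abs_real_inner_le_norm _ _).trans (by rw [hM]; gcongr)
      simp only [hf, Set.indicator_of_mem hx, Set.indicator_of_mem h1, hH,
        Set.indicator_of_mem h3, h2, le_refl]
    · simp [hf, Set.indicator_of_notMem hx]
  have key : ∫⁻ x, f x ≤ ∫⁻ x, (Metric.closedBall (0 : E d) (ρ + ‖e‖)).indicator
      (fun _ => ∫⁻ t, H t) x := by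
    calc ∫⁻ x, f x = ∫⁻ t in Set.Ioc (0 : ℝ) 1, ∫⁻ x, f x := by simp
      _ = ∫⁻ t in Set.Ioc (0 : ℝ) 1, ∫⁻ x, f (x + t • e) := by
        simp_rw [lintegral_add_right_eq_self]
      _ = ∫⁻ x, ∫⁻ t in Set.Ioc (0 : ℝ) 1, f (x + t • e) := by
        rw [lintegral_lintegral_swap]
        exact (hfm.comp (by fun_prop)).aemeasurable
      _ ≤ ∫⁻ x, (Metric.closedBall (0 : E d) (ρ + ‖e‖)).indicator
          (fun _ => ∫⁻ t, H t) x := by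
        refine lintegral_mono fun x => ?_
        refine (setLIntegral_mono' measurableSet_Ioc (hpt x)).trans ?_
        by_cases hx : x ∈ Metric.closedBall (0 : E d) (ρ + ‖e‖)
        · simp only [Set.indicator_of_mem hx]
          refine (setLIntegral_le_lintegral _ _).trans ?_
          rw [lintegral_add_left_eq_self (μ := volume) H]
        · simp [Set.indicator_of_notMem hx]
  refine key.trans_lt ?_
  rw [lintegral_indicator Metric.isClosed_closedBall.measurableSet, setLIntegral_const]
  exact ENNReal.mul_lt_top hHfin (isCompact_closedBall (0 : E d) _).measure_lt_top

theorem integrable_mul_wk (h : IsDunklData R k) {f : E d → ℝ} (hf : AEStronglyMeasurable f)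
    {C ρ : ℝ} (hC : ∀ x, |f x| ≤ C) (hρ : ∀ x, ρ < ‖x‖ → f x = 0) :
    Integrable fun x => f x * wk R k x := by
  have hw : IntegrableOn (wk R k) (Metric.closedBall 0 ρ) :=
    (continuous_wk h).continuousOn.integrableOn_compact (isCompact_closedBall _ _)
  refine Integrable.mono' ((hw.integrable_indicator
    Metric.isClosed_closedBall.measurableSet).const_mul C)
    (hf.mul (continuous_wk h).aestronglyMeasurable) (Eventually.of_forall fun x => ?_)
  by_cases hx : x ∈ Metric.closedBall (0 : E d) ρ
  · rw [Set.indicator_of_mem hx, norm_mul, Real.norm_eq_abs, Real.norm_eq_abs,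
      abs_of_nonneg (wk_nonneg x)]
    exact mul_le_mul_of_nonneg_right (hC x) (wk_nonneg x)
  · rw [Set.indicator_of_notMem hx, hρ x (by simpa using hx)]
    simp

theorem integrable_div_mul_wk (h : IsDunklData R k) {α : E d} (hα : α ∈ R) {f : E d → ℝ}
    (hf : AEStronglyMeasurable f) {C ρ : ℝ} (hC : ∀ x, |f x| ≤ C)
    (hρ : ∀ x, ρ < ‖x‖ → f x = 0) :
    Integrable fun x => f x / ⟪α, x⟫ * wk R k x := by
  classical
  set r : E d → ℝ := fun x => ∏ β ∈ R.erase α, |⟪x, β⟫| ^ (k β) with hr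
  have hrc : Continuous r := by
    refine continuous_finsetProd _ fun β hβ => ?_
    exact ((by fun_prop : Continuous fun x : E d => |⟪x, β⟫|)).rpow_const
      fun x => Or.inr (h.pos β (Finset.mem_of_mem_erase hβ)).le
  have hwr : ∀ x, wk R k x = |⟪α, x⟫| ^ (k α) * r x := by
    intro x
    rw [wk, ← Finset.mul_prod_erase R _ hα, real_inner_comm]
  obtain ⟨B, hB⟩ := (isCompact_closedBall (0 : E d) ρ).exists_bound_of_continuousOn
    hrc.continuousOn
  have hInt := (integrableOn_abs_inner_rpow (h.ne_zero α hα) (s := k α - 1)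
    (by linarith [h.pos α hα]) ρ).integrable_indicator Metric.isClosed_closedBall.measurableSet
  refine Integrable.mono' (hInt.const_mul (C * B)) ?_ (Eventually.of_forall fun x => ?_)
  · refine (hf.mul ?_).mul (continuous_wk h).aestronglyMeasurable
    have : Measurable fun x : E d => (⟪α, x⟫)⁻¹ := by fun_prop
    exact this.aestronglyMeasurable
  by_cases hx : x ∈ Metric.closedBall (0 : E d) ρ
  · rw [Set.indicator_of_mem hx, norm_mul, Real.norm_eq_abs, Real.norm_eq_abs,
      abs_of_nonneg (wk_nonneg x), hwr, abs_div]
    have hC0 : 0 ≤ C := (abs_nonneg _).trans (hC x)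
    have hrx : r x ≤ B := (le_abs_self _).trans (hB x hx)
    have hr0 : 0 ≤ r x := Finset.prod_nonneg fun _ _ => Real.rpow_nonneg (abs_nonneg _) _
    rcases eq_or_ne (⟪α, x⟫ : ℝ) 0 with h0 | h0
    · have h1 : 0 ≤ |(⟪α, x⟫ : ℝ)| ^ (k α - 1) := Real.rpow_nonneg (abs_nonneg _) _
      have : 0 ≤ C * B * |(⟪α, x⟫ : ℝ)| ^ (k α - 1) :=
        mul_nonneg (mul_nonneg hC0 (hr0.trans hrx)) h1
      simpa [h0] using this
    · have hpos : 0 < |(⟪α, x⟫ : ℝ)| := abs_pos.2 h0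
      have h2 : 0 ≤ |(⟪α, x⟫ : ℝ)| ^ (k α - 1) := Real.rpow_nonneg (abs_nonneg _) _
      calc |f x| / |⟪α, x⟫| * (|⟪α, x⟫| ^ k α * r x)
          = |f x| * r x * |⟪α, x⟫| ^ (k α - 1) := by
            rw [Real.rpow_sub_one hpos.ne']
            ring
        _ ≤ C * B * |⟪α, x⟫| ^ (k α - 1) := by
            gcongr
            exact hC x
  · rw [Set.indicator_of_notMem hx, hρ x (by simpa using hx)]
    simp

end Weight

section IntegrationByParts

variable {d : ℕ} {R : Finset (E d)} {k : E d → ℝ}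

theorem hasDerivAt_wk_line (x e : E d) {s : ℝ} (hs : ∀ α ∈ R, ⟪α, x + s • e⟫ ≠ 0) :
    HasDerivAt (fun s : ℝ => wk R k (x + s • e))
      ((∑ α ∈ R, k α * (⟪α, e⟫ / ⟪α, x + s • e⟫)) * wk R k (x + s • e)) s := by
  classical
  have h1 : ∀ α ∈ R, HasDerivAt (fun s : ℝ => |⟪x + s • e, α⟫| ^ (k α))
      (k α * (⟪α, e⟫ / ⟪α, x + s • e⟫) * |⟪x + s • e, α⟫| ^ (k α)) s := by
    intro α hα
    have h0 : (⟪x + s • e, α⟫ : ℝ) ≠ 0 := by rw [real_inner_comm]; exact hs α hα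
    have hl : HasDerivAt (fun s : ℝ => (⟪x + s • e, α⟫ : ℝ)) ⟪α, e⟫ s := by
      have : (fun s : ℝ => (⟪x + s • e, α⟫ : ℝ)) = fun s => ⟪x, α⟫ + s * ⟪α, e⟫ := by
        funext s
        rw [inner_add_left, inner_smul_left, real_inner_comm α e]
        rfl
      rw [this]
      simpa using ((hasDerivAt_id s).mul_const (⟪α, e⟫ : ℝ)).const_add (⟪x, α⟫ : ℝ)
    have h2 := ((hasDerivAt_abs h0).comp s hl).rpow_const (p := k α)
      (Or.inl (by simpa using h0))
    refine h2.congr_deriv ?_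
    have hpos : 0 < |(⟪x + s • e, α⟫ : ℝ)| := abs_pos.2 h0
    simp only [Function.comp]
    rw [Real.rpow_sub_one hpos.ne', real_inner_comm (x + s • e) α]
    have h3 : (SignType.sign (⟪x + s • e, α⟫ : ℝ) : ℝ) / |⟪x + s • e, α⟫|
        = 1 / ⟪x + s • e, α⟫ := by
      rw [div_eq_div_iff hpos.ne' h0, one_mul]
      exact sign_mul_self _
    calc _ = (SignType.sign (⟪x + s • e, α⟫ : ℝ) : ℝ) / |⟪x + s • e, α⟫| *
          (⟪α, e⟫ * k α * |⟪x + s • e, α⟫| ^ k α) := by ring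
      _ = _ := by rw [h3]; ring
  have h2 := HasDerivAt.fun_finsetProd h1
  refine h2.congr_deriv ?_
  rw [Finset.sum_mul]
  refine Finset.sum_congr rfl fun α hα => ?_
  rw [wk, ← Finset.mul_prod_erase R _ hα, smul_eq_mul]
  ring

theorem integral_fderiv_add_mul_wk_eq_zero (h : IsDunklData R k) {F : E d → ℝ}
    (hF : ContDiff ℝ 1 F) (hFs : HasCompactSupport F) (e : E d) :
    Integrable (fun x =>
      (fderiv ℝ F x e + ∑ α ∈ R, k α * (⟪α, e⟫ / ⟪α, x⟫) * F x) * wk R k x) ∧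
    ∫ x, (fderiv ℝ F x e + ∑ α ∈ R, k α * (⟪α, e⟫ / ⟪α, x⟫) * F x) * wk R k x = 0 := by
  set G : E d → ℝ := fun x => F x * wk R k x with hG
  set G' : E d → ℝ := fun x =>
    (fderiv ℝ F x e + ∑ α ∈ R, k α * (⟪α, e⟫ / ⟪α, x⟫) * F x) * wk R k x with hG'
  have hFc : Continuous F := hF.continuous
  have hF'c : Continuous fun x => fderiv ℝ F x e :=
    (hF.continuous_fderiv one_ne_zero).clm_apply continuous_const
  have hF's : HasCompactSupport fun x => fderiv ℝ F x e := hFs.fderiv_apply ℝ e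
  have hbd : ∀ {f : E d → ℝ}, Continuous f → HasCompactSupport f →
      ∃ C ρ : ℝ, (∀ x, |f x| ≤ C) ∧ ∀ x, ρ < ‖x‖ → f x = 0 := by
    intro f hf hfs
    obtain ⟨C, hC⟩ := hf.bounded_above_of_compact_support hfs
    obtain ⟨ρ, hρ⟩ := hfs.isCompact.isBounded.subset_closedBall (0 : E d)
    refine ⟨C, ρ, hC, fun x hx => ?_⟩
    by_contra hne
    have := hρ (subset_tsupport f hne)
    rw [mem_closedBall_zero_iff] at this
    linarith
  have hwc := continuous_wk h
  have hGi : Integrable G := by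
    obtain ⟨C, ρ, hC, hρ⟩ := hbd hFc hFs
    exact integrable_mul_wk h hFc.aestronglyMeasurable hC hρ
  have hG'i : Integrable G' := by
    obtain ⟨C, ρ, hC, hρ⟩ := hbd hF'c hF's
    obtain ⟨C₂, ρ₂, hC₂, hρ₂⟩ := hbd hFc hFs
    have h1 := integrable_mul_wk h hF'c.aestronglyMeasurable hC hρ
    have h2 : Integrable fun x => ∑ α ∈ R, (k α * ⟪α, e⟫) * (F x / ⟪α, x⟫ * wk R k x) :=
      integrable_finsetSum _ fun α hα =>
        (integrable_div_mul_wk h hα hFc.aestronglyMeasurable hC₂ hρ₂).const_mul _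
    refine (h1.add h2).congr (Eventually.of_forall fun x => ?_)
    simp only [hG', Pi.add_apply, add_mul, Finset.sum_mul]
    congr 1
    exact Finset.sum_congr rfl fun α _ => by ring
  have hG'm : Measurable G' := by
    have := hF'c.measurable
    have := hFc.measurable
    have := hwc.measurable
    simp only [hG']
    refine Measurable.mul (Measurable.add ‹_› ?_) ‹_›
    refine Finset.measurable_fun_sum _ fun α _ => ?_
    fun_prop
  have hprod : Integrable (Function.uncurry fun (x : E d) (s : ℝ) => G' (x + s • e))
      (volume.prod (volume.restrict (Set.Ioc (0 : ℝ) 1))) := by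
    rw [integrable_prod_iff']
    · refine ⟨Eventually.of_forall fun s => hG'i.comp_add_right (s • e), ?_⟩
      have : (fun s : ℝ => ∫ x, ‖Function.uncurry (fun (x : E d) (s : ℝ) => G' (x + s • e)) (x, s)‖)
          = fun _ => ∫ x, ‖G' x‖ := by
        funext s
        exact integral_add_right_eq_self (fun x => ‖G' x‖) (s • e)
      rw [this]
      exact integrable_const _
    · refine Measurable.aestronglyMeasurable ?_
      exact hG'm.comp (by fun_prop)
  have hline : ∀ᵐ x : E d, ∫ s in (0 : ℝ)..1, G' (x + s • e) = G (x + e) - G x := by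
    filter_upwards [ae_forall_inner_ne_zero h, hprod.prod_right_ae] with x hx hxi
    set S : Set ℝ := ⋃ α ∈ R, {s : ℝ | (⟪α, x + s • e⟫ : ℝ) = 0} with hS
    have hSc : S.Countable := by
      refine Set.Countable.biUnion R.countable_toSet fun α hα => ?_
      refine Set.Subsingleton.countable fun s hs t ht => ?_
      simp only [Set.mem_ofPred_eq, inner_add_right, inner_smul_right] at hs ht
      have h1 : (s - t) * ⟪α, e⟫ = 0 := by linarith
      rcases mul_eq_zero.1 h1 with h2 | h2
      · linarith
      · rw [h2] at hs
        exact absurd (by simpa using hs) (hx α hα)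
    have hFTC := integral_eq_of_hasDerivAt_off_countable (fun s : ℝ => G (x + s • e))
      (fun s : ℝ => G' (x + s • e)) (a := 0) (b := 1) hSc
      (by fun_prop) ?_ ((intervalIntegrable_iff_integrableOn_Ioc_of_le zero_le_one).2 hxi)
    · simpa using hFTC
    · intro s hs
      have hs' : ∀ α ∈ R, (⟪α, x + s • e⟫ : ℝ) ≠ 0 := by
        intro α hα h0
        exact hs.2 (Set.mem_biUnion hα h0)
      have hl : HasDerivAt (fun s : ℝ => x + s • e) e s := by
        simpa using ((hasDerivAt_id s).smul_const e).const_add x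
      have hFd : HasDerivAt (fun s : ℝ => F (x + s • e)) (fderiv ℝ F (x + s • e) e) s :=
        ((hF.differentiable one_ne_zero).differentiableAt.hasFDerivAt).comp_hasDerivAt s hl
      refine (hFd.mul (hasDerivAt_wk_line x e hs')).congr_deriv ?_
      simp only [hG', add_mul, Finset.sum_mul, Finset.mul_sum]
      congr 1
      exact Finset.sum_congr rfl fun α _ => by ring
  have h0 : ∫ x, ∫ s in (0 : ℝ)..1, G' (x + s • e) = 0 := by
    rw [integral_congr_ae hline, integral_sub (hGi.comp_add_right e) hGi,
      integral_add_right_eq_self, sub_self]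
  have h1 : ∫ x, ∫ s in (0 : ℝ)..1, G' (x + s • e) = ∫ x, G' x := by
    simp only [intervalIntegral.integral_of_le zero_le_one]
    rw [integral_integral_swap hprod]
    simp_rw [integral_add_right_eq_self]
    simp
  exact ⟨hG'i, by rw [← h1, h0]⟩



theorem lap_eq_sum_fderiv (u : E d → ℝ) (x : E d) :
    lap u x = ∑ i : Fin d, fderiv ℝ (fderiv ℝ u) x (EuclideanSpace.single i 1)
      (EuclideanSpace.single i 1) := by
  simp [lap, iteratedFDeriv_two_apply]

theorem inner_gradient_eq_fderiv (u : E d → ℝ) (x v : E d) :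
    ⟪gradient u x, v⟫ = fderiv ℝ u x v := by
  simp [gradient]

theorem sum_inner_single_mul (l : E d →L[ℝ] ℝ) (v : E d) :
    ∑ i : Fin d, ⟪v, EuclideanSpace.single i 1⟫ * l (EuclideanSpace.single i 1) = l v := by
  conv_rhs => rw [← (EuclideanSpace.basisFun (Fin d) ℝ).sum_repr' v]
  simp [map_sum, real_inner_comm]

theorem fderiv_eq_zero_of_outside {u : E d → ℝ} {ρ : ℝ} (hu : ∀ x, ρ < ‖x‖ → u x = 0) {x : E d}
    (hx : ρ < ‖x‖) : fderiv ℝ u x = 0 := by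
  have : u =ᶠ[𝓝 x] fun _ => 0 := by
    filter_upwards [(isOpen_lt continuous_const continuous_norm).mem_nhds hx] with y hy
    exact hu y hy
  rw [this.fderiv_eq]
  simp

theorem fderiv_fderiv_eq_zero_of_outside {u : E d → ℝ} {ρ : ℝ} (hu : ∀ x, ρ < ‖x‖ → u x = 0)
    {x : E d} (hx : ρ < ‖x‖) : fderiv ℝ (fderiv ℝ u) x = 0 := by
  have : fderiv ℝ u =ᶠ[𝓝 x] fun _ => 0 := by
    filter_upwards [(isOpen_lt continuous_const continuous_norm).mem_nhds hx] with y hy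
    exact fderiv_eq_zero_of_outside hu hy
  rw [this.fderiv_eq]
  simp

theorem exists_eq_zero_of_lt_norm {f : E d → ℝ} (hf : HasCompactSupport f) :
    ∃ ρ, ∀ x, ρ < ‖x‖ → f x = 0 := by
  obtain ⟨ρ, hρ⟩ := hf.isCompact.isBounded.subset_closedBall (0 : E d)
  refine ⟨ρ, fun x hx => ?_⟩
  by_contra hne
  exact hx.not_ge (mem_closedBall_zero_iff.1 (hρ (subset_tsupport f hne)))

theorem exists_forall_abs_le_of_outside {f : E d → ℝ} (hf : Continuous f) {ρ : ℝ}
    (hρ : ∀ x, ρ < ‖x‖ → f x = 0) : ∃ C, ∀ x, |f x| ≤ C := by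
  obtain ⟨C, hC⟩ := (isCompact_closedBall (0 : E d) ρ).exists_bound_of_continuousOn
    hf.continuousOn
  refine ⟨max C 0, fun x => ?_⟩
  rcases le_or_gt ‖x‖ ρ with hx | hx
  · exact (hC x (mem_closedBall_zero_iff.2 hx)).trans (le_max_left _ _)
  · simp [hρ x hx]

theorem exists_forall_abs_sub_dunklReflect_le {u : E d → ℝ} (hu : ContDiff ℝ 1 u) {α : E d}
    (hα : α ≠ 0) (ρ : ℝ) :
    ∃ C, 0 ≤ C ∧ ∀ x, ‖x‖ ≤ ρ → |u x - u (dunklReflect α x)| ≤ C * |⟪α, x⟫| := by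
  obtain ⟨C, hC⟩ := (isCompact_closedBall (0 : E d) ρ).exists_bound_of_continuousOn
    (hu.continuous_fderiv one_ne_zero).continuousOn
  refine ⟨max C 0 * (2 / ‖α‖), by positivity, fun x hx => ?_⟩
  have h1 := Convex.norm_image_sub_le_of_norm_fderiv_le (𝕜 := ℝ) (f := u) (C := max C 0)
    (s := Metric.closedBall (0 : E d) ρ) (x := x) (y := dunklReflect α x)
    (fun y _ => (hu.differentiable one_ne_zero).differentiableAt)
    (fun y hy => (hC y hy).trans (le_max_left _ _)) (convex_closedBall _ _)
    (mem_closedBall_zero_iff.2 hx)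
    (mem_closedBall_zero_iff.2 (by rwa [norm_dunklReflect]))
  rw [dist_dunklReflect_self hα, Real.norm_eq_abs, abs_sub_comm] at h1
  linarith

/-- Either `f` or `g` vanishes outside the closed ball of radius `ρ`. -/
def VanishOutside (ρ : ℝ) (f g : E d → ℝ) : Prop :=
  (∀ x, ρ < ‖x‖ → f x = 0) ∨ (∀ x, ρ < ‖x‖ → g x = 0)

variable {f g : E d → ℝ} {ρ : ℝ}

theorem integrable_mul_lap (h : IsDunklData R k) (hf : Continuous f) (hg : ContDiff ℝ 2 g)
    (hρ : VanishOutside ρ f g) : Integrable fun x => f x * lap g x * wk R k x := by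
  have hc : Continuous fun x => f x * lap g x := by
    refine hf.mul ?_
    simp only [funext (lap_eq_sum_fderiv g)]
    refine continuous_finsetSum _ fun i _ => ?_
    have h2 : Continuous (fderiv ℝ (fderiv ℝ g)) :=
      (hg.fderiv_right (m := 1) (by norm_num)).continuous_fderiv one_ne_zero
    fun_prop
  have hz : ∀ x, ρ < ‖x‖ → f x * lap g x = 0 := by
    intro x hx
    rcases hρ with h0 | h0
    · rw [h0 x hx, zero_mul]
    · rw [lap_eq_sum_fderiv, fderiv_fderiv_eq_zero_of_outside h0 hx]
      simp
  obtain ⟨C, hC⟩ := exists_forall_abs_le_of_outside hc hz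
  exact integrable_mul_wk h hc.aestronglyMeasurable hC hz

theorem integrable_mul_fderiv_div (h : IsDunklData R k) (hf : Continuous f)
    (hg : ContDiff ℝ 1 g) (hρ : VanishOutside ρ f g) {α : E d} (hα : α ∈ R) :
    Integrable fun x => f x * fderiv ℝ g x α / ⟪α, x⟫ * wk R k x := by
  have hc : Continuous fun x => f x * fderiv ℝ g x α :=
    hf.mul ((hg.continuous_fderiv one_ne_zero).clm_apply continuous_const)
  have hz : ∀ x, ρ < ‖x‖ → f x * fderiv ℝ g x α = 0 := by
    intro x hx
    rcases hρ with h0 | h0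
    · rw [h0 x hx, zero_mul]
    · rw [fderiv_eq_zero_of_outside h0 hx]
      simp
  obtain ⟨C, hC⟩ := exists_forall_abs_le_of_outside hc hz
  exact integrable_div_mul_wk h hα hc.aestronglyMeasurable hC hz

theorem integrable_mul_sub_dunklReflect_div (h : IsDunklData R k) (hf : Continuous f)
    (hg : ContDiff ℝ 1 g) (hρ : VanishOutside ρ f g) {α : E d} (hα : α ∈ R) :
    Integrable fun x => f x * (g x - g (dunklReflect α x)) / ⟪α, x⟫ ^ 2 * wk R k x := by
  have hc : Continuous fun x => f x * (g x - g (dunklReflect α x)) :=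
    hf.mul (hg.continuous.sub (hg.continuous.comp (continuous_dunklReflect α)))
  have hz : ∀ x, ρ < ‖x‖ → f x * (g x - g (dunklReflect α x)) / ⟪α, x⟫ = 0 := by
    intro x hx
    rcases hρ with h0 | h0
    · rw [h0 x hx, zero_mul, zero_div]
    · rw [h0 x hx, h0 _ (by rwa [norm_dunklReflect])]
      simp
  obtain ⟨B, hB⟩ := (isCompact_closedBall (0 : E d) ρ).exists_bound_of_continuousOn
    hf.continuousOn
  obtain ⟨C, hC0, hC⟩ := exists_forall_abs_sub_dunklReflect_le hg (h.ne_zero α hα) ρ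
  have hbd : ∀ x, |f x * (g x - g (dunklReflect α x)) / ⟪α, x⟫| ≤ max B 0 * C := by
    intro x
    rcases lt_or_ge ρ ‖x‖ with hx | hx
    · rw [hz x hx, abs_zero]
      positivity
    · rw [abs_div, abs_mul]
      refine div_le_of_le_mul₀ (abs_nonneg _) (by positivity) ?_
      rw [mul_assoc]
      gcongr
      · exact (hB x (mem_closedBall_zero_iff.2 hx)).trans (le_max_left _ _)
      · exact hC x hx
  have hm : AEStronglyMeasurable
      (fun x => f x * (g x - g (dunklReflect α x)) / (⟪α, x⟫ : ℝ)) volume := by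
    have h1 : Measurable fun x : E d => (⟪α, x⟫ : ℝ)⁻¹ := by fun_prop
    exact (hc.measurable.mul h1).aestronglyMeasurable
  refine (integrable_div_mul_wk h hα hm hbd hz).congr (Eventually.of_forall fun x => ?_)
  simp only
  rw [pow_two, div_div]

theorem mul_dunklLap_mul_wk_eq (f g : E d → ℝ) (x : E d) :
    f x * dunklLap R k g x * wk R k x = f x * lap g x * wk R k x +
      ∑ α ∈ R, (k α * (f x * fderiv ℝ g x α / ⟪α, x⟫ * wk R k x) -
        k α * (‖α‖ ^ 2 / 2) *
          (f x * (g x - g (dunklReflect α x)) / ⟪α, x⟫ ^ 2 * wk R k x)) := by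
  rw [dunklLap, mul_add, add_mul, Finset.mul_sum, Finset.sum_mul]
  congr 1
  refine Finset.sum_congr rfl fun α _ => ?_
  rw [inner_gradient_eq_fderiv]
  ring

theorem integrable_mul_dunklLap (h : IsDunklData R k) (hf : Continuous f)
    (hg : ContDiff ℝ 2 g) (hρ : VanishOutside ρ f g) :
    Integrable fun x => f x * dunklLap R k g x * wk R k x := by
  simp only [mul_dunklLap_mul_wk_eq f g]
  have hg1 : ContDiff ℝ 1 g := hg.of_le (by norm_num)
  refine (integrable_mul_lap h hf hg hρ).add (integrable_finsetSum _ fun α hα => ?_)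
  exact ((integrable_mul_fderiv_div h hf hg1 hρ hα).const_mul _).sub
    ((integrable_mul_sub_dunklReflect_div h hf hg1 hρ hα).const_mul _)

/-- The Dunkl Laplacian is symmetric with respect to the weighted measure `wk R k x dx`. -/
theorem integral_mul_dunklLap_comm (h : IsDunklData R k) (hf : ContDiff ℝ 2 f)
    (hg : ContDiff ℝ 2 g) (hgs : HasCompactSupport g) :
    ∫ x, f x * dunklLap R k g x * wk R k x = ∫ x, g x * dunklLap R k f x * wk R k x := by
  obtain ⟨ρ, hρ'⟩ := exists_eq_zero_of_lt_norm hgs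
  have hf1 : ContDiff ℝ 1 f := hf.of_le (by norm_num)
  have hg1 : ContDiff ℝ 1 g := hg.of_le (by norm_num)
  have hf' : ContDiff ℝ 1 (fderiv ℝ f) := hf.fderiv_right (by norm_num)
  have hg' : ContDiff ℝ 1 (fderiv ℝ g) := hg.fderiv_right (by norm_num)
  have v1 : VanishOutside ρ f g := Or.inr hρ'
  have v2 : VanishOutside ρ g f := Or.inl hρ'
  rw [← sub_eq_zero, ← integral_sub (integrable_mul_dunklLap h hf.continuous hg v1)
    (integrable_mul_dunklLap h hg.continuous hf v2)]
  set X : Fin d → E d → ℝ := fun i x => f x * fderiv ℝ g x (EuclideanSpace.single i 1) -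
    g x * fderiv ℝ f x (EuclideanSpace.single i 1) with hX
  have hXc : ∀ i, ContDiff ℝ 1 (X i) := fun i =>
    (hf1.mul (hg'.clm_apply contDiff_const)).sub (hg1.mul (hf'.clm_apply contDiff_const))
  have hXs : ∀ i, HasCompactSupport (X i) := fun i =>
    ((hgs.fderiv_apply ℝ _).mul_left).sub hgs.mul_right
  have hKL := fun i => integral_fderiv_add_mul_wk_eq_zero h (hXc i) (hXs i)
    (EuclideanSpace.single i 1)
  set A : E d → E d → ℝ := fun α x =>
    f x * (g x - g (dunklReflect α x)) / ⟪α, x⟫ ^ 2 * wk R k x -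
    g x * (f x - f (dunklReflect α x)) / ⟪α, x⟫ ^ 2 * wk R k x with hA
  have hAi : ∀ α ∈ R, Integrable (A α) := fun α hα =>
    (integrable_mul_sub_dunklReflect_div h hf.continuous hg1 v1 hα).sub
      (integrable_mul_sub_dunklReflect_div h hg.continuous hf1 v2 hα)
  have hA0 : ∀ α ∈ R, ∫ x, A α x = 0 := by
    intro α hα
    have h1 : ∀ x, A α (dunklReflect α x) = -A α x := by
      intro x
      simp only [hA, dunklReflect_dunklReflect, wk_dunklReflect h hα,
        inner_root_dunklReflect (h.ne_zero α hα)]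
      ring
    have h2 := integral_comp_dunklReflect α (A α)
    simp only [h1, integral_neg] at h2
    linarith
  have hX' : ∀ i x, fderiv ℝ (X i) x (EuclideanSpace.single i 1) =
      f x * fderiv ℝ (fderiv ℝ g) x (EuclideanSpace.single i 1) (EuclideanSpace.single i 1) -
      g x * fderiv ℝ (fderiv ℝ f) x (EuclideanSpace.single i 1) (EuclideanSpace.single i 1) := by
    intro i x
    have df := (hf1.differentiable one_ne_zero).differentiableAt (x := x) |>.hasFDerivAt
    have dg := (hg1.differentiable one_ne_zero).differentiableAt (x := x) |>.hasFDerivAt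
    have df' := ((hf'.differentiable one_ne_zero).differentiableAt (x := x)).hasFDerivAt.clm_apply
      (hasFDerivAt_const (EuclideanSpace.single i (1 : ℝ)) x)
    have dg' := ((hg'.differentiable one_ne_zero).differentiableAt (x := x)).hasFDerivAt.clm_apply
      (hasFDerivAt_const (EuclideanSpace.single i (1 : ℝ)) x)
    have := ((df.mul dg').sub (dg.mul df')).fderiv
    simp only [hX]
    erw [this]
    simp
    ring
  have hpt : ∀ x, f x * dunklLap R k g x * wk R k x - g x * dunklLap R k f x * wk R k x =
      (∑ i, (fderiv ℝ (X i) x (EuclideanSpace.single i 1) + ∑ α ∈ R, k α *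
        (⟪α, EuclideanSpace.single i 1⟫ / ⟪α, x⟫) * X i x) * wk R k x) -
      ∑ α ∈ R, k α * (‖α‖ ^ 2 / 2) * A α x := by
    intro x
    rw [mul_dunklLap_mul_wk_eq, mul_dunklLap_mul_wk_eq]
    simp only [add_mul, Finset.sum_add_distrib, hX', Finset.sum_mul]
    rw [Finset.sum_comm (s := Finset.univ) (t := R)]
    have h1 : ∀ α, ∑ i, k α * (⟪α, EuclideanSpace.single i 1⟫ / ⟪α, x⟫) * X i x * wk R k x =
        k α * (f x * fderiv ℝ g x α / ⟪α, x⟫ * wk R k x) -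
        k α * (g x * fderiv ℝ f x α / ⟪α, x⟫ * wk R k x) := by
      intro α
      rw [← sum_inner_single_mul (fderiv ℝ g x) α, ← sum_inner_single_mul (fderiv ℝ f x) α]
      simp only [hX, Finset.mul_sum, Finset.sum_mul, Finset.sum_div, ← Finset.sum_sub_distrib]
      exact Finset.sum_congr rfl fun i _ => by ring
    simp only [h1, lap_eq_sum_fderiv, Finset.mul_sum, Finset.sum_mul, hA, Finset.sum_sub_distrib,
      sub_mul, mul_sub]
    ring
  simp only [hpt]
  rw [integral_sub, integral_finsetSum, integral_finsetSum]
  · simp only [integral_const_mul]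
    rw [Finset.sum_eq_zero fun i _ => (hKL i).2, Finset.sum_eq_zero fun α hα => by
      rw [hA0 α hα, mul_zero], sub_zero]
  · exact fun α hα => (hAi α hα).const_mul _
  · exact fun i _ => (hKL i).1
  · exact integrable_finsetSum _ fun i _ => (hKL i).1
  · exact integrable_finsetSum _ fun α hα => (hAi α hα).const_mul _

end IntegrationByParts

section Extended

variable {d : ℕ} {R : Finset (E d)} {k : E d → ℝ}

/-- The contribution of the root `α` to the Dunkl Laplacian, extended by continuity to the
hyperplane orthogonal to `α`. -/
def dunklTerm (α : E d) (u : E d → ℝ) (x : E d) : ℝ :=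
  if ⟪α, x⟫ = 0 then fderiv ℝ (fderiv ℝ u) x α α / ‖α‖ ^ 2
  else fderiv ℝ u x α / ⟪α, x⟫ -
    ‖α‖ ^ 2 / 2 * ((u x - u (dunklReflect α x)) / ⟪α, x⟫ ^ 2)

/-- The Dunkl Laplacian, extended by continuity to the reflection hyperplanes. -/
def dunklExt (R : Finset (E d)) (k : E d → ℝ) (u : E d → ℝ) (x : E d) : ℝ :=
  lap u x + ∑ α ∈ R, k α * dunklTerm α u x

theorem dunklExt_eq_dunklLap (u : E d → ℝ) {x : E d} (hx : ∀ α ∈ R, ⟪α, x⟫ ≠ 0) :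
    dunklExt R k u x = dunklLap R k u x := by
  rw [dunklExt, dunklLap]
  congr 1
  refine Finset.sum_congr rfl fun α hα => ?_
  rw [dunklTerm, if_neg (hx α hα), inner_gradient_eq_fderiv]

theorem eventually_differentiableAt_of_contDiffAt {u : E d → ℝ} {x : E d}
    (hu : ContDiffAt ℝ 2 u x) : ∀ᶠ y in 𝓝 x, DifferentiableAt ℝ u y := by
  filter_upwards [hu.eventually (by simp)] with y hy
  exact hy.differentiableAt (by norm_num)

theorem differentiableAt_fderiv_of_contDiffAt {u : E d → ℝ} {x : E d}
    (hu : ContDiffAt ℝ 2 u x) : DifferentiableAt ℝ (fderiv ℝ u) x :=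
  (hu.fderiv_right (m := 1) (by norm_num)).differentiableAt (by norm_num)

theorem fderiv_add_const_mul {u v : E d → ℝ} {x : E d} (c : ℝ)
    (hu : DifferentiableAt ℝ u x) (hv : DifferentiableAt ℝ v x) :
    fderiv ℝ (fun y => u y + c * v y) x = fderiv ℝ u x + c • fderiv ℝ v x := by
  rw [fderiv_fun_add hu (hv.const_mul c), fderiv_const_mul hv]

theorem fderiv_fderiv_add_const_mul {u v : E d → ℝ} {x : E d} (c : ℝ)
    (hu : ContDiffAt ℝ 2 u x) (hv : ContDiffAt ℝ 2 v x) (a b : E d) :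
    fderiv ℝ (fderiv ℝ fun y => u y + c * v y) x a b =
      fderiv ℝ (fderiv ℝ u) x a b + c * fderiv ℝ (fderiv ℝ v) x a b := by
  have h : (fderiv ℝ fun y => u y + c * v y) =ᶠ[𝓝 x]
      fun y => fderiv ℝ u y + c • fderiv ℝ v y := by
    filter_upwards [eventually_differentiableAt_of_contDiffAt hu,
      eventually_differentiableAt_of_contDiffAt hv] with y h1 h2
    exact fderiv_add_const_mul c h1 h2
  rw [h.fderiv_eq, ((differentiableAt_fderiv_of_contDiffAt hu).hasFDerivAt.fun_add
    ((differentiableAt_fderiv_of_contDiffAt hv).hasFDerivAt.fun_const_smul c)).fderiv]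
  simp

theorem dunklExt_add_const_mul {u v : E d → ℝ} {x : E d} (c : ℝ)
    (hu : ContDiffAt ℝ 2 u x) (hv : ContDiffAt ℝ 2 v x) :
    dunklExt R k (fun y => u y + c * v y) x = dunklExt R k u x + c * dunklExt R k v x := by
  have hu1 := hu.differentiableAt (by norm_num)
  have hv1 := hv.differentiableAt (by norm_num)
  have h1 : ∀ α, dunklTerm α (fun y => u y + c * v y) x =
      dunklTerm α u x + c * dunklTerm α v x := by
    intro α
    simp only [dunklTerm, fderiv_fderiv_add_const_mul c hu hv, fderiv_add_const_mul c hu1 hv1,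
      add_apply, smul_apply, smul_eq_mul]
    split_ifs <;> ring
  simp only [dunklExt, lap_eq_sum_fderiv, h1, fderiv_fderiv_add_const_mul c hu hv, mul_add,
    Finset.sum_add_distrib, Finset.mul_sum, mul_left_comm c]
  ring

theorem fderiv_fderiv_apply_self_nonpos {h : E d → ℝ} {x : E d} (hh : ContDiffAt ℝ 2 h x)
    (hmax : IsLocalMax h x) (v : E d) : fderiv ℝ (fderiv ℝ h) x v v ≤ 0 := by
  by_contra! hpos
  set f : ℝ → ℝ := fun t => h (x + t • v) with hf
  have hline : ∀ t : ℝ, HasDerivAt (fun t : ℝ => x + t • v) v t := fun t => by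
    simpa using ((hasDerivAt_id t).smul_const v).const_add x
  have hlim : Tendsto (fun t : ℝ => x + t • v) (𝓝 0) (𝓝 x) := by
    simpa using (hline 0).continuousAt.tendsto
  have h1 : deriv f =ᶠ[𝓝 0] fun t => fderiv ℝ h (x + t • v) v := by
    filter_upwards [hlim.eventually (eventually_differentiableAt_of_contDiffAt hh)] with t ht
    exact (ht.hasFDerivAt.comp_hasDerivAt t (hline t)).deriv
  have h2 : deriv (deriv f) 0 = fderiv ℝ (fderiv ℝ h) x v v := by
    rw [h1.deriv_eq]
    have h3 : HasFDerivAt (fderiv ℝ h) (fderiv ℝ (fderiv ℝ h) x) (x + (0 : ℝ) • v) := by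
      simpa using (differentiableAt_fderiv_of_contDiffAt hh).hasFDerivAt
    have h4 := h3.comp_hasDerivAt (0 : ℝ) (hline 0)
    exact (h4.clm_apply (hasDerivAt_const (0 : ℝ) v)).deriv.trans (by simp)
  have hmax' : IsLocalMax f 0 := by
    have := hlim.eventually hmax
    simpa [IsLocalMax, IsMaxFilter, hf] using this
  have hmin : IsLocalMin f 0 := by
    refine isLocalMin_of_deriv_deriv_pos (by rw [h2]; exact hpos) hmax'.deriv_eq_zero ?_
    have : ContinuousAt h (x + (0 : ℝ) • v) := by simpa using hh.continuousAt
    exact ContinuousAt.comp (f := fun t : ℝ => x + t • v) this (hline 0).continuousAt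
  have hconst : f =ᶠ[𝓝 0] fun _ => f 0 := by
    filter_upwards [hmax', hmin] with t ht1 ht2 using le_antisymm ht1 ht2
  have h5 : deriv (deriv f) 0 = 0 := by
    have h6 : deriv f =ᶠ[𝓝 0] fun _ => 0 := by
      filter_upwards [hconst.eventually_nhds] with t ht
      rw [Filter.EventuallyEq.deriv_eq ht, deriv_const]
    rw [h6.deriv_eq, deriv_const]
  linarith

theorem dunklExt_nonpos_of_isLocalMax (hd : IsDunklData R k) {h : E d → ℝ} {x : E d}
    (hh : ContDiffAt ℝ 2 h x) (hmax : IsLocalMax h x)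
    (hrefl : ∀ α ∈ R, h (dunklReflect α x) ≤ h x) : dunklExt R k h x ≤ 0 := by
  have hlap : lap h x ≤ 0 := by
    rw [lap_eq_sum_fderiv]
    exact Finset.sum_nonpos fun i _ => fderiv_fderiv_apply_self_nonpos hh hmax _
  refine add_nonpos hlap (Finset.sum_nonpos fun α hα =>
    mul_nonpos_of_nonneg_of_nonpos (hd.pos α hα).le ?_)
  rw [dunklTerm]
  split_ifs with h0
  · exact div_nonpos_of_nonpos_of_nonneg (fderiv_fderiv_apply_self_nonpos hh hmax _) (by positivity)
  · rw [hmax.fderiv_eq_zero]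
    have := hrefl α hα
    have h1 : 0 ≤ ‖α‖ ^ 2 / 2 * ((h x - h (dunklReflect α x)) / ⟪α, x⟫ ^ 2) :=
      mul_nonneg (by positivity) (div_nonneg (by linarith) (by positivity))
    simpa using h1

/-- The homogeneous dimension of the Dunkl setting. -/
def dunklDim (R : Finset (E d)) (k : E d → ℝ) : ℝ := (d : ℝ) + ∑ α ∈ R, k α

theorem fderiv_comp_norm_sq {G : ℝ → ℝ} {x : E d} (hG : DifferentiableAt ℝ G (‖x‖ ^ 2)) :
    fderiv ℝ (fun y : E d => G (‖y‖ ^ 2)) x = (2 * deriv G (‖x‖ ^ 2)) • innerSL ℝ x := by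
  have h1 : HasFDerivAt (fun y : E d => ‖y‖ ^ 2) (2 • innerSL ℝ x) x :=
    (hasStrictFDerivAt_norm_sq x).hasFDerivAt
  have h2 : HasFDerivAt (fun y : E d => G (‖y‖ ^ 2)) _ x := hG.hasDerivAt.comp_hasFDerivAt x h1
  rw [h2.fderiv]
  ext v
  simp
  ring

theorem contDiffAt_comp_norm_sq {G : ℝ → ℝ} {x : E d} {n : WithTop ℕ∞}
    (hG : ContDiffAt ℝ n G (‖x‖ ^ 2)) :
    ContDiffAt ℝ n (fun y : E d => G (‖y‖ ^ 2)) x :=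
  ContDiffAt.comp x (f := fun y : E d => ‖y‖ ^ 2) hG (contDiff_norm_sq ℝ).contDiffAt

theorem differentiableAt_deriv_of_contDiffAt {G : ℝ → ℝ} {t : ℝ} (hG : ContDiffAt ℝ 2 G t) :
    DifferentiableAt ℝ (deriv G) t := by
  have h : DifferentiableAt ℝ (fderiv ℝ G) t :=
    (hG.fderiv_right (m := 1) (by norm_num)).differentiableAt (by norm_num)
  simpa only [fderiv_apply_one_eq_deriv] using h.clm_apply (differentiableAt_const (1 : ℝ))

theorem fderiv_fderiv_comp_norm_sq {G : ℝ → ℝ} {x : E d} (hG : ContDiffAt ℝ 2 G (‖x‖ ^ 2))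
    (a b : E d) :
    fderiv ℝ (fderiv ℝ fun y : E d => G (‖y‖ ^ 2)) x a b =
      4 * deriv (deriv G) (‖x‖ ^ 2) * ⟪x, a⟫ * ⟪x, b⟫ + 2 * deriv G (‖x‖ ^ 2) * ⟪a, b⟫ := by
  have hev : ∀ᶠ t in 𝓝 (‖x‖ ^ 2), DifferentiableAt ℝ G t := by
    filter_upwards [hG.eventually (by simp)] with y hy
    exact hy.differentiableAt (by norm_num)
  have hlim : Tendsto (fun y : E d => ‖y‖ ^ 2) (𝓝 x) (𝓝 (‖x‖ ^ 2)) :=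
    (continuous_norm.pow 2).continuousAt
  have h1 : (fderiv ℝ fun y : E d => G (‖y‖ ^ 2)) =ᶠ[𝓝 x]
      fun y => (2 * deriv G (‖y‖ ^ 2)) • innerSL ℝ y := by
    filter_upwards [hlim.eventually hev] with y hy using fderiv_comp_norm_sq hy
  have hG' : DifferentiableAt ℝ (deriv G) (‖x‖ ^ 2) :=
    differentiableAt_deriv_of_contDiffAt hG
  have h2 : HasFDerivAt (fun y : E d => 2 * deriv G (‖y‖ ^ 2))
      ((2 : ℝ) • ((2 * deriv (deriv G) (‖x‖ ^ 2)) • innerSL ℝ x)) x := by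
    have h3 := fderiv_comp_norm_sq hG'
    have h4 : DifferentiableAt ℝ (fun y : E d => deriv G (‖y‖ ^ 2)) x :=
      DifferentiableAt.comp x (f := fun y : E d => ‖y‖ ^ 2) hG'
        ((contDiff_norm_sq ℝ (n := 1)).differentiable one_ne_zero x)
    have h5 := h4.hasFDerivAt.const_mul 2
    rwa [h3] at h5
  rw [h1.fderiv_eq, (h2.fun_smul (innerSL ℝ (E := E d)).hasFDerivAt).fderiv]
  simp only [add_apply, smul_apply, ContinuousLinearMap.smulRight_apply, smul_eq_mul,
    innerSL_apply_apply]
  erw [innerSL_apply_apply, innerSL_apply_apply]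
  ring

theorem dunklExt_comp_norm_sq (hd : IsDunklData R k) {G : ℝ → ℝ} {x : E d}
    (hG : ContDiffAt ℝ 2 G (‖x‖ ^ 2)) :
    dunklExt R k (fun y => G (‖y‖ ^ 2)) x =
      4 * ‖x‖ ^ 2 * deriv (deriv G) (‖x‖ ^ 2) + 2 * dunklDim R k * deriv G (‖x‖ ^ 2) := by
  have h1 : ∀ α ∈ R, dunklTerm α (fun y => G (‖y‖ ^ 2)) x = 2 * deriv G (‖x‖ ^ 2) := by
    intro α hα
    have hα0 : ‖α‖ ≠ 0 := norm_ne_zero_iff.2 (hd.ne_zero α hα)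
    rw [dunklTerm, fderiv_fderiv_comp_norm_sq hG,
      fderiv_comp_norm_sq (hG.differentiableAt (by norm_num)), norm_dunklReflect]
    split_ifs with h0
    · rw [real_inner_comm, h0, real_inner_self_eq_norm_sq]
      field_simp
      ring
    · simp only [smul_apply, innerSL_apply_apply, smul_eq_mul,
        real_inner_comm α x]
      field_simp
      ring
  have h2 : lap (fun y : E d => G (‖y‖ ^ 2)) x =
      4 * ‖x‖ ^ 2 * deriv (deriv G) (‖x‖ ^ 2) + 2 * d * deriv G (‖x‖ ^ 2) := by
    have h3 := sum_inner_single_mul (innerSL ℝ x) x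
    simp only [innerSL_apply_apply, real_inner_self_eq_norm_sq] at h3
    simp only [lap_eq_sum_fderiv, fderiv_fderiv_comp_norm_sq hG, Finset.sum_add_distrib, mul_assoc,
      ← Finset.mul_sum, h3]
    simp
    ring
  rw [dunklExt, h2, Finset.sum_congr rfl fun α hα => by rw [h1 α hα], ← Finset.sum_mul, dunklDim]
  ring

end Extended

section Polynomials

variable {d : ℕ} {R : Finset (E d)} {k : E d → ℝ}

theorem fderiv_fderiv_mul {u v : E d → ℝ} {x : E d}
    (hu : ContDiffAt ℝ 2 u x) (hv : ContDiffAt ℝ 2 v x) (a b : E d) :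
    fderiv ℝ (fderiv ℝ fun y => u y * v y) x a b =
      u x * fderiv ℝ (fderiv ℝ v) x a b + fderiv ℝ u x a * fderiv ℝ v x b +
        fderiv ℝ v x a * fderiv ℝ u x b + v x * fderiv ℝ (fderiv ℝ u) x a b := by
  have h : (fderiv ℝ fun y => u y * v y) =ᶠ[𝓝 x]
      fun y => u y • fderiv ℝ v y + v y • fderiv ℝ u y := by
    filter_upwards [eventually_differentiableAt_of_contDiffAt hu,
      eventually_differentiableAt_of_contDiffAt hv] with y h1 h2
    exact fderiv_fun_mul h1 h2
  have hu1 := (hu.differentiableAt (by norm_num)).hasFDerivAt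
  have hv1 := (hv.differentiableAt (by norm_num)).hasFDerivAt
  rw [h.fderiv_eq,
    ((hu1.fun_smul (differentiableAt_fderiv_of_contDiffAt hv).hasFDerivAt).fun_add
      (hv1.fun_smul (differentiableAt_fderiv_of_contDiffAt hu).hasFDerivAt)).fderiv]
  simp
  ring

theorem dunklExt_comp_norm_sq_mul (hd : IsDunklData R k) {G : ℝ → ℝ} {q : E d → ℝ} {x : E d}
    (hG : ContDiffAt ℝ 2 G (‖x‖ ^ 2)) (hq : ContDiffAt ℝ 2 q x) :
    dunklExt R k (fun y => G (‖y‖ ^ 2) * q y) x =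
      G (‖x‖ ^ 2) * dunklExt R k q x +
        q x * (4 * ‖x‖ ^ 2 * deriv (deriv G) (‖x‖ ^ 2) +
          2 * dunklDim R k * deriv G (‖x‖ ^ 2)) +
        4 * deriv G (‖x‖ ^ 2) * fderiv ℝ q x x := by
  have hu := contDiffAt_comp_norm_sq hG
  have hG1 := hG.differentiableAt (by norm_num)
  have hu1 := hu.differentiableAt (by norm_num)
  have hq1 := hq.differentiableAt (by norm_num)
  have h1 : ∀ α ∈ R, dunklTerm α (fun y => G (‖y‖ ^ 2) * q y) x =
      G (‖x‖ ^ 2) * dunklTerm α q x + q x * (2 * deriv G (‖x‖ ^ 2)) := by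
    intro α hα
    have hα0 : ‖α‖ ≠ 0 := norm_ne_zero_iff.2 (hd.ne_zero α hα)
    rw [dunklTerm, fderiv_fderiv_mul hu hq, fderiv_fderiv_comp_norm_sq hG, fderiv_fun_mul hu1 hq1,
      fderiv_comp_norm_sq hG1, norm_dunklReflect, dunklTerm]
    simp only [add_apply, smul_apply, innerSL_apply_apply, smul_eq_mul, real_inner_comm α x,
      real_inner_self_eq_norm_sq]
    split_ifs with h0
    · rw [h0]
      field_simp
      ring
    · field_simp
      ring
  have h2 : lap (fun y : E d => G (‖y‖ ^ 2) * q y) x =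
      G (‖x‖ ^ 2) * lap q x +
        q x * (4 * ‖x‖ ^ 2 * deriv (deriv G) (‖x‖ ^ 2) + 2 * d * deriv G (‖x‖ ^ 2)) +
        4 * deriv G (‖x‖ ^ 2) * fderiv ℝ q x x := by
    have h3 := sum_inner_single_mul (innerSL ℝ x) x
    have h4 := sum_inner_single_mul (fderiv ℝ q x) x
    simp only [innerSL_apply_apply, real_inner_self_eq_norm_sq] at h3
    have h5 : ∀ i : Fin d, fderiv ℝ (fderiv ℝ fun y : E d => G (‖y‖ ^ 2) * q y) x
        (EuclideanSpace.single i 1) (EuclideanSpace.single i 1) =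
        G (‖x‖ ^ 2) * fderiv ℝ (fderiv ℝ q) x
          (EuclideanSpace.single i 1) (EuclideanSpace.single i 1) +
        4 * deriv G (‖x‖ ^ 2) *
          (⟪x, EuclideanSpace.single i 1⟫ * fderiv ℝ q x (EuclideanSpace.single i 1)) +
        q x * (4 * deriv (deriv G) (‖x‖ ^ 2)) *
          (⟪x, EuclideanSpace.single i 1⟫ * ⟪x, EuclideanSpace.single i 1⟫) +
        q x * 2 * deriv G (‖x‖ ^ 2) := by
      intro i
      rw [fderiv_fderiv_mul hu hq, fderiv_fderiv_comp_norm_sq hG, fderiv_comp_norm_sq hG1]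
      simp only [smul_apply, innerSL_apply_apply, smul_eq_mul, real_inner_self_eq_norm_sq,
        PiLp.norm_single, norm_one]
      ring
    simp only [lap_eq_sum_fderiv, h5, Finset.sum_add_distrib, ← Finset.mul_sum, h3, h4]
    simp
    ring
  have h3 : ∑ α ∈ R, k α * dunklTerm α (fun y => G (‖y‖ ^ 2) * q y) x =
      G (‖x‖ ^ 2) * ∑ α ∈ R, k α * dunklTerm α q x +
        q x * (2 * deriv G (‖x‖ ^ 2)) * ∑ α ∈ R, k α := by
    rw [Finset.mul_sum, Finset.mul_sum, ← Finset.sum_add_distrib]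
    refine Finset.sum_congr rfl fun α hα => ?_
    rw [h1 α hα]
    ring
  rw [dunklExt, h2, h3, dunklExt, dunklDim]
  ring

/-- If `-c ≤ Δ_k p` in a ball and `p ≤ s` on its boundary, then `p` is bounded from above. -/
theorem le_of_neg_le_dunklExt (hd : IsDunklData R k) (hm : 0 < dunklDim R k) {p : E d → ℝ}
    (hp : ContDiff ℝ 2 p) {ρ c s : ℝ} (hρ : 0 ≤ ρ) (hc : ∀ x, ‖x‖ < ρ → -c ≤ dunklExt R k p x)
    (hs : ∀ x, ‖x‖ = ρ → p x ≤ s) (hc0 : 0 ≤ c) {x : E d} (hx : ‖x‖ ≤ ρ) :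
    p x ≤ s + c / (2 * dunklDim R k) * ρ ^ 2 := by
  have key : ∀ c' > c, p x ≤ s + c' / (2 * dunklDim R k) * ρ ^ 2 := by
    intro c' hc'
    set b := c' / (2 * dunklDim R k) with hb
    have hb0 : 0 ≤ b := div_nonneg (hc0.trans (le_of_lt hc')) (by positivity)
    have hbm : 2 * dunklDim R k * b = c' := by rw [hb]; field_simp
    have hN : ContDiff ℝ 2 fun y : E d => ‖y‖ ^ 2 := contDiff_norm_sq ℝ
    have hh : ContDiff ℝ 2 fun y => p y + b * ‖y‖ ^ 2 := hp.add (contDiff_const.mul hN)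
    obtain ⟨x0, hx0, hmax⟩ := (isCompact_closedBall (0 : E d) ρ).exists_isMaxOn
      ⟨0, by simpa using hρ⟩ hh.continuous.continuousOn
    rw [mem_closedBall_zero_iff] at hx0
    have hmax' : ∀ y : E d, ‖y‖ ≤ ρ → p y + b * ‖y‖ ^ 2 ≤ p x0 + b * ‖x0‖ ^ 2 :=
      fun y hy => hmax (mem_closedBall_zero_iff.2 hy)
    have hx0' : ‖x0‖ = ρ := by
      by_contra hne
      have hlt : ‖x0‖ < ρ := lt_of_le_of_ne hx0 hne
      have hloc : IsLocalMax (fun y => p y + b * ‖y‖ ^ 2) x0 := by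
        filter_upwards [(isOpen_lt continuous_norm continuous_const).mem_nhds hlt] with y hy
        exact hmax' y (le_of_lt hy)
      have h1 := dunklExt_nonpos_of_isLocalMax hd hh.contDiffAt hloc
        fun α _ => hmax' _ ((norm_dunklReflect α x0).le.trans hx0)
      have h2 := dunklExt_comp_norm_sq hd (x := x0) (contDiffAt_id (𝕜 := ℝ) (n := 2))
      rw [dunklExt_add_const_mul b hp.contDiffAt hN.contDiffAt] at h1
      simp only [id, deriv_id', deriv_const, deriv_id] at h2
      rw [h2] at h1
      have h3 := hc x0 hlt
      nlinarith
    have h4 := hmax' x hx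
    have h5 := hs x0 hx0'
    rw [hx0'] at h4
    nlinarith [mul_nonneg hb0 (sq_nonneg ‖x‖)]
  have hlim : Tendsto (fun c' => s + c' / (2 * dunklDim R k) * ρ ^ 2) (𝓝[>] c)
      (𝓝 (s + c / (2 * dunklDim R k) * ρ ^ 2)) := by
    have : Continuous fun c' => s + c' / (2 * dunklDim R k) * ρ ^ 2 := by fun_prop
    exact this.continuousAt.tendsto.mono_left nhdsWithin_le_nhds
  exact ge_of_tendsto hlim (by filter_upwards [self_mem_nhdsWithin] with c' hc' using key c' hc')

theorem abs_le_of_abs_dunklExt_le (hd : IsDunklData R k) (hm : 0 < dunklDim R k) {p : E d → ℝ}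
    (hp : ContDiff ℝ 2 p) {ρ c s : ℝ} (hρ : 0 ≤ ρ) (hc : ∀ x, ‖x‖ < ρ → |dunklExt R k p x| ≤ c)
    (hs : ∀ x, ‖x‖ = ρ → |p x| ≤ s) (hc0 : 0 ≤ c) {x : E d} (hx : ‖x‖ ≤ ρ) :
    |p x| ≤ s + c / (2 * dunklDim R k) * ρ ^ 2 := by
  have hneg : ∀ y, dunklExt R k (fun y => -p y) y = -dunklExt R k p y := by
    intro y
    have h1 := dunklExt_add_const_mul (R := R) (k := k) (-2) (hp.contDiffAt (x := y))
      hp.contDiffAt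
    calc dunklExt R k (fun y => -p y) y = dunklExt R k (fun y => p y + -2 * p y) y := by
          congr 1; ext; ring
      _ = _ := by rw [h1]; ring
  refine abs_le'.2 ⟨le_of_neg_le_dunklExt hd hm hp hρ (fun y hy => (abs_le.1 (hc y hy)).1)
    (fun y hy => (abs_le.1 (hs y hy)).2) hc0 hx,
    le_of_neg_le_dunklExt hd hm hp.neg hρ (fun y hy => ?_)
    (fun y hy => by linarith [(abs_le.1 (hs y hy)).1]) hc0 hx⟩
  have := (abs_le.1 (hc y hy)).2
  change -c ≤ dunklExt R k (fun y => -p y) y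
  rw [hneg]
  linarith

/-- The space of affine functions on `E d`. -/
def affineSpace (d : ℕ) : Submodule ℝ (E d → ℝ) where
  carrier := {f | ∃ (c : ℝ) (v : E d), f = fun x => c + ⟪v, x⟫}
  zero_mem' := ⟨0, 0, by ext; simp⟩
  add_mem' := by
    rintro _ _ ⟨c, v, rfl⟩ ⟨c', v', rfl⟩
    exact ⟨c + c', v + v', by ext x; simp only [Pi.add_apply, inner_add_left]; ring⟩
  smul_mem' := by
    rintro a _ ⟨c, v, rfl⟩
    exact ⟨a * c, a • v, by ext x; simp [inner_smul_left, mul_add]⟩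

/-- The space of polynomial functions of degree at most `n - 2`
(the zero space for `n = 0` and `n = 1`). -/
def polySpace (d : ℕ) : ℕ → Submodule ℝ (E d → ℝ)
  | 0 => ⊥
  | 1 => ⊥
  | n + 2 => affineSpace d ^ n

theorem one_mem_affineSpace : (1 : E d → ℝ) ∈ affineSpace d := ⟨1, 0, by ext; simp⟩

theorem inner_mem_affineSpace (v : E d) : (fun x => ⟪v, x⟫) ∈ affineSpace d :=
  ⟨0, v, by ext; simp⟩

theorem mul_mem_polySpace {n : ℕ} {l q : E d → ℝ} (hl : l ∈ affineSpace d)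
    (hq : q ∈ polySpace d n) : (fun x => l x * q x) ∈ polySpace d (n + 1) := by
  match n, hq with
  | 0, hq =>
    rw [(Submodule.mem_bot ℝ).1 hq]
    simp only [Pi.zero_apply, mul_zero]
    exact (polySpace d 1).zero_mem
  | 1, hq =>
    rw [(Submodule.mem_bot ℝ).1 hq]
    simp only [Pi.zero_apply, mul_zero]
    exact (polySpace d 2).zero_mem
  | n + 2, hq =>
    change _ ∈ affineSpace d ^ (n + 1)
    rw [pow_succ']
    exact Submodule.mul_mem_mul hl hq

theorem polySpace_le_succ (n : ℕ) : polySpace d n ≤ polySpace d (n + 1) := fun q hq => by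
  simpa using mul_mem_polySpace one_mem_affineSpace hq

theorem finiteDimensional_polySpace (n : ℕ) : FiniteDimensional ℝ (polySpace d n) := by
  have hA : (affineSpace d).FG := by
    let L : (ℝ × E d) →ₗ[ℝ] (E d → ℝ) :=
      { toFun := fun p x => p.1 + ⟪p.2, x⟫
        map_add' := fun p q => by
          ext x; simp only [Prod.fst_add, Prod.snd_add, inner_add_left, Pi.add_apply]; ring
        map_smul' := fun a p => by
          ext x; simp [inner_smul_left, mul_add] }
    have : affineSpace d = LinearMap.range L := by
      ext f
      constructor
      · rintro ⟨c, v, rfl⟩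
        exact ⟨(c, v), rfl⟩
      · rintro ⟨⟨c, v⟩, rfl⟩
        exact ⟨c, v, rfl⟩
    rw [this, LinearMap.range_eq_map]
    exact (Module.finite_def.1 inferInstance).map L
  match n with
  | 0 => exact inferInstanceAs (FiniteDimensional ℝ (⊥ : Submodule ℝ (E d → ℝ)))
  | 1 => exact inferInstanceAs (FiniteDimensional ℝ (⊥ : Submodule ℝ (E d → ℝ)))
  | n + 2 => exact Module.Finite.iff_fg.2 (hA.pow n)

theorem polySpace_induction {C : ℕ → (E d → ℝ) → Prop}
    (hconst : ∀ c : ℝ, C 0 fun _ => c)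
    (hadd : ∀ n p q, C n p → C n q → C n fun x => p x + q x)
    (hmul : ∀ n (c : ℝ) (v : E d) p, p ∈ polySpace d (n + 2) → C n p →
      C (n + 1) fun x => (c + ⟪v, x⟫) * p x)
    (n : ℕ) {p : E d → ℝ} (hp : p ∈ polySpace d (n + 2)) : C n p := by
  induction n generalizing p with
  | zero =>
    change p ∈ affineSpace d ^ 0 at hp
    rw [pow_zero] at hp
    obtain ⟨c, rfl⟩ := Submodule.mem_one.1 hp
    exact hconst c
  | succ n ih =>
    change p ∈ affineSpace d ^ (n + 1) at hp
    rw [pow_succ'] at hp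
    refine Submodule.mul_induction_on hp ?_ fun p q => hadd _ p q
    rintro _ ⟨c, v, rfl⟩ q hq
    exact hmul n c v q hq (ih hq)

theorem contDiff_of_mem_polySpace {n : ℕ} {p : E d → ℝ} (hp : p ∈ polySpace d n)
    {r : WithTop ℕ∞} : ContDiff ℝ r p := by
  have hp2 := polySpace_le_succ _ (polySpace_le_succ _ hp)
  refine polySpace_induction (C := fun _ p => ContDiff ℝ r p) (fun c => contDiff_const)
    (fun n p q hp hq => hp.add hq) (fun n c v p _ hp => ?_) n hp2
  exact (contDiff_const.add (innerSL ℝ v).contDiff).mul hp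

end Polynomials

section PolynomialOperators

variable {d : ℕ} {R : Finset (E d)} {k : E d → ℝ}

theorem fderiv_affine (c : ℝ) (v x : E d) :
    fderiv ℝ (fun y : E d => c + ⟪v, y⟫) x = innerSL ℝ v := by
  rw [fderiv_const_add]
  exact (innerSL ℝ v).fderiv

theorem fderiv_fderiv_affine (c : ℝ) (v x : E d) :
    fderiv ℝ (fderiv ℝ fun y : E d => c + ⟪v, y⟫) x = 0 := by
  rw [funext (fderiv_affine c v)]
  exact fderiv_const_apply _

theorem contDiff_affine (c : ℝ) (v : E d) {n : WithTop ℕ∞} :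
    ContDiff ℝ n fun y : E d => c + ⟪v, y⟫ :=
  contDiff_const.add (innerSL ℝ v).contDiff

/-- Polynomials are mapped to polynomials by each of the terms of the Dunkl Laplacian. -/
theorem exists_dunklTerm_eq {α : E d} (hα : α ≠ 0) {n : ℕ} {p : E d → ℝ}
    (hp : p ∈ polySpace d (n + 2)) :
    ∃ q ∈ polySpace d (n + 1), ∃ r ∈ polySpace d n,
      (∀ x, p x - p (dunklReflect α x) = ⟪α, x⟫ * q x) ∧
      (∀ x, fderiv ℝ p x α - ‖α‖ ^ 2 / 2 * q x = ⟪α, x⟫ * r x) ∧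
      ∀ x, ⟪α, x⟫ = 0 → fderiv ℝ (fderiv ℝ p) x α α = r x * ‖α‖ ^ 2 := by
  have hα0 : ‖α‖ ≠ 0 := norm_ne_zero_iff.2 hα
  refine polySpace_induction (C := fun n p => ∃ q ∈ polySpace d (n + 1), ∃ r ∈ polySpace d n,
      (∀ x, p x - p (dunklReflect α x) = ⟪α, x⟫ * q x) ∧
      (∀ x, fderiv ℝ p x α - ‖α‖ ^ 2 / 2 * q x = ⟪α, x⟫ * r x) ∧
      (∀ x, ⟪α, x⟫ = 0 → fderiv ℝ (fderiv ℝ p) x α α = r x * ‖α‖ ^ 2) ∧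
      ContDiff ℝ 2 p) ?_ ?_ ?_ n hp |>.imp ?_
  · intro c
    refine ⟨0, zero_mem _, 0, zero_mem _, ?_, ?_, ?_, contDiff_const⟩
    · simp
    · simp
    · intro x _
      have : fderiv ℝ (fun _ : E d => c) = fun _ => 0 := by ext; simp
      simp [this]
  · rintro n p p' ⟨q, hq, r, hr, h1, h2, h3, h4⟩ ⟨q', hq', r', hr', h1', h2', h3', h4'⟩
    have hd1 : ∀ x, fderiv ℝ (fun x => p x + p' x) x = fderiv ℝ p x + fderiv ℝ p' x := fun x =>
      fderiv_fun_add (h4.differentiable (by norm_num) x) (h4'.differentiable (by norm_num) x)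
    refine ⟨q + q', add_mem hq hq', r + r', add_mem hr hr', fun x => ?_, fun x => ?_,
      fun x hx => ?_, h4.add h4'⟩
    · simp only [Pi.add_apply]
      linear_combination h1 x + h1' x
    · simp only [Pi.add_apply, hd1, add_apply]
      linear_combination h2 x + h2' x
    · rw [funext hd1, fderiv_fun_add (differentiableAt_fderiv_of_contDiffAt h4.contDiffAt)
        (differentiableAt_fderiv_of_contDiffAt h4'.contDiffAt)]
      simp only [Pi.add_apply, add_apply]
      linear_combination h3 x hx + h3' x hx
  · rintro n c v p hp ⟨q, hq, r, hr, h1, h2, h3, h4⟩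
    have hl : (fun x => c + ⟪v, x⟫) ∈ affineSpace d := ⟨c, v, rfl⟩
    have hσ : (fun x => p (dunklReflect α x)) ∈ polySpace d (n + 2) := by
      have : (fun x => p (dunklReflect α x)) = p - fun x => ⟪α, x⟫ * q x := by
        ext x
        simp only [Pi.sub_apply]
        linear_combination -h1 x
      rw [this]
      exact sub_mem hp (mul_mem_polySpace (inner_mem_affineSpace α) hq)
    have hd1 : ∀ x, fderiv ℝ (fun x => (c + ⟪v, x⟫) * p x) x α =
        (c + ⟪v, x⟫) * fderiv ℝ p x α + p x * ⟪v, α⟫ := by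
      intro x
      rw [fderiv_fun_mul ((contDiff_affine c v (n := 1)).differentiable one_ne_zero x)
        (h4.differentiable (by norm_num) x), fderiv_affine]
      simp
    refine ⟨_, add_mem (mul_mem_polySpace hl hq)
      ((polySpace d (n + 2)).smul_mem (2 * ⟪v, α⟫ / ‖α‖ ^ 2) hσ),
      _, add_mem (mul_mem_polySpace hl hr) ((polySpace d (n + 1)).smul_mem ⟪v, α⟫ hq),
      fun x => ?_, fun x => ?_, fun x hx => ?_, (contDiff_affine c v).mul h4⟩
    · have h5 : ⟪v, dunklReflect α x⟫ = ⟪v, x⟫ - 2 * ⟪α, x⟫ / ‖α‖ ^ 2 * ⟪v, α⟫ := by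
        rw [dunklReflect, inner_sub_right, inner_smul_right]
      simp only [Pi.add_apply, Pi.smul_apply, smul_eq_mul, h5]
      linear_combination (c + ⟪v, x⟫) * h1 x
    · simp only [Pi.add_apply, Pi.smul_apply, smul_eq_mul, hd1]
      have : ‖α‖ ^ 2 / 2 * (2 * ⟪v, α⟫ / ‖α‖ ^ 2 * p (dunklReflect α x)) =
          ⟪v, α⟫ * p (dunklReflect α x) := by field_simp
      linear_combination (c + ⟪v, x⟫) * h2 x + ⟪v, α⟫ * h1 x - this
    · rw [fderiv_fderiv_mul (contDiff_affine c v).contDiffAt h4.contDiffAt, fderiv_affine,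
        fderiv_fderiv_affine]
      simp only [Pi.add_apply, Pi.smul_apply, smul_eq_mul, innerSL_apply_apply, zero_apply]
      have h6 := h2 x
      rw [hx] at h6
      linear_combination (c + ⟪v, x⟫) * h3 x hx + 2 * ⟪v, α⟫ * h6
  · rintro q ⟨hq, r, hr, h1, h2, h3, -⟩
    exact ⟨hq, r, hr, h1, h2, h3⟩

theorem dunklTerm_mem_polySpace {α : E d} (hα : α ≠ 0) {n : ℕ} {p : E d → ℝ}
    (hp : p ∈ polySpace d (n + 2)) : dunklTerm α p ∈ polySpace d n := by
  have hα0 : ‖α‖ ≠ 0 := norm_ne_zero_iff.2 hα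
  obtain ⟨q, -, r, hr, h1, h2, h3⟩ := exists_dunklTerm_eq hα hp
  convert hr using 1
  ext x
  rw [dunklTerm]
  split_ifs with h0
  · rw [h3 x h0]
    field_simp
  · rw [h1]
    field_simp
    linear_combination 2 * h2 x

theorem fderiv_apply_mem_polySpace (a : E d) {n : ℕ} {p : E d → ℝ}
    (hp : p ∈ polySpace d (n + 1)) : (fun x => fderiv ℝ p x a) ∈ polySpace d n := by
  match n, hp with
  | 0, hp =>
    rw [(Submodule.mem_bot ℝ).1 hp]
    convert (polySpace d 0).zero_mem using 1
    ext x
    simp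
  | n + 1, hp =>
    refine (polySpace_induction (C := fun n p => (fun x => fderiv ℝ p x a) ∈ polySpace d (n + 1) ∧
      ContDiff ℝ 1 p) ?_ ?_ ?_ n hp).1
    · intro c
      refine ⟨?_, contDiff_const⟩
      convert (polySpace d 1).zero_mem using 1
      ext x
      simp
    · rintro n p p' ⟨h1, h2⟩ ⟨h1', h2'⟩
      refine ⟨?_, h2.add h2'⟩
      convert add_mem h1 h1' using 1
      ext x
      rw [fderiv_fun_add (h2.differentiable one_ne_zero x) (h2'.differentiable one_ne_zero x)]
      simp
    · rintro n c v p hp ⟨h1, h2⟩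
      refine ⟨?_, (contDiff_affine c v).mul h2⟩
      convert add_mem (mul_mem_polySpace ⟨c, v, rfl⟩ h1)
        ((polySpace d (n + 2)).smul_mem ⟪v, a⟫ hp) using 1
      ext x
      rw [fderiv_fun_mul ((contDiff_affine c v (n := 1)).differentiable one_ne_zero x)
        (h2.differentiable one_ne_zero x), fderiv_affine]
      simp
      ring

theorem lap_mem_polySpace {n : ℕ} {p : E d → ℝ} (hp : p ∈ polySpace d (n + 2)) :
    lap p ∈ polySpace d n := by
  have hp2 : ContDiff ℝ 2 p := contDiff_of_mem_polySpace hp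
  have h : lap p = ∑ i : Fin d, fun x => fderiv ℝ (fun y => fderiv ℝ p y
      (EuclideanSpace.single i 1)) x (EuclideanSpace.single i 1) := by
    ext x
    rw [lap_eq_sum_fderiv, Finset.sum_apply]
    refine Finset.sum_congr rfl fun i _ => ?_
    rw [fderiv_clm_apply (differentiableAt_fderiv_of_contDiffAt hp2.contDiffAt)
      (differentiableAt_const _)]
    simp
  rw [h]
  exact sum_mem fun i _ => fderiv_apply_mem_polySpace _ (fderiv_apply_mem_polySpace _ hp)

theorem dunklExt_mem_polySpace (hd : IsDunklData R k) {n : ℕ} {p : E d → ℝ}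
    (hp : p ∈ polySpace d (n + 2)) : dunklExt R k p ∈ polySpace d n := by
  have h : dunklExt R k p = lap p + ∑ α ∈ R, k α • dunklTerm α p := by
    ext x
    simp [dunklExt, Finset.sum_apply]
  rw [h]
  exact add_mem (lap_mem_polySpace hp) (sum_mem fun α hα =>
    (polySpace d n).smul_mem _ (dunklTerm_mem_polySpace (hd.ne_zero α hα) hp))

theorem norm_sq_mul_mem_polySpace {n : ℕ} {q : E d → ℝ} (hq : q ∈ polySpace d n) :
    (fun x => ‖x‖ ^ 2 * q x) ∈ polySpace d (n + 2) := by
  have h : (fun x => ‖x‖ ^ 2 * q x) = ∑ i : Fin d, fun x =>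
      ⟪EuclideanSpace.single i 1, x⟫ * (⟪EuclideanSpace.single i 1, x⟫ * q x) := by
    ext x
    rw [Finset.sum_apply, EuclideanSpace.norm_sq_eq, Finset.sum_mul]
    refine Finset.sum_congr rfl fun i _ => ?_
    rw [EuclideanSpace.inner_single_left, Real.norm_eq_abs, sq_abs]
    simp
    ring
  rw [h]
  exact sum_mem fun i _ => mul_mem_polySpace (inner_mem_affineSpace _)
    (mul_mem_polySpace (inner_mem_affineSpace _) hq)

theorem sub_norm_sq_mul_mem_polySpace (ρ : ℝ) {n : ℕ} {q : E d → ℝ} (hq : q ∈ polySpace d n) :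
    (fun x => (ρ ^ 2 - ‖x‖ ^ 2) * q x) ∈ polySpace d (n + 2) := by
  have h : (fun x => (ρ ^ 2 - ‖x‖ ^ 2) * q x) = ρ ^ 2 • q - fun x => ‖x‖ ^ 2 * q x := by
    ext x
    simp
    ring
  rw [h]
  exact sub_mem ((polySpace d _).smul_mem _ (polySpace_le_succ _ (polySpace_le_succ _ hq)))
    (norm_sq_mul_mem_polySpace hq)

/-- The Dirichlet problem for the Dunkl Laplacian in a ball can be solved in the space of
polynomials. -/
theorem exists_polySpace_dunklExt_eq (hd : IsDunklData R k) (hm : 0 < dunklDim R k) {ρ : ℝ}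
    (hρ : 0 < ρ) {n : ℕ} {p : E d → ℝ} (hp : p ∈ polySpace d n) :
    ∃ q ∈ polySpace d n, ∀ x, dunklExt R k (fun x => (ρ ^ 2 - ‖x‖ ^ 2) * q x) x = p x := by
  have := finiteDimensional_polySpace (d := d) n
  have hC : ∀ q : polySpace d n, ContDiff ℝ 2 fun x => (ρ ^ 2 - ‖x‖ ^ 2) * (q : E d → ℝ) x :=
    fun q => contDiff_of_mem_polySpace (sub_norm_sq_mul_mem_polySpace ρ q.2)
  let T : polySpace d n →ₗ[ℝ] polySpace d n :=
    { toFun := fun q => ⟨dunklExt R k fun x => (ρ ^ 2 - ‖x‖ ^ 2) * (q : E d → ℝ) x,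
        dunklExt_mem_polySpace hd (sub_norm_sq_mul_mem_polySpace ρ q.2)⟩
      map_add' := by
        intro q q'
        ext x
        have h1 := dunklExt_add_const_mul (R := R) (k := k) 1 (hC q).contDiffAt
          (hC q').contDiffAt (x := x)
        simp only [Submodule.coe_add, Pi.add_apply, mul_add, one_mul] at h1 ⊢
        exact h1
      map_smul' := by
        intro a q
        ext x
        have h1 := dunklExt_add_const_mul (R := R) (k := k) (a - 1) (hC q).contDiffAt
          (hC q).contDiffAt (x := x)
        have h2 : (fun x => (ρ ^ 2 - ‖x‖ ^ 2) * (a • q : polySpace d n).1 x) = fun x =>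
            (ρ ^ 2 - ‖x‖ ^ 2) * q.1 x + (a - 1) * ((ρ ^ 2 - ‖x‖ ^ 2) * q.1 x) := by
          ext x
          simp
          ring
        change dunklExt R k (fun x => (ρ ^ 2 - ‖x‖ ^ 2) * (a • q : polySpace d n).1 x) x =
          a * dunklExt R k (fun x => (ρ ^ 2 - ‖x‖ ^ 2) * q.1 x) x
        rw [h2, h1]
        ring }
  have hinj : Function.Injective T := by
    rw [injective_iff_map_eq_zero]
    intro q hq
    have h0 : ∀ x, dunklExt R k (fun x => (ρ ^ 2 - ‖x‖ ^ 2) * (q : E d → ℝ) x) x = 0 := fun x =>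
      congrFun (congrArg Subtype.val hq) x
    have h1 : ∀ x : E d, ‖x‖ < ρ → (q : E d → ℝ) x = 0 := by
      intro x hx
      have h2 := abs_le_of_abs_dunklExt_le hd hm (hC q) (ρ := ρ) (c := 0) (s := 0) hρ.le
        (fun y _ => by simp [h0 y]) (fun y hy => by simp [hy]) le_rfl hx.le
      have h3 : (ρ ^ 2 - ‖x‖ ^ 2) * (q : E d → ℝ) x = 0 :=
        abs_nonpos_iff.1 (by simpa only [zero_div, zero_mul, add_zero] using h2)
      have h4 : ρ ^ 2 - ‖x‖ ^ 2 ≠ 0 := by nlinarith [norm_nonneg x]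
      exact (mul_eq_zero.1 h3).resolve_left h4
    have h5 : AnalyticOnNhd ℝ (q : E d → ℝ) Set.univ :=
      (contDiff_of_mem_polySpace q.2).analyticOnNhd
    have h6 : (q : E d → ℝ) = 0 := by
      refine h5.eq_of_eventuallyEq (z₀ := 0) (fun _ _ => analyticAt_const) ?_
      filter_upwards [Metric.ball_mem_nhds (0 : E d) hρ] with x hx
      exact h1 x (by simpa using hx)
    exact Subtype.ext h6
  obtain ⟨q, hq⟩ := LinearMap.injective_iff_surjective.1 hinj ⟨p, hp⟩
  exact ⟨q, q.2, fun x => congrFun (congrArg Subtype.val hq) x⟩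

end PolynomialOperators

section Density

variable {d : ℕ}

theorem polySpace_mono : Monotone (polySpace d) := monotone_nat_of_le_succ polySpace_le_succ

theorem exists_add_mem_polySpace {p q : E d → ℝ} (hp : ∃ n, p ∈ polySpace d n)
    (hq : ∃ n, q ∈ polySpace d n) : ∃ n, p + q ∈ polySpace d n := by
  obtain ⟨n, hn⟩ := hp
  obtain ⟨m, hm⟩ := hq
  exact ⟨max n m, add_mem (polySpace_mono (le_max_left n m) hn)
    (polySpace_mono (le_max_right n m) hm)⟩

theorem exists_mul_mem_polySpace {p q : E d → ℝ} (hp : ∃ n, p ∈ polySpace d n)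
    (hq : ∃ n, q ∈ polySpace d n) : ∃ n, p * q ∈ polySpace d n := by
  obtain ⟨n, hn⟩ := hp
  obtain ⟨m, hm⟩ := hq
  have hn2 : p ∈ affineSpace d ^ n := polySpace_mono (Nat.le_add_right n 2) hn
  have hm2 : q ∈ affineSpace d ^ m := polySpace_mono (Nat.le_add_right m 2) hm
  refine ⟨n + m + 2, ?_⟩
  change p * q ∈ affineSpace d ^ (n + m)
  rw [pow_add]
  exact Submodule.mul_mem_mul hn2 hm2

/-- Polynomials are dense in the space of continuous functions on a ball. -/
theorem exists_polySpace_near {ρ : ℝ} {f : E d → ℝ} (hf : ContinuousOn f (Metric.closedBall 0 ρ))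
    {δ : ℝ} (hδ : 0 < δ) :
    ∃ n, ∃ p ∈ polySpace d n, ∀ x, ‖x‖ ≤ ρ → |p x - f x| < δ := by
  let K : Set (E d) := Metric.closedBall 0 ρ
  have hK : CompactSpace K := isCompact_iff_compactSpace.1 (isCompact_closedBall _ _)
  let e : E d → C(K, ℝ) := fun v => ⟨fun x => ⟪v, (x : E d)⟫, by fun_prop⟩
  let A : Subalgebra ℝ C(K, ℝ) := Algebra.adjoin ℝ (Set.range e)
  have hA : A.SeparatesPoints := by
    intro x y hxy
    refine ⟨_, ⟨e (x - y), Algebra.subset_adjoin ⟨_, rfl⟩, rfl⟩, fun h => hxy ?_⟩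
    have h2 : ⟪(x : E d) - y, (x : E d)⟫ = ⟪(x : E d) - y, (y : E d)⟫ := h
    have h3 : ⟪(x : E d) - y, (x : E d) - y⟫ = 0 := by rw [inner_sub_right, h2, sub_self]
    exact Subtype.ext (sub_eq_zero.1 (inner_self_eq_zero.1 h3))
  have hpoly : ∀ g ∈ A, ∃ p : E d → ℝ, (∃ n, p ∈ polySpace d n) ∧ ∀ x : K, p x = g x := by
    intro g hg
    induction hg using Algebra.adjoin_induction with
    | mem g hg =>
      obtain ⟨v, rfl⟩ := hg
      refine ⟨fun x => ⟪v, x⟫, ⟨3, ?_⟩, fun x => rfl⟩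
      change _ ∈ affineSpace d ^ 1
      rw [pow_one]
      exact inner_mem_affineSpace v
    | algebraMap c =>
      refine ⟨fun _ => c, ⟨2, ?_⟩, fun x => rfl⟩
      change _ ∈ affineSpace d ^ 0
      rw [pow_zero]
      exact Submodule.mem_one.2 ⟨c, rfl⟩
    | add g g' _ _ h h' =>
      obtain ⟨p, hp, h1⟩ := h
      obtain ⟨p', hp', h1'⟩ := h'
      exact ⟨p + p', exists_add_mem_polySpace hp hp', fun x => by simp [h1, h1']⟩
    | mul g g' _ _ h h' =>
      obtain ⟨p, hp, h1⟩ := h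
      obtain ⟨p', hp', h1'⟩ := h'
      exact ⟨p * p', exists_mul_mem_polySpace hp hp', fun x => by simp [h1, h1']⟩
  obtain ⟨⟨g, hg⟩, hgf⟩ := ContinuousMap.exists_mem_subalgebra_near_continuous_of_separatesPoints
    A hA (fun x : K => f x) (continuousOn_iff_continuous_domRestrict.1 hf) δ hδ
  obtain ⟨p, ⟨n, hn⟩, hp⟩ := hpoly g hg
  refine ⟨n, p, hn, fun x hx => ?_⟩
  have := hgf ⟨x, mem_closedBall_zero_iff.2 hx⟩
  rw [← Real.norm_eq_abs, hp ⟨x, mem_closedBall_zero_iff.2 hx⟩]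
  exact this

end Density

section Cutoff

/-- Smooth convex approximations of the function `t ↦ max (b - t) 0`. -/
theorem exists_smooth_cutoff (b : ℝ) {ε : ℝ} (hε : 0 < ε) :
    ∃ G : ℝ → ℝ, ContDiff ℝ (⊤ : ℕ∞) G ∧ (∀ t, b - ε ≤ t → G t = 0) ∧
      (∀ t, -1 ≤ deriv G t ∧ deriv G t ≤ 0) ∧ (∀ t, 0 ≤ deriv (deriv G) t) ∧
      (∀ t, t < b - 2 * ε → deriv G t = -1 ∧ deriv (deriv G) t = 0) ∧
      ∀ t, t ≤ b → |G t - (b - t)| ≤ 2 * ε := by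
  set c := b - ε with hc
  set χ : ℝ → ℝ := fun t => -Real.smoothTransition ((c - t) / ε) with hχ
  have hχs : ContDiff ℝ (⊤ : ℕ∞) χ :=
    (Real.smoothTransition.contDiff.comp (by fun_prop : ContDiff ℝ (⊤ : ℕ∞)
      fun t : ℝ => (c - t) / ε)).neg
  set G : ℝ → ℝ := fun t => ∫ s in c..t, χ s with hG
  have hder : ∀ t, HasDerivAt G (χ t) t := fun t =>
    intervalIntegral.integral_hasDerivAt_right (hχs.continuous.intervalIntegrable _ _)
      (hχs.continuous.stronglyMeasurableAtFilter _ _) hχs.continuous.continuousAt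
  have hderiv : deriv G = χ := funext fun t => (hder t).deriv
  have hdiff : Differentiable ℝ G := fun t => (hder t).differentiableAt
  have h0 : ∀ t, c ≤ t → χ t = 0 := fun t ht => by
    simp only [hχ, neg_eq_zero]
    exact Real.smoothTransition.zero_of_nonpos (div_nonpos_of_nonpos_of_nonneg (by linarith) hε.le)
  have h1 : ∀ t, t ≤ c - ε → χ t = -1 := fun t ht => by
    simp only [hχ, neg_inj]
    exact Real.smoothTransition.one_of_one_le ((le_div_iff₀ hε).2 (by linarith))
  have hb : ∀ t, -1 ≤ χ t ∧ χ t ≤ 0 := fun t =>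
    ⟨neg_le_neg (Real.smoothTransition.le_one _), neg_nonpos.2 (Real.smoothTransition.nonneg _)⟩
  have hmono : Monotone χ := fun s t hst =>
    neg_le_neg (Real.smoothTransition.monotone (by gcongr))
  have hGc : ∀ t, c ≤ t → G t = 0 := by
    intro t ht
    simp only [hG]
    rw [intervalIntegral.integral_congr (g := fun _ => 0)]
    · simp
    · intro s hs
      rw [Set.uIcc_of_le ht] at hs
      exact h0 s hs.1
  have hG' : ∀ t, HasDerivAt (fun t => G t + t) (χ t + 1) t := fun t =>
    (hder t).add (hasDerivAt_id t)
  have hfm : Monotone fun t => G t + t :=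
    monotone_of_deriv_nonneg (fun t => (hG' t).differentiableAt) fun t => by
      rw [(hG' t).deriv]
      linarith [(hb t).1]
  have hanti : Antitone G := antitone_of_deriv_nonpos hdiff fun t => by
    rw [hderiv]
    exact (hb t).2
  refine ⟨G, ?_, hGc, by rwa [hderiv], fun t => ?_, fun t ht => ?_, fun t ht => ?_⟩
  · rw [contDiff_infty_iff_deriv, hderiv]
    exact ⟨hdiff, hχs⟩
  · rw [hderiv]
    exact hmono.deriv_nonneg
  · have ht' : t < c - ε := by linarith
    rw [hderiv]
    refine ⟨h1 t ht'.le, ?_⟩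
    have : χ =ᶠ[𝓝 t] fun _ => -1 := by
      filter_upwards [Iio_mem_nhds ht'] with s hs using h1 s (le_of_lt hs)
    rw [this.deriv_eq, deriv_const]
  · have h2 : G t + t ≤ G b + b := hfm ht
    rw [hGc b (by linarith)] at h2
    have h3 : b - 2 * ε ≤ G t + t := by
      rcases le_total c t with h | h
      · rw [hGc t h]
        linarith
      · rcases le_total (c - ε) t with h' | h'
        · have := hanti h
          rw [hGc c le_rfl] at this
          linarith
        · have h4 := (convex_Iic (c - ε)).norm_image_sub_le_of_norm_hasDerivWithin_le (C := 0)
            (fun s _ => (hG' s).hasDerivWithinAt) (fun s hs => by simp [h1 s hs]) h'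
            (Set.self_mem_Iic)
          have h5 : G (c - ε) + (c - ε) - (G t + t) = 0 := by simpa using h4
          have h6 := hanti (show c - ε ≤ c by linarith)
          rw [hGc c le_rfl] at h6
          linarith
    exact abs_le.2 ⟨by linarith, by linarith⟩

end Cutoff

section Uniqueness

variable {d : ℕ} {R : Finset (E d)} {k : E d → ℝ}

theorem dunklLap_const (c : ℝ) (x : E d) : dunklLap R k (fun _ => c) x = 0 := by
  have h1 : fderiv ℝ (fun _ : E d => c) = fun _ => 0 := by ext; simp
  simp [dunklLap, lap_eq_sum_fderiv, h1]

theorem integral_dunklLap_eq_zero (h : IsDunklData R k) {g : E d → ℝ} (hg : ContDiff ℝ 2 g)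
    (hgs : HasCompactSupport g) : ∫ x, dunklLap R k g x * wk R k x = 0 := by
  have := integral_mul_dunklLap_comm h (contDiff_const (c := (1 : ℝ))) hg hgs
  simpa [dunklLap_const] using this

theorem hasCompactSupport_of_outside {g : E d → ℝ} {ρ : ℝ} (hρ : ∀ x, ρ < ‖x‖ → g x = 0) :
    HasCompactSupport g :=
  HasCompactSupport.intro (isCompact_closedBall (0 : E d) ρ) fun x hx =>
    hρ x (by simpa using hx)

theorem ae_dunklExt_eq_dunklLap (h : IsDunklData R k) (u : E d → ℝ) :
    ∀ᵐ x, dunklExt R k u x = dunklLap R k u x := by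
  filter_upwards [ae_forall_inner_ne_zero h] with x hx using dunklExt_eq_dunklLap u hx

theorem integrable_indicator_wk (h : IsDunklData R k) (ρ : ℝ) :
    Integrable ((Metric.closedBall (0 : E d) ρ).indicator (wk R k)) :=
  (integrable_indicator_iff measurableSet_closedBall).2
    ((continuous_wk h).continuousOn.integrableOn_compact (isCompact_closedBall _ _))

end Uniqueness

section Uniqueness

variable {d : ℕ} {R : Finset (E d)} {k : E d → ℝ}

theorem two_le_coe_top : (2 : WithTop ℕ∞) ≤ ((⊤ : ℕ∞) : WithTop ℕ∞) :=
  WithTop.coe_le_coe.2 le_top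

theorem deriv_eq_zero_of_forall_ge {G : ℝ → ℝ} {a : ℝ} (hG : ∀ t, a ≤ t → G t = 0) {t : ℝ}
    (ht : a < t) : deriv G t = 0 := by
  have : G =ᶠ[𝓝 t] fun _ => 0 := by
    filter_upwards [Ioi_mem_nhds ht] with s hs using hG s (le_of_lt hs)
  rw [this.deriv_eq, deriv_const]

theorem sq_le_sq_norm {ρ : ℝ} (hρ : 0 < ρ) {x : E d} (hx : ρ < ‖x‖) : ρ ^ 2 < ‖x‖ ^ 2 := by
  gcongr

theorem integral_norm_sq_mul_deriv_deriv_le (hd : IsDunklData R k) (hm : 0 < dunklDim R k)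
    {ρ ε : ℝ} (hρ : 0 < ρ) (hε : 0 < ε) {G : ℝ → ℝ} (hG : ContDiff ℝ (⊤ : ℕ∞) G)
    (hG0 : ∀ t, ρ ^ 2 - ε ≤ t → G t = 0) (hG1 : ∀ t, -1 ≤ deriv G t ∧ deriv G t ≤ 0) :
    Integrable (fun x : E d => 4 * ‖x‖ ^ 2 * deriv (deriv G) (‖x‖ ^ 2) * wk R k x) ∧
      ∫ x : E d, 4 * ‖x‖ ^ 2 * deriv (deriv G) (‖x‖ ^ 2) * wk R k x ≤
        2 * dunklDim R k * ∫ x, (Metric.closedBall (0 : E d) ρ).indicator (wk R k) x := by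
  have hG' : ContDiff ℝ (⊤ : ℕ∞) (deriv G) := (contDiff_infty_iff_deriv.1 hG).2
  have hG'' : ContDiff ℝ (⊤ : ℕ∞) (deriv (deriv G)) := (contDiff_infty_iff_deriv.1 hG').2
  have hout : ∀ x : E d, ρ < ‖x‖ → ρ ^ 2 - ε < ‖x‖ ^ 2 := fun x hx => by
    linarith [sq_le_sq_norm hρ hx]
  have h1 : ∀ x : E d, ρ < ‖x‖ → deriv G (‖x‖ ^ 2) = 0 := fun x hx =>
    deriv_eq_zero_of_forall_ge hG0 (hout x hx)
  have h2 : ∀ x : E d, ρ < ‖x‖ → 4 * ‖x‖ ^ 2 * deriv (deriv G) (‖x‖ ^ 2) = 0 := by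
    intro x hx
    have h3 := sq_le_sq_norm hρ hx
    rw [deriv_eq_zero_of_forall_ge (a := ρ ^ 2)
      (fun t ht => deriv_eq_zero_of_forall_ge hG0 (by linarith)) h3, mul_zero]
  have hc1 : Continuous fun x : E d => deriv G (‖x‖ ^ 2) := hG'.continuous.comp (by fun_prop)
  have hc2 : Continuous fun x : E d => 4 * ‖x‖ ^ 2 * deriv (deriv G) (‖x‖ ^ 2) :=
    (by fun_prop : Continuous fun x : E d => 4 * ‖x‖ ^ 2).mul
      (hG''.continuous.comp (by fun_prop))
  obtain ⟨C, hC⟩ := exists_forall_abs_le_of_outside hc2 h2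
  have hi1 : Integrable fun x : E d => deriv G (‖x‖ ^ 2) * wk R k x :=
    integrable_mul_wk hd hc1.aestronglyMeasurable
      (fun x => abs_le.2 ⟨(hG1 _).1, (hG1 _).2.trans zero_le_one⟩) h1
  have hi2 := integrable_mul_wk hd hc2.aestronglyMeasurable hC h2
  refine ⟨hi2, ?_⟩
  have hg : ContDiff ℝ 2 fun x : E d => G (‖x‖ ^ 2) :=
    (hG.of_le two_le_coe_top).comp (contDiff_norm_sq ℝ)
  have h0 := integral_dunklLap_eq_zero hd hg (hasCompactSupport_of_outside (ρ := ρ)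
    fun x hx => hG0 _ (hout x hx).le)
  have h3 : ∫ x, dunklLap R k (fun x : E d => G (‖x‖ ^ 2)) x * wk R k x =
      ∫ x : E d, (4 * ‖x‖ ^ 2 * deriv (deriv G) (‖x‖ ^ 2) * wk R k x +
        2 * dunklDim R k * (deriv G (‖x‖ ^ 2) * wk R k x)) := by
    refine integral_congr_ae ?_
    filter_upwards [ae_dunklExt_eq_dunklLap hd fun x : E d => G (‖x‖ ^ 2)] with x hx
    rw [← hx, dunklExt_comp_norm_sq hd (hG.of_le two_le_coe_top).contDiffAt]
    ring
  rw [h3, integral_add hi2 (hi1.const_mul _), integral_const_mul] at h0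
  have h4 : -∫ x : E d, deriv G (‖x‖ ^ 2) * wk R k x ≤
      ∫ x, (Metric.closedBall (0 : E d) ρ).indicator (wk R k) x := by
    rw [← integral_neg]
    refine integral_mono hi1.neg (integrable_indicator_wk hd ρ) fun x => ?_
    rcases le_or_gt ‖x‖ ρ with hx | hx
    · rw [Set.indicator_of_mem (mem_closedBall_zero_iff.2 hx)]
      nlinarith [wk_nonneg (R := R) (k := k) x, (hG1 (‖x‖ ^ 2)).1]
    · rw [Set.indicator_of_notMem (by simpa using hx)]
      simp [h1 x hx]
  nlinarith

theorem integral_mul_dunklExt_sub_norm_sq_mul_eq_zero (hd : IsDunklData R k)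
    (hm : 0 < dunklDim R k) {ρ : ℝ} (hρ : 0 < ρ) {z : E d → ℝ} (hz : Continuous z)
    (hz0 : ∀ x, ρ ≤ ‖x‖ → z x = 0)
    (hzψ : ∀ ψ : E d → ℝ, ContDiff ℝ (⊤ : ℕ∞) ψ → (∀ x, ρ ≤ ‖x‖ → ψ x = 0) →
      ∫ x, z x * dunklLap R k ψ x * wk R k x = 0)
    {n : ℕ} {q : E d → ℝ} (hq : q ∈ polySpace d n) :
    ∫ x, z x * dunklExt R k (fun x => (ρ ^ 2 - ‖x‖ ^ 2) * q x) x * wk R k x = 0 := by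
  have hqs : ∀ {r : WithTop ℕ∞}, ContDiff ℝ r q := contDiff_of_mem_polySpace hq
  have hLq : Continuous (dunklExt R k q) := (contDiff_of_mem_polySpace (r := 0)
    (dunklExt_mem_polySpace hd (polySpace_le_succ _ (polySpace_le_succ _ hq)))).continuous
  have hDq : Continuous fun x => fderiv ℝ q x x :=
    ((hqs (r := 1)).continuous_fderiv one_ne_zero).clm_apply continuous_id
  have hbd : ∀ f : E d → ℝ, Continuous f → ∃ C, ∀ x, ‖x‖ ≤ ρ → |f x| ≤ C := fun f hf => by
    obtain ⟨C, hC⟩ := (isCompact_closedBall (0 : E d) ρ).exists_bound_of_continuousOn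
      hf.continuousOn
    exact ⟨C, fun x hx => hC x (mem_closedBall_zero_iff.2 hx)⟩
  obtain ⟨C, hC0, hCq, hCL, hCD⟩ : ∃ C, 0 ≤ C ∧ (∀ x, ‖x‖ ≤ ρ → |q x| ≤ C) ∧
      (∀ x, ‖x‖ ≤ ρ → |dunklExt R k q x| ≤ C) ∧ ∀ x, ‖x‖ ≤ ρ → |fderiv ℝ q x x| ≤ C := by
    obtain ⟨C1, h1⟩ := hbd q (hqs (r := 0)).continuous
    obtain ⟨C2, h2⟩ := hbd _ hLq
    obtain ⟨C3, h3⟩ := hbd _ hDq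
    refine ⟨max (max C1 C2) C3, ?_, fun x hx => ?_, fun x hx => ?_, fun x hx => ?_⟩
    · exact (abs_nonneg _).trans ((h3 0 (by simpa using hρ.le)).trans (le_max_right _ _))
    · exact (h1 x hx).trans ((le_max_left _ _).trans (le_max_left _ _))
    · exact (h2 x hx).trans ((le_max_right _ _).trans (le_max_left _ _))
    · exact (h3 x hx).trans (le_max_right _ _)
  obtain ⟨Z, hZ⟩ := hbd z hz
  have hZ0 : 0 ≤ Z := (abs_nonneg _).trans (hZ 0 (by simpa using hρ.le))
  set m := dunklDim R k with hmdef
  set W := ∫ x, (Metric.closedBall (0 : E d) ρ).indicator (wk R k) x with hW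
  set I := ∫ x, z x * dunklExt R k (fun x => (ρ ^ 2 - ‖x‖ ^ 2) * q x) x * wk R k x with hI
  have hInt : ∀ f : E d → ℝ, ContDiff ℝ 2 f →
      Integrable fun x => z x * dunklExt R k f x * wk R k x := fun f hf =>
    (integrable_mul_dunklLap hd hz hf (Or.inl fun x hx => hz0 x (le_of_lt hx))).congr (by
      filter_upwards [ae_dunklExt_eq_dunklLap hd f] with x hx
      rw [hx])
  have hζ : ContDiff ℝ 2 fun x => (ρ ^ 2 - ‖x‖ ^ 2) * q x :=
    contDiff_of_mem_polySpace (sub_norm_sq_mul_mem_polySpace ρ hq)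
  have key : ∀ η > 0, |I| ≤ η * ((2 * C * Z + C * (2 * m + 4) + C * (2 * m)) * W) := by
    intro η hη
    obtain ⟨τ, hτ0, hτ⟩ : ∃ τ, 0 < τ ∧ ∀ x : E d, ‖x‖ ≤ ρ → ρ ^ 2 - ‖x‖ ^ 2 < τ → |z x| ≤ η := by
      have hcpt : IsCompact (Metric.closedBall (0 : E d) ρ ∩ {x | η ≤ |z x|}) :=
        (isCompact_closedBall _ _).inter_right (isClosed_le continuous_const hz.abs)
      obtain ⟨τ, h1, h2⟩ := hcpt.exists_forall_le' (f := fun x : E d => ρ ^ 2 - ‖x‖ ^ 2) (a := 0)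
        (by fun_prop) (fun x hx => by
          have h3 : ‖x‖ < ρ := by
            by_contra! h
            have h4 : η ≤ |z x| := hx.2
            rw [hz0 x h, abs_zero] at h4
            linarith
          nlinarith [norm_nonneg x])
      refine ⟨τ, h1, fun x hx hlt => ?_⟩
      by_contra! hne
      exact absurd (h2 x ⟨mem_closedBall_zero_iff.2 hx, hne.le⟩) (not_le.2 hlt)
    set ε := min η (τ / 3) with hεdef
    have hε : 0 < ε := lt_min hη (by positivity)
    have hεη : ε ≤ η := min_le_left _ _
    have hετ : 2 * ε < τ := by linarith [min_le_right η (τ / 3)]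
    obtain ⟨G, hG, hG0, hG1, hG2, hG3, hG4⟩ := exists_smooth_cutoff (ρ ^ 2) hε
    have hG' : ContDiff ℝ 2 G := hG.of_le two_le_coe_top
    set ψ : E d → ℝ := fun x => G (‖x‖ ^ 2) * q x with hψ
    have hψs : ContDiff ℝ (⊤ : ℕ∞) ψ := (hG.comp (contDiff_norm_sq ℝ)).mul hqs
    have hψ0 : ∀ x, ρ ≤ ‖x‖ → ψ x = 0 := fun x hx => by
      have : ρ ^ 2 ≤ ‖x‖ ^ 2 := by gcongr
      simp only [hψ, hG0 _ (by linarith : ρ ^ 2 - ε ≤ ‖x‖ ^ 2), zero_mul]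
    have hψ2 : ContDiff ℝ 2 ψ := hψs.of_le two_le_coe_top
    have hIψ : ∫ x, z x * dunklExt R k ψ x * wk R k x = 0 := by
      rw [← hzψ ψ hψs hψ0]
      refine integral_congr_ae ?_
      filter_upwards [ae_dunklExt_eq_dunklLap hd ψ] with x hx
      rw [hx]
    have hIeq : -I = ∫ x, (z x * dunklExt R k ψ x * wk R k x -
        z x * dunklExt R k (fun x => (ρ ^ 2 - ‖x‖ ^ 2) * q x) x * wk R k x) := by
      rw [integral_sub (hInt ψ hψ2) (hInt _ hζ), hIψ, zero_sub]
    obtain ⟨hJi, hJ⟩ := integral_norm_sq_mul_deriv_deriv_le hd hm hρ hε hG hG0 hG1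
    have hwi := integrable_indicator_wk hd ρ
    have hLψ : ∀ x, dunklExt R k ψ x = G (‖x‖ ^ 2) * dunklExt R k q x +
        q x * (4 * ‖x‖ ^ 2 * deriv (deriv G) (‖x‖ ^ 2) + 2 * m * deriv G (‖x‖ ^ 2)) +
        4 * deriv G (‖x‖ ^ 2) * fderiv ℝ q x x := fun x =>
      dunklExt_comp_norm_sq_mul hd hG'.contDiffAt hqs.contDiffAt
    have hLζ : ∀ x, dunklExt R k (fun x => (ρ ^ 2 - ‖x‖ ^ 2) * q x) x =
        (ρ ^ 2 - ‖x‖ ^ 2) * dunklExt R k q x - 2 * m * q x - 4 * fderiv ℝ q x x := fun x => by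
      have h1 := dunklExt_comp_norm_sq_mul (k := k) hd (G := fun t => ρ ^ 2 - t) (x := x)
        (by fun_prop) (hqs (r := 2)).contDiffAt
      have h2 : deriv (fun t : ℝ => ρ ^ 2 - t) = fun _ => -1 := by
        ext t
        simp
      simp only [h2, deriv_const] at h1
      rw [h1]
      ring
    rw [← abs_neg, hIeq, ← Real.norm_eq_abs]
    calc ‖∫ x, (z x * dunklExt R k ψ x * wk R k x -
          z x * dunklExt R k (fun x => (ρ ^ 2 - ‖x‖ ^ 2) * q x) x * wk R k x)‖
        ≤ ∫ x : E d, ((η * (2 * C * Z + C * (2 * m + 4))) *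
            (Metric.closedBall (0 : E d) ρ).indicator (wk R k) x +
            η * C * (4 * ‖x‖ ^ 2 * deriv (deriv G) (‖x‖ ^ 2) * wk R k x)) := by
          refine norm_integral_le_of_norm_le ((hwi.const_mul _).add (hJi.const_mul _))
            (Eventually.of_forall fun x => ?_)
          have hw0 := wk_nonneg (R := R) (k := k) x
          have hA : 0 ≤ 4 * ‖x‖ ^ 2 * deriv (deriv G) (‖x‖ ^ 2) :=
            mul_nonneg (by positivity) (hG2 _)
          rcases le_or_gt ρ ‖x‖ with hx | hx
          · rw [hz0 x hx]
            simp only [zero_mul, sub_zero, norm_zero]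
            exact add_nonneg (mul_nonneg (by positivity) (Set.indicator_nonneg
              (fun _ _ => wk_nonneg _) _)) (mul_nonneg (by positivity) (mul_nonneg hA hw0))
          · rw [Set.indicator_of_mem (mem_closedBall_zero_iff.2 hx.le), ← sub_mul, ← mul_sub,
              norm_mul, Real.norm_of_nonneg hw0, ← mul_assoc (η * C), ← add_mul]
            refine mul_le_mul_of_nonneg_right ?_ hw0
            rw [Real.norm_eq_abs, abs_mul, hLψ, hLζ]
            set A := 4 * ‖x‖ ^ 2 * deriv (deriv G) (‖x‖ ^ 2) with hAdef
            have e1 : G (‖x‖ ^ 2) * dunklExt R k q x +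
                q x * (A + 2 * m * deriv G (‖x‖ ^ 2)) +
                4 * deriv G (‖x‖ ^ 2) * fderiv ℝ q x x -
                ((ρ ^ 2 - ‖x‖ ^ 2) * dunklExt R k q x - 2 * m * q x - 4 * fderiv ℝ q x x) =
                (G (‖x‖ ^ 2) - (ρ ^ 2 - ‖x‖ ^ 2)) * dunklExt R k q x + (q x * A +
                (deriv G (‖x‖ ^ 2) + 1) * (2 * m * q x + 4 * fderiv ℝ q x x)) := by ring
            have hx2 : ‖x‖ ^ 2 ≤ ρ ^ 2 := by gcongr
            have b1 : |(G (‖x‖ ^ 2) - (ρ ^ 2 - ‖x‖ ^ 2)) * dunklExt R k q x| ≤ 2 * η * C := by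
              rw [abs_mul]
              exact mul_le_mul ((hG4 _ hx2).trans (by linarith)) (hCL x hx.le) (abs_nonneg _)
                (by positivity)
            rw [e1]
            rcases lt_or_ge (‖x‖ ^ 2) (ρ ^ 2 - 2 * ε) with hin | hin
            · obtain ⟨h1, h2⟩ := hG3 _ hin
              have hA' : A = 0 := by rw [hAdef, h2, mul_zero]
              rw [h1, hA']
              simp only [mul_zero, neg_add_cancel, zero_mul, add_zero]
              calc |z x| * |(G (‖x‖ ^ 2) - (ρ ^ 2 - ‖x‖ ^ 2)) * dunklExt R k q x|
                  ≤ Z * (2 * η * C) := mul_le_mul (hZ x hx.le) b1 (abs_nonneg _) hZ0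
                _ ≤ η * (2 * C * Z + C * (2 * m + 4)) := by
                  have : 0 ≤ η * (C * (2 * m + 4)) := by positivity
                  linarith
            · have hzη : |z x| ≤ η := hτ x hx.le (by linarith)
              have b2 : |q x * A + (deriv G (‖x‖ ^ 2) + 1) *
                  (2 * m * q x + 4 * fderiv ℝ q x x)| ≤ C * A + C * (2 * m + 4) := by
                refine (abs_add_le _ _).trans (add_le_add ?_ ?_)
                · rw [abs_mul, abs_of_nonneg hA]
                  exact mul_le_mul_of_nonneg_right (hCq x hx.le) hA
                · rw [abs_mul]
                  have b3 : |deriv G (‖x‖ ^ 2) + 1| ≤ 1 :=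
                    abs_le.2 ⟨by linarith [(hG1 (‖x‖ ^ 2)).1], by linarith [(hG1 (‖x‖ ^ 2)).2]⟩
                  have b4 : |2 * m * q x + 4 * fderiv ℝ q x x| ≤ C * (2 * m + 4) := by
                    refine (abs_add_le _ _).trans ?_
                    rw [abs_mul (2 * m), abs_mul 4, abs_of_pos (by positivity : 0 < 2 * m),
                      abs_of_pos (by norm_num : (0 : ℝ) < 4)]
                    have := mul_le_mul_of_nonneg_left (hCq x hx.le) (by positivity : 0 ≤ 2 * m)
                    linarith [hCD x hx.le]
                  calc _ ≤ 1 * (C * (2 * m + 4)) :=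
                        mul_le_mul b3 b4 (abs_nonneg _) zero_le_one
                    _ = _ := one_mul _
              calc |z x| * |(G (‖x‖ ^ 2) - (ρ ^ 2 - ‖x‖ ^ 2)) * dunklExt R k q x + (q x * A +
                      (deriv G (‖x‖ ^ 2) + 1) * (2 * m * q x + 4 * fderiv ℝ q x x))|
                  ≤ |z x| * (2 * η * C) + |z x| * (C * A + C * (2 * m + 4)) := by
                    rw [← mul_add]
                    exact mul_le_mul_of_nonneg_left ((abs_add_le _ _).trans (add_le_add b1 b2))
                      (abs_nonneg _)
                _ ≤ Z * (2 * η * C) + η * (C * A + C * (2 * m + 4)) := by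
                    refine add_le_add (mul_le_mul_of_nonneg_right (hZ x hx.le) (by positivity))
                      (mul_le_mul_of_nonneg_right hzη (by positivity))
                _ = _ := by ring
      _ = η * (2 * C * Z + C * (2 * m + 4)) * W +
            η * C * ∫ x : E d, 4 * ‖x‖ ^ 2 * deriv (deriv G) (‖x‖ ^ 2) * wk R k x := by
          rw [integral_add (hwi.const_mul _) (hJi.const_mul _), integral_const_mul,
            integral_const_mul]
      _ ≤ η * (2 * C * Z + C * (2 * m + 4)) * W + η * C * (2 * m * W) := by
          gcongr
      _ = η * ((2 * C * Z + C * (2 * m + 4) + C * (2 * m)) * W) := by ring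
  have hlim : Tendsto (fun η : ℝ => η * ((2 * C * Z + C * (2 * m + 4) + C * (2 * m)) * W))
      (𝓝[>] 0) (𝓝 0) := by
    have : Continuous fun η : ℝ => η * ((2 * C * Z + C * (2 * m + 4) + C * (2 * m)) * W) := by
      fun_prop
    simpa using (this.tendsto 0).mono_left nhdsWithin_le_nhds
  exact abs_nonpos_iff.1 (ge_of_tendsto hlim
    (by filter_upwards [self_mem_nhdsWithin] with η hη using key η hη))

end Uniqueness

section PolynomialApproximation

variable {d : ℕ} {R : Finset (E d)} {k : E d → ℝ}

theorem dunklLap_eq_zero_of_outside {u : E d → ℝ} {ρ : ℝ} (hu : ∀ x, ρ < ‖x‖ → u x = 0) {x : E d}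
    (hx : ρ < ‖x‖) : dunklLap R k u x = 0 := by
  simp [dunklLap, lap_eq_sum_fderiv, hu x hx,
    hu _ (hx.trans_eq (norm_dunklReflect _ x).symm), fderiv_eq_zero_of_outside hu hx,
    fderiv_fderiv_eq_zero_of_outside hu hx]

theorem eq_zero_of_forall_integral_mul_dunklLap_eq_zero (hd : IsDunklData R k)
    (hm : 0 < dunklDim R k) {ρ : ℝ} (hρ : 0 < ρ) {z : E d → ℝ} (hz : Continuous z)
    (hz0 : ∀ x, ρ ≤ ‖x‖ → z x = 0)
    (hzψ : ∀ ψ : E d → ℝ, ContDiff ℝ (⊤ : ℕ∞) ψ → (∀ x, ρ ≤ ‖x‖ → ψ x = 0) →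
      ∫ x, z x * dunklLap R k ψ x * wk R k x = 0) (x : E d) : z x = 0 := by
  have hz0' : ∀ x, ρ < ‖x‖ → z x = 0 := fun x hx => hz0 x hx.le
  obtain ⟨Z, hZ⟩ := exists_forall_abs_le_of_outside hz hz0'
  have hzi : ∀ f : E d → ℝ, Continuous f → Integrable fun x => z x * f x * wk R k x := by
    intro f hf
    have h0 : ∀ x, ρ < ‖x‖ → z x * f x = 0 := fun x hx => by rw [hz0' x hx, zero_mul]
    obtain ⟨C, hC⟩ := exists_forall_abs_le_of_outside (hz.mul hf) h0
    exact integrable_mul_wk hd (hz.mul hf).aestronglyMeasurable hC h0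
  have hpoly : ∀ n, ∀ p ∈ polySpace d n, ∫ x, z x * p x * wk R k x = 0 := by
    intro n p hp
    obtain ⟨q, hq, hqp⟩ := exists_polySpace_dunklExt_eq hd hm hρ hp
    rw [← integral_mul_dunklExt_sub_norm_sq_mul_eq_zero hd hm hρ hz hz0 hzψ hq]
    exact integral_congr_ae (Eventually.of_forall fun x => by simp only [hqp])
  have hle : ∀ δ > 0, ∫ x, z x * z x * wk R k x ≤ δ * ∫ x, |z x| * 1 * wk R k x := by
    intro δ hδ
    obtain ⟨n, p, hp, hpz⟩ := exists_polySpace_near (ρ := ρ) hz.continuousOn hδ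
    have hpc : Continuous p := (contDiff_of_mem_polySpace (r := 0) hp).continuous
    have habs : Integrable fun x => |z x| * 1 * wk R k x :=
      (hzi _ (continuous_const (y := (1 : ℝ)))).norm.congr (Eventually.of_forall fun x => by
        simp only [norm_mul, Real.norm_eq_abs, abs_of_nonneg (wk_nonneg x), abs_one])
    calc ∫ x, z x * z x * wk R k x
        = ∫ x, (z x * z x * wk R k x - z x * p x * wk R k x) := by
          rw [integral_sub (hzi _ hz) (hzi _ hpc), hpoly n p hp, sub_zero]
      _ ≤ ∫ x, δ * (|z x| * 1 * wk R k x) := by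
          refine integral_mono ((hzi _ hz).sub (hzi _ hpc)) (habs.const_mul _) fun x => ?_
          have hw0 := wk_nonneg (R := R) (k := k) x
          rcases le_or_gt ‖x‖ ρ with hx | hx
          · have h1 : z x * (z x - p x) ≤ |z x| * δ := by
              refine (le_abs_self _).trans ?_
              rw [abs_mul, abs_sub_comm]
              exact mul_le_mul_of_nonneg_left (hpz x hx).le (abs_nonneg _)
            have := mul_le_mul_of_nonneg_right h1 hw0
            simp only
            linarith
          · simp [hz0' x hx]
      _ = _ := integral_const_mul _ _
  have hnonneg : ∀ x, 0 ≤ z x * z x * wk R k x := fun x =>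
    mul_nonneg (mul_self_nonneg _) (wk_nonneg x)
  have hI : ∫ x, z x * z x * wk R k x = 0 := by
    refine le_antisymm ?_ (integral_nonneg hnonneg)
    have : Continuous fun δ : ℝ => δ * ∫ x, |z x| * 1 * wk R k x := by fun_prop
    have h0 := (this.tendsto 0).mono_left (nhdsWithin_le_nhds (s := Set.Ioi 0))
    rw [zero_mul] at h0
    refine ge_of_tendsto h0 ?_
    filter_upwards [self_mem_nhdsWithin] with δ hδ using hle δ hδ
  have hae : z =ᵐ[volume] fun _ => 0 := by
    filter_upwards [(integral_eq_zero_iff_of_nonneg hnonneg (hzi _ hz)).1 hI,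
      ae_forall_inner_ne_zero hd] with y hy hne
    have hw := wk_pos (k := k) hne
    simpa [hw.ne'] using hy
  exact congrFun ((hz.ae_eq_iff_eq volume continuous_const).1 hae) x

/-- Radial retraction onto the closed ball of radius `ρ`. -/
def ballRetract (ρ : ℝ) (x : E d) : E d := (ρ / max ρ ‖x‖) • x

theorem continuous_ballRetract {ρ : ℝ} (hρ : 0 < ρ) :
    Continuous (ballRetract ρ : E d → E d) :=
  (continuous_const.div (by fun_prop) fun x => (lt_max_of_lt_left hρ).ne').smul continuous_id

theorem ballRetract_of_le {ρ : ℝ} (hρ : 0 < ρ) {x : E d} (hx : ‖x‖ ≤ ρ) :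
    ballRetract ρ x = x := by
  rw [ballRetract, max_eq_left hx, div_self hρ.ne', one_smul]

theorem norm_ballRetract_of_ge {ρ : ℝ} (hρ : 0 < ρ) {x : E d} (hx : ρ ≤ ‖x‖) :
    ‖ballRetract ρ x‖ = ρ := by
  rw [ballRetract, max_eq_right hx, norm_smul, norm_div, norm_norm, Real.norm_of_nonneg hρ.le,
    div_mul_cancel₀ _ (hρ.trans_le hx).ne']

theorem norm_ballRetract_le {ρ : ℝ} (hρ : 0 < ρ) (x : E d) : ‖ballRetract ρ x‖ ≤ ρ := by
  rcases le_total ‖x‖ ρ with h | h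
  · rwa [ballRetract_of_le hρ h]
  · exact (norm_ballRetract_of_ge hρ h).le

theorem exists_polySpace_dunklExt_near (hd : IsDunklData R k) (hm : 0 < dunklDim R k) {ρ : ℝ}
    (hρ : 0 < ρ) {v g : E d → ℝ} (hv : Continuous v) (hg : Continuous g) {δ : ℝ} (hδ : 0 < δ) :
    ∃ n, ∃ P ∈ polySpace d n, (∀ x, ‖x‖ = ρ → |P x - v x| ≤ δ) ∧
      ∀ x, ‖x‖ ≤ ρ → |dunklExt R k P x - g x| ≤ δ := by
  obtain ⟨n₁, h, hh, hhv⟩ := exists_polySpace_near (ρ := ρ) hv.continuousOn hδ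
  obtain ⟨n₂, p, hp, hpg⟩ := exists_polySpace_near (ρ := ρ) hg.continuousOn hδ
  have hh2 : h ∈ polySpace d (max n₁ n₂ + 2) := polySpace_mono (by omega) hh
  have hp' : p ∈ polySpace d (max n₁ n₂) := polySpace_mono (le_max_right _ _) hp
  obtain ⟨q, hq, hqp⟩ := exists_polySpace_dunklExt_eq hd hm hρ
    (Submodule.sub_mem _ hp' (dunklExt_mem_polySpace hd hh2))
  have hζ := sub_norm_sq_mul_mem_polySpace ρ hq
  refine ⟨_, fun x => h x + (ρ ^ 2 - ‖x‖ ^ 2) * q x, Submodule.add_mem _ hh2 hζ, fun x hx => ?_,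
    fun x hx => ?_⟩
  · simpa [hx] using (hhv x hx.le).le
  · have h1 := dunklExt_add_const_mul (R := R) (k := k) 1 (x := x)
      (contDiff_of_mem_polySpace hh).contDiffAt (contDiff_of_mem_polySpace hζ).contDiffAt
    simp only [one_mul, hqp, Pi.sub_apply, add_sub_cancel] at h1
    rw [h1]
    exact (hpg x hx).le

theorem exists_polySpace_approx (hd : IsDunklData R k) (hm : 0 < dunklDim R k) {ρ : ℝ}
    (hρ : 0 < ρ) {v g : E d → ℝ} (hv : Continuous v) (hg : Continuous g)
    (hsol : ∀ ψ : E d → ℝ, ContDiff ℝ (⊤ : ℕ∞) ψ → HasCompactSupport ψ →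
      ∫ x, v x * dunklLap R k ψ x * wk R k x = ∫ x, g x * ψ x * wk R k x)
    {δ : ℝ} (hδ : 0 < δ) :
    ∃ n, ∃ P ∈ polySpace d n, (∀ x, ‖x‖ ≤ ρ → |P x - v x| ≤ δ) ∧
      ∀ x, ‖x‖ ≤ ρ → |dunklExt R k P x - g x| ≤ δ := by
  choose n P hP hPv hPg using fun N : ℕ => exists_polySpace_dunklExt_near hd hm hρ hv hg
    (Nat.one_div_pos_of_nat (α := ℝ) (n := N))
  have hPc : ∀ N {r : WithTop ℕ∞}, ContDiff ℝ r (P N) := fun N => contDiff_of_mem_polySpace (hP N)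
  set M := 2 + 2 / (2 * dunklDim R k) * ρ ^ 2 with hM
  have hM0 : 0 < M := by positivity
  have hdiff : ∀ N₁ N₂ N : ℕ, N ≤ N₁ → N ≤ N₂ → ∀ x, ‖x‖ ≤ ρ →
      |P N₁ x - P N₂ x| ≤ M * (1 / (N + 1)) := by
    intro N₁ N₂ N h₁ h₂ x hx
    have i₁ := Nat.one_div_le_one_div (α := ℝ) h₁
    have i₂ := Nat.one_div_le_one_div (α := ℝ) h₂
    have e : ∀ x, dunklExt R k (fun y => P N₁ y + (-1) * P N₂ y) x =
        dunklExt R k (P N₁) x + (-1) * dunklExt R k (P N₂) x := fun x =>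
      dunklExt_add_const_mul (-1) (hPc N₁).contDiffAt (hPc N₂).contDiffAt
    have h := abs_le_of_abs_dunklExt_le hd hm (p := fun y => P N₁ y + (-1) * P N₂ y)
      (c := 2 * (1 / (N + 1))) (s := 2 * (1 / (N + 1)))
      ((hPc N₁).add (contDiff_const.mul (hPc N₂))) hρ.le (fun y hy => by
        rw [e y]
        have a₁ := abs_le.1 (hPg N₁ y hy.le)
        have a₂ := abs_le.1 (hPg N₂ y hy.le)
        exact abs_le.2 ⟨by linarith, by linarith⟩) (fun y hy => by
        have a₁ := abs_le.1 (hPv N₁ y hy)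
        have a₂ := abs_le.1 (hPv N₂ y hy)
        exact abs_le.2 ⟨by linarith, by linarith⟩) (by positivity) hx
    calc |P N₁ x - P N₂ x| = |P N₁ x + (-1) * P N₂ x| := by ring_nf
      _ ≤ _ := h
      _ = _ := by rw [hM]; ring
  have hlim0 : Tendsto (fun N : ℕ => M * (1 / ((N : ℝ) + 1))) atTop (𝓝 0) := by
    simpa using tendsto_one_div_add_atTop_nhds_zero_nat.const_mul M
  have hcauchy : ∀ x, ‖x‖ ≤ ρ → CauchySeq fun N => P N x := fun x hx =>
    cauchySeq_of_le_tendsto_0' (fun N : ℕ => M * (1 / ((N : ℝ) + 1)))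
      (fun N₁ N₂ h => by
        rw [Real.dist_eq]
        exact hdiff N₁ N₂ N₁ le_rfl h x hx) hlim0
  have hexu : ∀ x, ∃ u, ‖x‖ ≤ ρ → Tendsto (fun N => P N x) atTop (𝓝 u) := fun x => by
    by_cases hx : ‖x‖ ≤ ρ
    · exact (cauchySeq_tendsto_of_complete (hcauchy x hx)).imp fun u hu _ => hu
    · exact ⟨0, fun h => absurd h hx⟩
  choose u hu using hexu
  have hPu : ∀ N x, ‖x‖ ≤ ρ → |P N x - u x| ≤ M * (1 / ((N : ℝ) + 1)) := fun N x hx => by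
    refine le_of_tendsto ((tendsto_const_nhds.sub (hu x hx)).abs) ?_
    filter_upwards [eventually_ge_atTop N] with N₂ h using hdiff N N₂ N le_rfl h x hx
  have hunif : TendstoUniformlyOn P u atTop (Metric.closedBall 0 ρ) := by
    rw [Metric.tendstoUniformlyOn_iff]
    intro ε hε
    filter_upwards [hlim0.eventually (gt_mem_nhds hε)] with N hN x hx
    rw [dist_comm, Real.dist_eq]
    exact (hPu N x (mem_closedBall_zero_iff.1 hx)).trans_lt hN
  have huc : ContinuousOn u (Metric.closedBall 0 ρ) := hunif.continuousOn
    (Eventually.of_forall fun N => (hPc N (r := 0)).continuous.continuousOn).frequently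
  set z : E d → ℝ := fun x => v (ballRetract ρ x) - u (ballRetract ρ x) with hz
  have hzc : Continuous z := by
    refine (hv.comp (continuous_ballRetract hρ)).sub ?_
    exact huc.comp_continuous (continuous_ballRetract hρ) fun x =>
      mem_closedBall_zero_iff.2 (norm_ballRetract_le hρ x)
  have hz0 : ∀ x, ρ ≤ ‖x‖ → z x = 0 := by
    intro x hx
    have hn := norm_ballRetract_of_ge hρ hx
    rw [hz, sub_eq_zero]
    refine tendsto_nhds_unique ?_ (hu _ hn.le)
    have : Tendsto (fun N : ℕ => (1 : ℝ) / ((N : ℝ) + 1)) atTop (𝓝 0) :=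
      tendsto_one_div_add_atTop_nhds_zero_nat
    refine tendsto_iff_dist_tendsto_zero.2 (squeeze_zero (fun _ => dist_nonneg) (fun N => ?_) this)
    rw [Real.dist_eq]
    exact hPv N _ hn
  have hzx : ∀ x, ‖x‖ ≤ ρ → z x = v x - u x := fun x hx => by
    simp only [hz, ballRetract_of_le hρ hx]
  have hzero : ∀ x, z x = 0 := by
    refine eq_zero_of_forall_integral_mul_dunklLap_eq_zero hd hm hρ hzc hz0 fun ψ hψ hψ0 => ?_
    have hψ0' : ∀ x, ρ < ‖x‖ → ψ x = 0 := fun x hx => hψ0 x hx.le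
    have hψs := hasCompactSupport_of_outside hψ0'
    have hψ2 : ContDiff ℝ 2 ψ := hψ.of_le two_le_coe_top
    have hi : ∀ f : E d → ℝ, Continuous f →
        Integrable fun x => f x * dunklLap R k ψ x * wk R k x := fun f hf =>
      integrable_mul_dunklLap hd hf hψ2 (Or.inr hψ0')
    have hi' : ∀ f : E d → ℝ, Continuous f → Integrable fun x => f x * ψ x * wk R k x := by
      intro f hf
      have h0 : ∀ x, ρ < ‖x‖ → f x * ψ x = 0 := fun x hx => by rw [hψ0' x hx, mul_zero]
      obtain ⟨C, hC⟩ := exists_forall_abs_le_of_outside (hf.mul hψ2.continuous) h0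
      exact integrable_mul_wk hd (hf.mul hψ2.continuous).aestronglyMeasurable hC h0
    set J := ∫ x, ‖1 * dunklLap R k ψ x * wk R k x‖ with hJ
    set J' := ∫ x, ‖1 * ψ x * wk R k x‖ with hJ'
    have hbound : ∀ N : ℕ, |∫ x, z x * dunklLap R k ψ x * wk R k x| ≤
        M * (1 / ((N : ℝ) + 1)) * J + 1 / ((N : ℝ) + 1) * J' := by
      intro N
      have hvP : Continuous fun x => v x - P N x := hv.sub (hPc N (r := 0)).continuous
      have hLP : Continuous (dunklExt R k (P N)) := (contDiff_of_mem_polySpace (r := 0)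
        (dunklExt_mem_polySpace hd (polySpace_mono (by omega : n N ≤ n N + 2) (hP N)))).continuous
      have e1 : ∫ x, (v x - P N x) * dunklLap R k ψ x * wk R k x =
          ∫ x, (g x - dunklExt R k (P N) x) * ψ x * wk R k x := by
        simp only [sub_mul]
        rw [integral_sub (hi _ hv) (hi _ (hPc N (r := 0)).continuous), hsol ψ hψ hψs,
          integral_sub (hi' _ hg) (hi' _ hLP), integral_mul_dunklLap_comm hd (hPc N) hψ2 hψs]
        congr 1
        refine integral_congr_ae ?_
        filter_upwards [ae_dunklExt_eq_dunklLap hd (P N)] with x hx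
        rw [hx, mul_comm (ψ x)]
      have e2 : ∫ x, z x * dunklLap R k ψ x * wk R k x =
          (∫ x, (z x - (v x - P N x)) * dunklLap R k ψ x * wk R k x) +
            ∫ x, (g x - dunklExt R k (P N) x) * ψ x * wk R k x := by
        rw [← e1, ← integral_add (hi (fun x => z x - (v x - P N x)) (hzc.sub hvP)) (hi _ hvP)]
        congr 1
        ext x
        ring
      rw [e2]
      refine (abs_add_le _ _).trans (add_le_add ?_ ?_)
      · rw [← Real.norm_eq_abs, hJ, ← integral_const_mul]
        refine norm_integral_le_of_norm_le ((hi _ continuous_const).norm.const_mul _)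
          (Eventually.of_forall fun x => ?_)
        rcases le_or_gt ‖x‖ ρ with h | h
        · rw [hzx x h, mul_assoc, norm_mul, one_mul, Real.norm_eq_abs (_ - _)]
          refine mul_le_mul_of_nonneg_right ?_ (norm_nonneg _)
          rw [show v x - u x - (v x - P N x) = P N x - u x by ring]
          exact hPu N x h
        · rw [dunklLap_eq_zero_of_outside hψ0' h, mul_zero, zero_mul, norm_zero]
          positivity
      · rw [← Real.norm_eq_abs, hJ', ← integral_const_mul]
        refine norm_integral_le_of_norm_le ((hi' _ continuous_const).norm.const_mul _)
          (Eventually.of_forall fun x => ?_)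
        rcases le_or_gt ‖x‖ ρ with h | h
        · rw [mul_assoc, norm_mul, one_mul, norm_sub_rev]
          exact mul_le_mul_of_nonneg_right (hPg N x h) (norm_nonneg _)
        · rw [hψ0' x h]
          simp
    have hlim : Tendsto (fun N : ℕ => M * (1 / ((N : ℝ) + 1)) * J + 1 / ((N : ℝ) + 1) * J')
        atTop (𝓝 0) := by
      simpa using (hlim0.mul_const J).add
        ((tendsto_one_div_add_atTop_nhds_zero_nat (𝕜 := ℝ)).mul_const J')
    exact abs_nonpos_iff.1 (ge_of_tendsto' hlim hbound)
  obtain ⟨N, hN1, hN2⟩ := ((hlim0.eventually (gt_mem_nhds hδ)).and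
    ((tendsto_one_div_add_atTop_nhds_zero_nat (𝕜 := ℝ)).eventually (gt_mem_nhds hδ))).exists
  refine ⟨n N, P N, hP N, fun x hx => ?_, fun x hx => (hPg N x hx).trans hN2.le⟩
  have := hzero x
  rw [hzx x hx, sub_eq_zero] at this
  rw [this]
  exact (hPu N x hx).trans hN1.le

end PolynomialApproximation

section KellerOsserman

theorem exists_inverse_hasDerivAt {f f' : ℝ → ℝ} {a : ℝ} {J : Set ℝ} (hJ : IsOpen J)
    (hf : ∀ t, a < t → HasDerivAt f (f' t) t) (hf' : ∀ t, a < t → 0 < f' t)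
    (hsurj : ∀ s ∈ J, ∃ t, a < t ∧ f t = s) :
    ∃ g : ℝ → ℝ, ∀ s ∈ J, a < g s ∧ f (g s) = s ∧ HasDerivAt g (f' (g s))⁻¹ s := by
  have hmono : StrictMonoOn f (Set.Ioi a) :=
    strictMonoOn_of_deriv_pos (convex_Ioi a)
      (fun t ht => (hf t ht).continuousAt.continuousWithinAt) fun t ht => by
        rw [interior_Ioi] at ht
        rw [(hf t ht).deriv]
        exact hf' t ht
  have hex : ∀ s, ∃ t, s ∈ J → a < t ∧ f t = s := fun s => by
    by_cases hs : s ∈ J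
    · exact (hsurj s hs).imp fun t ht _ => ht
    · exact ⟨0, fun h => absurd h hs⟩
  choose g hg using hex
  refine ⟨g, fun s hs => ⟨(hg s hs).1, (hg s hs).2, ?_⟩⟩
  have hJs : J ∈ 𝓝 s := hJ.mem_nhds hs
  obtain ⟨hga, hgs⟩ := hg s hs
  refine HasDerivAt.of_local_left_inverse ?_ (hf _ hga) (hf' _ hga).ne'
    (by filter_upwards [hJs] with y hy using (hg y hy).2)
  rw [ContinuousAt, tendsto_order]
  constructor
  · intro b hb
    have h1 : a < max b ((a + g s) / 2) := lt_max_of_lt_right (by linarith)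
    have h2 : max b ((a + g s) / 2) < g s := max_lt hb (by linarith)
    have h3 := hmono h1 hga h2
    rw [hgs] at h3
    filter_upwards [hJs, Ioi_mem_nhds h3] with y hy hlt
    obtain ⟨h4, h5⟩ := hg y hy
    refine (le_max_left _ _).trans_lt ((hmono.lt_iff_lt h1 h4).1 ?_)
    rwa [h5]
  · intro b hb
    have h3 := hmono hga (hga.trans hb) hb
    rw [hgs] at h3
    filter_upwards [hJs, Iio_mem_nhds h3] with y hy hlt
    obtain ⟨h4, h5⟩ := hg y hy
    refine (hmono.lt_iff_lt h4 (hga.trans hb)).1 ?_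
    rwa [h5]

theorem contDiffOn_two_of_hasDerivAt {g g₁ g₂ : ℝ → ℝ} {J : Set ℝ} (hJ : IsOpen J)
    (h₁ : ∀ s ∈ J, HasDerivAt g (g₁ s) s) (h₂ : ∀ s ∈ J, HasDerivAt g₁ (g₂ s) s)
    (h₃ : ContinuousOn g₂ J) : ContDiffOn ℝ 2 g J := by
  have e : ContDiffOn ℝ 1 g₁ J := by
    rw [show (1 : WithTop ℕ∞) = 0 + 1 from (zero_add 1).symm,
      contDiffOn_succ_iff_deriv_of_isOpen hJ]
    refine ⟨fun s hs => (h₂ s hs).differentiableAt.differentiableWithinAt, by simp, ?_⟩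
    exact contDiffOn_zero.2 (h₃.congr fun s hs => (h₂ s hs).deriv)
  rw [show (2 : WithTop ℕ∞) = 1 + 1 from one_add_one_eq_two.symm,
    contDiffOn_succ_iff_deriv_of_isOpen hJ]
  exact ⟨fun s hs => (h₁ s hs).differentiableAt.differentiableWithinAt, by simp,
    e.congr fun s hs => (h₁ s hs).deriv⟩

/-- The primitive of `φ` vanishing at `0`. -/
def koPrim (φ : ℝ → ℝ) (t : ℝ) : ℝ := ∫ s in (0 : ℝ)..t, φ s

/-- The time map `t ↦ ∫₁ᵗ ds / √Φ(s)` of the Keller–Osserman condition, `Φ = koPrim φ`. -/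
def koTime (φ : ℝ → ℝ) (t : ℝ) : ℝ := ∫ s in (1 : ℝ)..t, (√(koPrim φ s))⁻¹

variable {φ : ℝ → ℝ}

theorem hasDerivAt_koPrim (hc : Continuous φ) (t : ℝ) : HasDerivAt (koPrim φ) (φ t) t :=
  hc.integral_hasStrictDerivAt 0 t |>.hasDerivAt

theorem continuous_koPrim (hc : Continuous φ) : Continuous (koPrim φ) :=
  continuous_iff_continuousAt.2 fun t => (hasDerivAt_koPrim hc t).continuousAt

theorem koPrim_le_mul (hc : Continuous φ) (hmono : Monotone φ) {t : ℝ} (ht : 0 ≤ t) :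
    koPrim φ t ≤ t * φ t := by
  have h := intervalIntegral.integral_mono_on ht (μ := volume)
    (hc.intervalIntegrable 0 t) (continuous_const.intervalIntegrable 0 t) (g := fun _ => φ t)
    fun s hs => hmono hs.2
  simpa [koPrim] using h

theorem koPrim_mono (hc : Continuous φ) (hmono : Monotone φ) (h0 : φ 0 = 0) {s t : ℝ}
    (hs : 0 ≤ s) (hst : s ≤ t) : koPrim φ s ≤ koPrim φ t := by
  have h : MonotoneOn (koPrim φ) (Set.Ici 0) :=
    monotoneOn_of_deriv_nonneg (convex_Ici 0) (continuous_koPrim hc).continuousOn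
      (fun t _ => (hasDerivAt_koPrim hc t).differentiableAt.differentiableWithinAt) fun t ht => by
        rw [interior_Ici] at ht
        rw [(hasDerivAt_koPrim hc t).deriv, ← h0]
        exact hmono (le_of_lt ht)
  exact h hs (hs.trans hst) hst

theorem continuousOn_inv_sqrt_koPrim (hc : Continuous φ) (hΦ : ∀ t, 0 < t → 0 < koPrim φ t) :
    ContinuousOn (fun s => (√(koPrim φ s))⁻¹) (Set.Ioi 0) :=
  (continuous_koPrim hc).sqrt.continuousOn.inv₀ fun s hs => (Real.sqrt_pos.2 (hΦ s hs)).ne'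

theorem intervalIntegrable_inv_sqrt_koPrim (hc : Continuous φ) (hΦ : ∀ t, 0 < t → 0 < koPrim φ t)
    {a b : ℝ} (ha : 0 < a) (hb : 0 < b) :
    IntervalIntegrable (fun s => (√(koPrim φ s))⁻¹) volume a b :=
  ((continuousOn_inv_sqrt_koPrim hc hΦ).mono fun _ hs =>
    (lt_min ha hb).trans_le hs.1).intervalIntegrable

theorem hasDerivAt_koTime (hc : Continuous φ) (hΦ : ∀ t, 0 < t → 0 < koPrim φ t) {t : ℝ}
    (ht : 0 < t) : HasDerivAt (koTime φ) (√(koPrim φ t))⁻¹ t :=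
  intervalIntegral.integral_hasDerivAt_right
    (intervalIntegrable_inv_sqrt_koPrim hc hΦ one_pos ht)
    ((continuousOn_inv_sqrt_koPrim hc hΦ).stronglyMeasurableAtFilter isOpen_Ioi t ht)
    ((continuousOn_inv_sqrt_koPrim hc hΦ).continuousAt (Ioi_mem_nhds ht))

theorem strictMonoOn_koTime (hc : Continuous φ) (hΦ : ∀ t, 0 < t → 0 < koPrim φ t) :
    StrictMonoOn (koTime φ) (Set.Ioi 0) :=
  strictMonoOn_of_deriv_pos (convex_Ioi 0)
    (fun _ ht => (hasDerivAt_koTime hc hΦ ht).continuousAt.continuousWithinAt) fun t ht => by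
      rw [interior_Ioi] at ht
      rw [(hasDerivAt_koTime hc hΦ ht).deriv]
      exact inv_pos.2 (Real.sqrt_pos.2 (hΦ t ht))

theorem exists_koTime_eq (hc : Continuous φ) (hΦ : ∀ t, 0 < t → 0 < koPrim φ t) {a b s : ℝ}
    (ha : 0 < a) (hab : a ≤ b) (hs : s ∈ Set.Icc (koTime φ a) (koTime φ b)) :
    ∃ t, 0 < t ∧ koTime φ t = s := by
  obtain ⟨t, ht, hts⟩ := intermediate_value_Icc hab (fun t ht =>
    (hasDerivAt_koTime hc hΦ (ha.trans_le ht.1)).continuousAt.continuousWithinAt) hs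
  exact ⟨t, ha.trans_le ht.1, hts⟩

/-- Inverting the time map solves `Dg = √Φ(g)`, hence `D²g = φ(g) / 2`. -/
theorem exists_koFlow (hc : Continuous φ) (hΦ : ∀ t, 0 < t → 0 < koPrim φ t) {J : Set ℝ}
    (hJ : IsOpen J) (hsurj : ∀ s ∈ J, ∃ t, 0 < t ∧ koTime φ t = s) :
    ∃ g : ℝ → ℝ, ∀ s ∈ J, 0 < g s ∧ koTime φ (g s) = s ∧ HasDerivAt g (√(koPrim φ (g s))) s ∧
      HasDerivAt (fun s => √(koPrim φ (g s))) (φ (g s) / 2) s := by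
  obtain ⟨g, hg⟩ := exists_inverse_hasDerivAt hJ (fun t ht => hasDerivAt_koTime hc hΦ ht)
    (fun t ht => inv_pos.2 (Real.sqrt_pos.2 (hΦ t ht))) hsurj
  refine ⟨g, fun s hs => ?_⟩
  obtain ⟨h1, h2, h3⟩ := hg s hs
  rw [inv_inv] at h3
  have hpos := hΦ _ h1
  have hne := (Real.sqrt_pos.2 hpos).ne'
  refine ⟨h1, h2, h3, ?_⟩
  exact ((hasDerivAt_koPrim hc (g s)).comp s h3).sqrt hpos.ne' |>.congr_deriv
    (mul_div_mul_right _ _ hne)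

theorem contDiffOn_koFlow (hc : Continuous φ) {J : Set ℝ} (hJ : IsOpen J) {g : ℝ → ℝ}
    (hg : ∀ s ∈ J, HasDerivAt g (√(koPrim φ (g s))) s ∧
      HasDerivAt (fun s => √(koPrim φ (g s))) (φ (g s) / 2) s) : ContDiffOn ℝ 2 g J :=
  contDiffOn_two_of_hasDerivAt hJ (fun s hs => (hg s hs).1) (fun s hs => (hg s hs).2)
    (((hc.comp_continuousOn fun s hs => (hg s hs).1.continuousAt.continuousWithinAt)).div_const 2)

/-- When the time map is bounded above, `φ` grows at least linearly. -/
theorem exists_le_mul_of_koTime_lt (hc : Continuous φ) (hmono : Monotone φ) (h0 : φ 0 = 0)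
    (hΦ : ∀ t, 0 < t → 0 < koPrim φ t) {C : ℝ} (hC : ∀ t, 0 < t → koTime φ t < C) {a : ℝ}
    (ha : 0 < a) : ∃ K, 0 < K ∧ ∀ t, a ≤ t → t ≤ K * φ t := by
  have hφa : 0 < φ a := by
    have := (hΦ a ha).trans_le (koPrim_le_mul hc hmono ha.le)
    exact (pos_iff_pos_of_mul_pos this).1 ha
  set D := C - koTime φ a with hD
  have hD0 : 0 < D := sub_pos.2 (hC a ha)
  refine ⟨max (2 * a / φ a) (4 * D ^ 2), lt_max_of_lt_left (by positivity), fun t ht => ?_⟩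
  have ht0 : 0 < t := ha.trans_le ht
  have hφt : φ a ≤ φ t := hmono ht
  rcases le_total t (2 * a) with h2 | h2
  · calc t ≤ 2 * a / φ a * φ a := by rwa [div_mul_cancel₀ _ hφa.ne']
      _ ≤ _ := mul_le_mul (le_max_left _ _) hφt hφa.le
        (le_max_of_le_left (by positivity))
  · have hs := Real.sqrt_pos.2 (hΦ t ht0)
    have h3 : t / 2 * (√(koPrim φ t))⁻¹ ≤ koTime φ t - koTime φ (t / 2) := by
      have h := intervalIntegral.integral_mono_on (a := t / 2) (b := t) (by linarith)
        (f := fun _ => (√(koPrim φ t))⁻¹) (g := fun s => (√(koPrim φ s))⁻¹)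
        (continuous_const.intervalIntegrable _ _)
        (intervalIntegrable_inv_sqrt_koPrim hc hΦ (by linarith) ht0) fun s hs => by
          have hs0 : 0 < s := by linarith [hs.1]
          exact inv_anti₀ (Real.sqrt_pos.2 (hΦ s hs0))
            (Real.sqrt_le_sqrt (koPrim_mono hc hmono h0 hs0.le hs.2))
      rw [koTime, koTime, intervalIntegral.integral_interval_sub_left
        (intervalIntegrable_inv_sqrt_koPrim hc hΦ one_pos ht0)
        (intervalIntegrable_inv_sqrt_koPrim hc hΦ one_pos (by linarith))]
      simpa [sub_half] using h
    have h4 : koTime φ a ≤ koTime φ (t / 2) :=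
      (strictMonoOn_koTime hc hΦ).monotoneOn ha (show (0 : ℝ) < t / 2 by linarith) (by linarith)
    have h5 : t / 2 * (√(koPrim φ t))⁻¹ ≤ D := by linarith [hC t ht0]
    have h6 : t ≤ 2 * D * √(koPrim φ t) := by
      rw [← div_eq_mul_inv, div_le_iff₀ hs] at h5
      linarith
    have h7 : t * t ≤ t * (4 * D ^ 2 * φ t) := by
      calc t * t ≤ (2 * D * √(koPrim φ t)) * (2 * D * √(koPrim φ t)) :=
            mul_self_le_mul_self ht0.le h6
        _ = 4 * D ^ 2 * (√(koPrim φ t) * √(koPrim φ t)) := by ring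
        _ = 4 * D ^ 2 * koPrim φ t := by rw [Real.mul_self_sqrt (hΦ t ht0).le]
        _ ≤ 4 * D ^ 2 * (t * φ t) := by
            gcongr
            exact koPrim_le_mul hc hmono ht0.le
        _ = _ := by ring
    exact (le_of_mul_le_mul_left h7 ht0).trans
      (mul_le_mul_of_nonneg_right (le_max_right _ _) (hφa.le.trans hφt))

/-- If the Keller–Osserman integral converges, the time map is bounded. -/
theorem exists_tendsto_koTime (hc : Continuous φ) (hΦ : ∀ t, 0 < t → 0 < koPrim φ t)
    (hfin : ∫⁻ t in Set.Ioi 1, (ENNReal.ofReal (√(koPrim φ t)))⁻¹ ≠ ⊤) :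
    ∃ C, Tendsto (koTime φ) atTop (𝓝 C) ∧ ∀ t, 0 < t → koTime φ t < C := by
  have hsub : Set.Ioi (1 : ℝ) ⊆ Set.Ioi 0 := Set.Ioi_subset_Ioi zero_le_one
  have hInt : IntegrableOn (fun s => (√(koPrim φ s))⁻¹) (Set.Ioi 1) := by
    refine ⟨((continuousOn_inv_sqrt_koPrim hc hΦ).mono hsub).aestronglyMeasurable
      measurableSet_Ioi, ?_⟩
    rw [hasFiniteIntegral_iff_ofReal (Eventually.of_forall fun s => by positivity)]
    refine lt_of_eq_of_lt (setLIntegral_congr_fun measurableSet_Ioi fun s hs => ?_)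
      hfin.lt_top
    exact ENNReal.ofReal_inv_of_pos (Real.sqrt_pos.2 (hΦ s (hsub hs)))
  have hlim := intervalIntegral_tendsto_integral_Ioi 1 hInt tendsto_id
  refine ⟨_, hlim, fun t ht => ?_⟩
  have hm := strictMonoOn_koTime hc hΦ
  refine (hm ht (show (0 : ℝ) < t + 1 by linarith) (by linarith)).trans_le
    (ge_of_tendsto hlim ?_)
  filter_upwards [eventually_ge_atTop (t + 1)] with s hs
  exact hm.monotoneOn (show (0 : ℝ) < t + 1 by linarith)
    (show (0 : ℝ) < s by linarith) hs

/-- If the Keller–Osserman integral diverges, the time map is unbounded. -/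
theorem exists_lt_koTime (hc : Continuous φ) (hΦ : ∀ t, 0 < t → 0 < koPrim φ t) {a : ℝ}
    (ha : 0 < a) (hinf : ∫⁻ t in Set.Ioi a, (ENNReal.ofReal (√(koPrim φ t)))⁻¹ = ⊤) (C : ℝ) :
    ∃ t, 1 < t ∧ C < koTime φ t := by
  by_contra! hC
  have hInt : IntegrableOn (fun s => (√(koPrim φ s))⁻¹) (Set.Ioi 1) := by
    refine integrableOn_Ioi_of_intervalIntegral_norm_bounded C 1 (l := atTop) (b := id)
      (fun t => ?_) tendsto_id ?_
    · exact (intervalIntegrable_iff.1 (intervalIntegrable_inv_sqrt_koPrim hc hΦ one_pos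
        (lt_max_of_lt_left one_pos : (0 : ℝ) < max 1 t))).mono_set
          ((Set.Ioc_subset_Ioc_right (le_max_right _ _)).trans_eq
            (Set.uIoc_of_le (le_max_left _ _)).symm)
    · filter_upwards [eventually_gt_atTop 1] with t ht
      refine le_trans (le_of_eq ?_) (hC t ht)
      refine intervalIntegral.integral_congr fun s _ => ?_
      exact Real.norm_of_nonneg (by positivity)
  have hInt' : IntegrableOn (fun s => (√(koPrim φ s))⁻¹) (Set.Ioi a) := by
    refine ((intervalIntegrable_iff.1
      (intervalIntegrable_inv_sqrt_koPrim hc hΦ ha one_pos)).union hInt).mono_set fun s hs => ?_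
    rcases le_or_gt s 1 with h | h
    · exact Or.inl ⟨(min_le_left _ _).trans_lt hs, h.trans (le_max_right _ _)⟩
    · exact Or.inr h
  refine absurd hinf (lt_of_eq_of_lt ?_ ((hasFiniteIntegral_iff_ofReal
    (Eventually.of_forall fun s => by positivity)).1 hInt'.2)).ne
  refine setLIntegral_congr_fun measurableSet_Ioi fun s hs => ?_
  exact (ENNReal.ofReal_inv_of_pos (Real.sqrt_pos.2 (hΦ s (ha.trans hs)))).symm

end KellerOsserman

section Nonexistence

variable {d : ℕ} {R : Finset (E d)} {k : E d → ℝ} {φ : ℝ → ℝ} {v : E d → ℝ}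

theorem dunklExt_norm_sq (hd : IsDunklData R k) (x : E d) :
    dunklExt R k (fun y => ‖y‖ ^ 2) x = 2 * dunklDim R k := by
  have h := dunklExt_comp_norm_sq hd (G := fun t => t) (x := x) contDiffAt_id
  simpa using h

/-- A weak solution lies below every radial supersolution blowing up at the boundary of a ball. -/
theorem le_of_supersolution (hd : IsDunklData R k) (hm : 0 < dunklDim R k) (hmono : Monotone φ)
    (hv : Continuous v) (hφv : Continuous fun x => φ (v x))
    (hsol : ∀ ψ : E d → ℝ, ContDiff ℝ (⊤ : ℕ∞) ψ → HasCompactSupport ψ →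
      ∫ x, v x * dunklLap R k ψ x * wk R k x = ∫ x, φ (v x) * ψ x * wk R k x)
    {ρ : ℝ} {G : ℝ → ℝ} (hG : ∀ t, 0 ≤ t → t < ρ ^ 2 → ContDiffAt ℝ 2 G t)
    (hsup : ∀ x : E d, ‖x‖ < ρ → dunklExt R k (fun y => G (‖y‖ ^ 2)) x ≤ φ (G (‖x‖ ^ 2)))
    (hGtop : ∀ M, ∀ s < ρ ^ 2, ∃ t, s < t ∧ t < ρ ^ 2 ∧ M ≤ G t) {x : E d} (hx : ‖x‖ < ρ) :
    v x ≤ G (‖x‖ ^ 2) := by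
  by_contra! hlt
  set a := v x - G (‖x‖ ^ 2) with ha
  have ha0 : 0 < a := sub_pos.2 hlt
  have hρ : 0 < ρ := (norm_nonneg x).trans_lt hx
  obtain ⟨M, hM⟩ := (isCompact_closedBall (0 : E d) ρ).exists_bound_of_continuousOn
    hv.continuousOn
  obtain ⟨t, ht1, ht2, htM⟩ := hGtop (M + 1) (‖x‖ ^ 2) (by gcongr)
  have ht0 : 0 < t := (sq_nonneg _).trans_lt ht1
  set r := √t with hr
  have hr0 : 0 < r := Real.sqrt_pos.2 ht0
  have hrt : r ^ 2 = t := Real.sq_sqrt ht0.le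
  have hrρ : r < ρ := lt_of_pow_lt_pow_left₀ 2 hρ.le (by rwa [hrt])
  have hxr : ‖x‖ < r := lt_of_pow_lt_pow_left₀ 2 hr0.le (by rwa [hrt])
  set m := dunklDim R k with hmdef
  set ε := min 1 a / (2 * (2 * m + ρ ^ 2)) with hε
  have hmin : 0 < min 1 a := lt_min one_pos ha0
  have hε0 : 0 < ε := by positivity
  have hεm : 2 * (ε * m) + ε * ρ ^ 2 < min 1 a := by
    have : ε * (2 * m + ρ ^ 2) = min 1 a / 2 := by
      rw [hε]
      field_simp
    linarith
  have hε1 := hεm.trans_le (min_le_left 1 a)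
  have hεa := hεm.trans_le (min_le_right 1 a)
  obtain ⟨n, P, hP, hPv, hPg⟩ := exists_polySpace_approx hd hm hρ hv hφv hsol
    (δ := ε * m) (by positivity)
  have hPc : ∀ {r : WithTop ℕ∞}, ContDiff ℝ r P := contDiff_of_mem_polySpace hP
  have hGc : ∀ y : E d, ‖y‖ < ρ → ContDiffAt ℝ 2 (fun y : E d => G (‖y‖ ^ 2)) y := fun y hy =>
    ContDiffAt.comp y (hG _ (sq_nonneg _) (by gcongr)) (contDiff_norm_sq ℝ).contDiffAt
  set h : E d → ℝ := fun y => (P y + ε * ‖y‖ ^ 2) + (-1) * G (‖y‖ ^ 2) with hh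
  have hPε : ContDiff ℝ 2 fun y : E d => P y + ε * ‖y‖ ^ 2 :=
    hPc.add (contDiff_const.mul (contDiff_norm_sq ℝ))
  have hhc : ∀ y, ‖y‖ < ρ → ContDiffAt ℝ 2 h y := fun y hy =>
    hPε.contDiffAt.add (contDiffAt_const.mul (hGc y hy))
  have hcl : ∀ y ∈ Metric.closedBall (0 : E d) r, ‖y‖ < ρ := fun y hy =>
    (mem_closedBall_zero_iff.1 hy).trans_lt hrρ
  obtain ⟨y, hy, hymax⟩ := (isCompact_closedBall (0 : E d) r).exists_isMaxOn
    ⟨x, mem_closedBall_zero_iff.2 hxr.le⟩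
    fun y hy => (hhc y (hcl y hy)).continuousAt.continuousWithinAt
  have hyρ := hcl y hy
  have hxy : h x ≤ h y := hymax (mem_closedBall_zero_iff.2 hxr.le)
  have hPx := abs_le.1 (hPv x hx.le)
  have hPy := abs_le.1 (hPv y hyρ.le)
  have hhx : a - ε * m ≤ h x := by
    simp only [hh]
    have : 0 ≤ ε * ‖x‖ ^ 2 := by positivity
    linarith [hPx.1]
  have hεy : ε * ‖y‖ ^ 2 ≤ ε * ρ ^ 2 := by gcongr
  have hyr : ‖y‖ < r := by
    refine lt_of_le_of_ne (mem_closedBall_zero_iff.1 hy) fun hyr => ?_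
    have h1 : v y ≤ M := (le_abs_self _).trans (hM y (mem_closedBall_zero_iff.2 hyρ.le))
    have h2 : h y ≤ -1 + (2 * (ε * m) + ε * ρ ^ 2) - ε * m := by
      simp only [hh]
      rw [show ‖y‖ ^ 2 = t by rw [hyr, hrt]] at hεy ⊢
      linarith [hPy.2]
    linarith
  have hle : dunklExt R k h y ≤ 0 := by
    refine dunklExt_nonpos_of_isLocalMax hd (hhc y hyρ) ?_ fun α _ => ?_
    · filter_upwards [Metric.isOpen_ball.mem_nhds (mem_ball_zero_iff.2 hyr)] with y' hy'
      exact hymax (Metric.ball_subset_closedBall hy')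
    · refine hymax ?_
      rw [mem_closedBall_zero_iff, norm_dunklReflect]
      exact hyr.le
  have heq : dunklExt R k h y = dunklExt R k P y + ε * (2 * m) +
      (-1) * dunklExt R k (fun y => G (‖y‖ ^ 2)) y := by
    rw [hh, dunklExt_add_const_mul (-1) hPε.contDiffAt (hGc y hyρ),
      dunklExt_add_const_mul ε hPc.contDiffAt (contDiff_norm_sq ℝ).contDiffAt,
      dunklExt_norm_sq hd]
  have hvy : G (‖y‖ ^ 2) ≤ v y := by
    have : a - ε * m ≤ (P y + ε * ‖y‖ ^ 2) + (-1) * G (‖y‖ ^ 2) := hhx.trans hxy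
    linarith [hPy.2]
  have h1 := hmono hvy
  have h2 := hsup y hyρ
  have h3 := abs_le.1 (hPg y hyρ.le)
  have h4 : 0 < ε * m := by positivity
  linarith [h3.1]

theorem le_of_koTime_bounded (hd : IsDunklData R k) (hm : 0 < dunklDim R k) (hc : Continuous φ)
    (hmono : Monotone φ) (h0 : φ 0 = 0) (hΦ : ∀ t, 0 < t → 0 < koPrim φ t) {C : ℝ}
    (hlim : Tendsto (koTime φ) atTop (𝓝 C)) (hC : ∀ t, 0 < t → koTime φ t < C)
    (hv : Continuous v)
    (hsol : ∀ ψ : E d → ℝ, ContDiff ℝ (⊤ : ℕ∞) ψ → HasCompactSupport ψ →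
      ∫ x, v x * dunklLap R k ψ x * wk R k x = ∫ x, φ (v x) * ψ x * wk R k x)
    {a : ℝ} (ha : 0 < a) (x : E d) : v x ≤ a := by
  have hstrict := strictMonoOn_koTime hc hΦ
  have ha2 : 0 < a / 2 := half_pos ha
  obtain ⟨g, hg⟩ := exists_koFlow hc hΦ (isOpen_Ioo (a := koTime φ (a / 2)) (b := C))
    fun s hs => by
      obtain ⟨b, hb1, hb2⟩ := ((hlim.eventually (lt_mem_nhds hs.2)).and
        (eventually_ge_atTop (a / 2))).exists
      exact exists_koTime_eq hc hΦ ha2 hb2 ⟨hs.1.le, hb1.le⟩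
  have hgc := contDiffOn_koFlow hc isOpen_Ioo fun s hs => (hg s hs).2.2
  set D := C - koTime φ a with hD
  have hD0 : 0 < D := sub_pos.2 (hC a ha)
  have haJ : koTime φ (a / 2) < koTime φ a := hstrict ha2 ha (half_lt_self ha)
  obtain ⟨K, hK, hKφ⟩ := exists_le_mul_of_koTime_lt hc hmono h0 hΦ hC ha
  set m := dunklDim R k with hmdef
  have hga : ∀ s, koTime φ a ≤ s → s < C → a ≤ g s := fun s hs hsC => by
    obtain ⟨h1, h2, -⟩ := hg s ⟨haJ.trans_le hs, hsC⟩
    refine (hstrict.le_iff_le ha h1).1 ?_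
    rwa [h2]
  by_contra! hlt
  have hvx0 : 0 < v x := ha.trans hlt
  have hbound : ∀ ρ, ‖x‖ < ρ → 2 * D ≤ ρ → 4 * m * D * √K ≤ ρ ^ 2 →
      koTime φ (v x) ≤ C - D / ρ ^ 2 * (ρ ^ 2 - ‖x‖ ^ 2) := by
    intro ρ hxρ hρD hρK
    have hρ : 0 < ρ := by linarith
    set β := D / ρ ^ 2 with hβ
    have hβ0 : 0 < β := by positivity
    have hβρ : β * ρ ^ 2 = D := div_mul_cancel₀ _ (by positivity)
    set T : ℝ → ℝ := fun t => C - β * (ρ ^ 2 - t) with hT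
    have hTd : ∀ t, HasDerivAt T β t := fun t => by
      have := (((hasDerivAt_id t).const_sub (ρ ^ 2)).const_mul β).const_sub C
      simpa using this
    have hTlo : ∀ t, 0 ≤ t → koTime φ a ≤ T t := fun t ht => by
      have : 0 ≤ β * t := by positivity
      simp only [hT]
      linarith
    have hTC : ∀ t, t < ρ ^ 2 → T t < C := fun t ht => by
      have : 0 < β * (ρ ^ 2 - t) := mul_pos hβ0 (by linarith)
      simp only [hT]
      linarith
    have hTJ : ∀ t, 0 ≤ t → t < ρ ^ 2 → T t ∈ Set.Ioo (koTime φ (a / 2)) C := fun t h1 h2 =>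
      ⟨haJ.trans_le (hTlo t h1), hTC t h2⟩
    have hTcont : Continuous T := continuous_iff_continuousAt.2 fun t => (hTd t).continuousAt
    have hG1 : ∀ t, T t ∈ Set.Ioo (koTime φ (a / 2)) C →
        HasDerivAt (fun t => g (T t)) (√(koPrim φ (g (T t))) * β) t := fun t ht =>
      (hg _ ht).2.2.1.comp t (hTd t)
    have hG2 : ∀ t, T t ∈ Set.Ioo (koTime φ (a / 2)) C →
        HasDerivAt (fun t => √(koPrim φ (g (T t))) * β) (φ (g (T t)) / 2 * β * β) t := fun t ht =>
      ((hg _ ht).2.2.2.comp t (hTd t)).mul_const β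
    have hG : ∀ t, 0 ≤ t → t < ρ ^ 2 → ContDiffAt ℝ 2 (fun t => g (T t)) t := fun t h1 h2 =>
      ContDiffAt.comp t (hgc.contDiffAt (isOpen_Ioo.mem_nhds (hTJ t h1 h2)))
        (by simp only [hT]; fun_prop)
    have hv' := le_of_supersolution hd hm hmono hv (hc.comp hv) hsol hG ?_ ?_ hxρ
    · have hJx := hTJ (‖x‖ ^ 2) (sq_nonneg _) (by gcongr)
      obtain ⟨h1, h2, -⟩ := hg _ hJx
      rw [show C - β * (ρ ^ 2 - ‖x‖ ^ 2) = T (‖x‖ ^ 2) from rfl, ← h2]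
      exact hstrict.monotoneOn hvx0 h1 hv'
    · intro y hy
      have hy2 : ‖y‖ ^ 2 < ρ ^ 2 := by gcongr
      have hyJ := hTJ _ (sq_nonneg ‖y‖) hy2
      have hdd : deriv (fun t => g (T t)) =ᶠ[𝓝 (‖y‖ ^ 2)] fun t => √(koPrim φ (g (T t))) * β := by
        filter_upwards [hTcont.continuousAt.preimage_mem_nhds (isOpen_Ioo.mem_nhds hyJ)] with t ht
        exact (hG1 t ht).deriv
      rw [dunklExt_comp_norm_sq hd (hG _ (sq_nonneg _) hy2), hdd.deriv_eq, (hG2 _ hyJ).deriv,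
        hdd.eq_of_nhds]
      obtain ⟨hU0, -, -⟩ := hg _ hyJ
      have hUa := hga _ (hTlo _ (sq_nonneg ‖y‖)) (hTC _ hy2)
      set U := g (T (‖y‖ ^ 2)) with hU
      have hφU : 0 ≤ φ U := by
        rw [← h0]
        exact hmono hU0.le
      have hsq : √(koPrim φ U) ≤ √K * φ U := by
        rw [← Real.sqrt_sq hφU, ← Real.sqrt_mul hK.le]
        refine Real.sqrt_le_sqrt ((koPrim_le_mul hc hmono hU0.le).trans ?_)
        nlinarith [mul_le_mul_of_nonneg_right (hKφ U hUa) hφU]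
      have e1 : 2 * (β * (β * ‖y‖ ^ 2)) ≤ 1 / 2 := by
        have h1 : β * ‖y‖ ^ 2 ≤ D := by
          rw [← hβρ]
          gcongr
        have h2 : β * (4 * D) ≤ 1 := by
          rw [hβ, div_mul_eq_mul_div, div_le_one (by positivity)]
          nlinarith
        nlinarith
      have e2 : 2 * m * β * √K ≤ 1 / 2 := by
        rw [hβ, mul_div_assoc', div_mul_eq_mul_div, div_le_iff₀ (by positivity)]
        linarith
      calc 4 * ‖y‖ ^ 2 * (φ U / 2 * β * β) + 2 * m * (√(koPrim φ U) * β)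
          = 2 * (β * (β * ‖y‖ ^ 2)) * φ U + 2 * m * β * √(koPrim φ U) := by ring
        _ ≤ 1 / 2 * φ U + 2 * m * β * (√K * φ U) := by gcongr
        _ = 1 / 2 * φ U + 2 * m * β * √K * φ U := by ring
        _ ≤ 1 / 2 * φ U + 1 / 2 * φ U := by gcongr
        _ = φ U := by ring
    · intro M s hs
      have hM0 : 0 < max M a := lt_max_of_lt_right ha
      have hTρ : T (ρ ^ 2) = C := by simp [hT]
      have h1 : ∀ᶠ t in 𝓝[<] (ρ ^ 2), koTime φ (max M a) < T t := by
        refine (hTcont.tendsto _).mono_left nhdsWithin_le_nhds |>.eventually (lt_mem_nhds ?_)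
        rw [hTρ]
        exact hC _ hM0
      have h2 : ∀ᶠ t in 𝓝[<] (ρ ^ 2), max s 0 < t :=
        (lt_mem_nhds (max_lt hs (by positivity))).filter_mono nhdsWithin_le_nhds
      obtain ⟨t, ht1, ht2, ht3⟩ := (h1.and (h2.and self_mem_nhdsWithin)).exists
      refine ⟨t, (le_max_left _ _).trans_lt ht2, ht3, ?_⟩
      obtain ⟨h3, h4, -⟩ := hg _ (hTJ t ((le_max_right _ _).trans ht2.le) ht3)
      refine (le_max_left M a).trans ((hstrict.le_iff_le hM0 h3).1 ?_)
      rw [h4]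
      exact ht1.le
  have hlimρ : Tendsto (fun ρ : ℝ => C - D / ρ ^ 2 * (ρ ^ 2 - ‖x‖ ^ 2)) atTop
      (𝓝 (C - (D - D * 0 * ‖x‖ ^ 2))) := by
    have h1 : Tendsto (fun ρ : ℝ => (ρ ^ 2)⁻¹) atTop (𝓝 0) :=
      tendsto_inv_atTop_zero.comp (tendsto_pow_atTop two_ne_zero)
    refine Tendsto.congr' ?_ ((((h1.const_mul D).mul_const (‖x‖ ^ 2)).const_sub D).const_sub C)
    filter_upwards [eventually_gt_atTop 0] with ρ hρ
    field_simp
  have hle : koTime φ (v x) ≤ C - (D - D * 0 * ‖x‖ ^ 2) := by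
    refine ge_of_tendsto hlimρ ?_
    filter_upwards [eventually_gt_atTop ‖x‖, eventually_ge_atTop (2 * D),
      (tendsto_pow_atTop (α := ℝ) two_ne_zero).eventually_ge_atTop (4 * m * D * √K)]
      with ρ h1 h2 h3 using hbound ρ h1 h2 h3
  have := hstrict ha hvx0 hlt
  rw [mul_zero, zero_mul, sub_zero] at hle
  linarith

theorem koPrim_pos_of_lintegral_ne_top (hc : Continuous φ) (hmono : Monotone φ) (h0 : φ 0 = 0)
    (hfin : ∀ a, 0 < a → ∫⁻ t in Set.Ioi a, (ENNReal.ofReal (√(koPrim φ t)))⁻¹ ≠ ⊤) {t : ℝ}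
    (ht : 0 < t) : 0 < koPrim φ t := by
  by_contra! hle
  refine hfin (t / 2) (half_pos ht) (top_le_iff.1 ?_)
  calc (⊤ : ℝ≥0∞) = ∫⁻ _ in Set.Ioc (t / 2) t, ⊤ := by
        rw [setLIntegral_const, Real.volume_Ioc, ENNReal.top_mul]
        simpa using ht
    _ = ∫⁻ s in Set.Ioc (t / 2) t, (ENNReal.ofReal (√(koPrim φ s)))⁻¹ := by
        refine setLIntegral_congr_fun measurableSet_Ioc fun s hs => ?_
        have h1 : koPrim φ s ≤ 0 :=
          (koPrim_mono hc hmono h0 ((half_pos ht).trans hs.1).le hs.2).trans hle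
        simp [Real.sqrt_eq_zero_of_nonpos h1]
    _ ≤ _ := lintegral_mono_set fun s hs => hs.1

end Nonexistence

section RadialInverse

/-- The weighted mean `∫₀¹ τ ^ (m - 1) c(tτ) dτ`. -/
def radialMean (m : ℝ) (c : ℝ → ℝ) (t : ℝ) : ℝ := ∫ τ in (0 : ℝ)..1, τ ^ (m - 1) * c (t * τ)

/-- The solution of the radial equation `Δu = c` in dimension `m` vanishing at the origin
together with its derivative. -/
def radialInv (m : ℝ) (c : ℝ → ℝ) (r : ℝ) : ℝ := ∫ t in (0 : ℝ)..r, t * radialMean m c t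

variable {m : ℝ} {c c₁ c₂ : ℝ → ℝ}

theorem continuous_rpow_mul_comp_mul (hm : 1 ≤ m) (hc : Continuous c) :
    Continuous fun p : ℝ × ℝ => p.2 ^ (m - 1) * c (p.1 * p.2) :=
  (continuous_snd.rpow_const fun _ => Or.inr (by linarith)).mul (by fun_prop)

theorem intervalIntegrable_rpow_mul_comp_mul (hm : 1 ≤ m) (hc : Continuous c) (t a b : ℝ) :
    IntervalIntegrable (fun τ => τ ^ (m - 1) * c (t * τ)) volume a b :=
  ((continuous_rpow_mul_comp_mul hm hc).comp
    (continuous_const.prodMk continuous_id : Continuous fun τ : ℝ => (t, τ))).intervalIntegrable a b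

theorem continuous_radialMean (hm : 1 ≤ m) (hc : Continuous c) : Continuous (radialMean m c) :=
  intervalIntegral.continuous_parametric_intervalIntegral_of_continuous'
    (continuous_rpow_mul_comp_mul hm hc) 0 1

theorem intervalIntegrable_mul_radialMean (hm : 1 ≤ m) (hc : Continuous c) (a b : ℝ) :
    IntervalIntegrable (fun t => t * radialMean m c t) volume a b :=
  (continuous_id.mul (continuous_radialMean hm hc)).intervalIntegrable a b

theorem continuous_radialInv (hm : 1 ≤ m) (hc : Continuous c) : Continuous (radialInv m c) :=
  intervalIntegral.continuous_primitive (intervalIntegrable_mul_radialMean hm hc) 0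

theorem radialMean_add_const_mul (hm : 1 ≤ m) (h₁ : Continuous c₁) (h₂ : Continuous c₂)
    (a t : ℝ) : radialMean m (fun s => c₁ s + a * c₂ s) t =
      radialMean m c₁ t + a * radialMean m c₂ t := by
  rw [radialMean, radialMean, radialMean, ← intervalIntegral.integral_const_mul,
    ← intervalIntegral.integral_add (intervalIntegrable_rpow_mul_comp_mul hm h₁ _ _ _)
    ((intervalIntegrable_rpow_mul_comp_mul hm h₂ _ _ _).const_mul _)]
  congr 1
  ext τ
  ring

theorem radialInv_add_const_mul (hm : 1 ≤ m) (h₁ : Continuous c₁) (h₂ : Continuous c₂)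
    (a r : ℝ) : radialInv m (fun s => c₁ s + a * c₂ s) r =
      radialInv m c₁ r + a * radialInv m c₂ r := by
  rw [radialInv, radialInv, radialInv, ← intervalIntegral.integral_const_mul,
    ← intervalIntegral.integral_add (intervalIntegrable_mul_radialMean hm h₁ _ _)
    ((intervalIntegrable_mul_radialMean hm h₂ _ _).const_mul _)]
  congr 1
  ext t
  rw [radialMean_add_const_mul hm h₁ h₂]
  ring

theorem radialMean_mono (hm : 1 ≤ m) (h₁ : Continuous c₁) (h₂ : Continuous c₂)
    (h : ∀ s, 0 ≤ s → c₁ s ≤ c₂ s) {t : ℝ} (ht : 0 ≤ t) : radialMean m c₁ t ≤ radialMean m c₂ t :=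
  intervalIntegral.integral_mono_on zero_le_one (intervalIntegrable_rpow_mul_comp_mul hm h₁ _ _ _)
    (intervalIntegrable_rpow_mul_comp_mul hm h₂ _ _ _) fun _ hτ =>
      mul_le_mul_of_nonneg_left (h _ (mul_nonneg ht hτ.1)) (Real.rpow_nonneg hτ.1 _)

theorem radialInv_mono (hm : 1 ≤ m) (h₁ : Continuous c₁) (h₂ : Continuous c₂)
    (h : ∀ s, 0 ≤ s → c₁ s ≤ c₂ s) {r : ℝ} (hr : 0 ≤ r) : radialInv m c₁ r ≤ radialInv m c₂ r :=
  intervalIntegral.integral_mono_on hr (intervalIntegrable_mul_radialMean hm h₁ _ _)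
    (intervalIntegrable_mul_radialMean hm h₂ _ _) fun _ ht =>
      mul_le_mul_of_nonneg_left (radialMean_mono hm h₁ h₂ h ht.1) ht.1

theorem radialInv_nonneg (hc : ∀ s, 0 ≤ s → 0 ≤ c s) {r : ℝ} (hr : 0 ≤ r) :
    0 ≤ radialInv m c r :=
  intervalIntegral.integral_nonneg hr fun _ ht => mul_nonneg ht.1 <|
    intervalIntegral.integral_nonneg zero_le_one fun _ hτ =>
      mul_nonneg (Real.rpow_nonneg hτ.1 _) (hc _ (mul_nonneg ht.1 hτ.1))

theorem abs_radialMean_le (hm : 1 ≤ m) {B ρ : ℝ} (hB : ∀ s, 0 ≤ s → s ≤ ρ → |c s| ≤ B) {t : ℝ}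
    (ht : 0 ≤ t) (htρ : t ≤ ρ) : |radialMean m c t| ≤ B := by
  have h := intervalIntegral.norm_integral_le_of_norm_le_const (a := 0) (b := 1) (C := B)
    (f := fun τ => τ ^ (m - 1) * c (t * τ)) fun τ hτ => by
      rw [Set.uIoc_of_le zero_le_one] at hτ
      rw [norm_mul, Real.norm_of_nonneg (Real.rpow_nonneg hτ.1.le _)]
      have h1 : τ ^ (m - 1) ≤ 1 := Real.rpow_le_one hτ.1.le hτ.2 (by linarith)
      have h2 : |c (t * τ)| ≤ B := hB _ (mul_nonneg ht hτ.1.le)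
        ((mul_le_of_le_one_right ht hτ.2).trans htρ)
      calc τ ^ (m - 1) * ‖c (t * τ)‖ ≤ 1 * B :=
            mul_le_mul h1 h2 (norm_nonneg _) zero_le_one
        _ = B := one_mul B
  simpa [radialMean] using h

theorem abs_radialInv_sub_radialInv_le (hm : 1 ≤ m) (hc : Continuous c) {B ρ : ℝ}
    (hB : ∀ s, 0 ≤ s → s ≤ ρ → |c s| ≤ B) {r s : ℝ} (hr : 0 ≤ r) (hrρ : r ≤ ρ) (hs : 0 ≤ s)
    (hsρ : s ≤ ρ) : |radialInv m c r - radialInv m c s| ≤ ρ * B * |r - s| := by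
  rw [radialInv, radialInv, intervalIntegral.integral_interval_sub_left
    (intervalIntegrable_mul_radialMean hm hc _ _) (intervalIntegrable_mul_radialMean hm hc _ _)]
  refine intervalIntegral.norm_integral_le_of_norm_le_const (C := ρ * B)
    (f := fun t => t * radialMean m c t) fun t ht => ?_
  have h1 : 0 ≤ t := (le_min hs hr).trans ht.1.le
  have h2 : t ≤ ρ := ht.2.trans (max_le hsρ hrρ)
  rw [norm_mul, Real.norm_of_nonneg h1]
  exact mul_le_mul h2 (abs_radialMean_le hm hB h1 h2) (norm_nonneg _) (h1.trans h2)

theorem abs_radialInv_le (hm : 1 ≤ m) (hc : Continuous c) {B ρ : ℝ}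
    (hB : ∀ s, 0 ≤ s → s ≤ ρ → |c s| ≤ B) {r : ℝ} (hr : 0 ≤ r) (hrρ : r ≤ ρ) :
    |radialInv m c r| ≤ ρ * B * ρ := by
  have h := abs_radialInv_sub_radialInv_le hm hc hB hr hrρ le_rfl (hr.trans hrρ)
  have h0 : radialInv m c 0 = 0 := intervalIntegral.integral_same
  rw [h0, sub_zero, sub_zero, abs_of_nonneg hr] at h
  have hB0 : 0 ≤ B := (abs_nonneg _).trans (hB r hr hrρ)
  exact h.trans (mul_le_mul_of_nonneg_left hrρ (mul_nonneg (hr.trans hrρ) hB0))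

theorem abs_radialInv_sub_le (hm : 1 ≤ m) (h₁ : Continuous c₁) (h₂ : Continuous c₂) {δ ρ : ℝ}
    (hδ : ∀ s, 0 ≤ s → s ≤ ρ → |c₁ s - c₂ s| ≤ δ) {r : ℝ} (hr : 0 ≤ r) (hrρ : r ≤ ρ) :
    |radialInv m c₁ r - radialInv m c₂ r| ≤ ρ * δ * ρ := by
  have h := abs_radialInv_le hm (c := fun s => c₁ s + (-1) * c₂ s) (B := δ) (ρ := ρ)
    (h₁.add (continuous_const.mul h₂)) (fun s h1 h2 => by
      simpa [← sub_eq_add_neg] using hδ s h1 h2) hr hrρ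
  rw [radialInv_add_const_mul hm h₁ h₂] at h
  simpa [← sub_eq_add_neg] using h

theorem radialInv_const_mul_pow (hm : 1 < m) (a : ℝ) (n : ℕ) (r : ℝ) :
    radialInv m (fun s => a * (s ^ 2) ^ n) r =
      a / (2 * (n + 1) * (m + 2 * n)) * (r ^ 2) ^ (n + 1) := by
  have hn : (0 : ℝ) ≤ n := n.cast_nonneg
  have h1 : ∀ t, radialMean m (fun s => a * (s ^ 2) ^ n) t = a / (m + 2 * n) * (t ^ 2) ^ n := by
    intro t
    have h2 : ∀ τ ∈ Set.uIcc (0 : ℝ) 1, τ ^ (m - 1) * (a * ((t * τ) ^ 2) ^ n) =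
        a * (t ^ 2) ^ n * τ ^ (m - 1 + (2 * n : ℕ)) := by
      intro τ hτ
      rw [Set.uIcc_of_le zero_le_one] at hτ
      rw [Real.rpow_add_natCast' hτ.1 (by push_cast; linarith), pow_mul, mul_pow, mul_pow]
      ring
    rw [radialMean, intervalIntegral.integral_congr h2, intervalIntegral.integral_const_mul,
      integral_rpow (Or.inl (by push_cast; linarith)), Real.one_rpow,
      Real.zero_rpow (by push_cast; linarith)]
    push_cast
    have h5 : m - 1 + 2 * n + 1 = m + 2 * n := by ring
    rw [h5]
    ring
  have h3 : ∀ t, t * (a / (m + 2 * n) * (t ^ 2) ^ n) = a / (m + 2 * n) * t ^ (2 * n + 1) := by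
    intro t
    rw [← pow_mul]
    ring
  simp only [radialInv, h1, h3]
  rw [intervalIntegral.integral_const_mul, integral_pow]
  have : (0 : ℝ) < m + 2 * n := by linarith
  rw [← pow_mul]
  push_cast
  field_simp
  ring

end RadialInverse

section RadialWeak

variable {d : ℕ} {R : Finset (E d)} {k : E d → ℝ} {c : ℝ → ℝ} {ψ : E d → ℝ}

theorem integrable_mul_mul_wk (hd : IsDunklData R k) {f : E d → ℝ} (hf : Continuous f)
    (hψ : Continuous ψ) {ρ : ℝ} (hρ : ∀ x, ρ < ‖x‖ → ψ x = 0) :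
    Integrable fun x => f x * ψ x * wk R k x := by
  have h0 : ∀ x, ρ < ‖x‖ → f x * ψ x = 0 := fun x hx => by rw [hρ x hx, mul_zero]
  obtain ⟨C, hC⟩ := exists_forall_abs_le_of_outside (hf.mul hψ) h0
  exact integrable_mul_wk hd (hf.mul hψ).aestronglyMeasurable hC h0

theorem dunklExt_const_mul_norm_sq_pow (hd : IsDunklData R k) (A : ℝ) (n : ℕ) (x : E d) :
    dunklExt R k (fun y => A * (‖y‖ ^ 2) ^ (n + 1)) x =
      A * (2 * (n + 1) * (dunklDim R k + 2 * n)) * (‖x‖ ^ 2) ^ n := by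
  have h1 : ∀ s : ℝ, HasDerivAt (fun s : ℝ => A * s ^ (n + 1)) (A * (n + 1) * s ^ n) s := fun s =>
    ((hasDerivAt_pow (n + 1) s).const_mul A).congr_deriv (by push_cast; ring_nf)
  have h2 : ∀ s : ℝ, HasDerivAt (fun s : ℝ => A * (n + 1) * s ^ n)
      (A * (n + 1) * (n * s ^ (n - 1))) s := fun s => (hasDerivAt_pow n s).const_mul _
  have e1 : deriv (fun s : ℝ => A * s ^ (n + 1)) = fun s => A * (n + 1) * s ^ n :=
    funext fun s => (h1 s).deriv
  rw [dunklExt_comp_norm_sq hd (G := fun s => A * s ^ (n + 1)) (by fun_prop), e1, (h2 _).deriv]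
  rcases n with _ | n
  · simp
    ring
  · rw [Nat.add_sub_cancel]
    push_cast
    ring

theorem integral_radialInv_poly_mul_dunklLap (hd : IsDunklData R k) (hm : 1 < dunklDim R k)
    (hψ : ContDiff ℝ 2 ψ) {ρ : ℝ} (hρ : ∀ x, ρ < ‖x‖ → ψ x = 0) (p : Polynomial ℝ) :
    ∫ x, radialInv (dunklDim R k) (fun s => p.eval (s ^ 2)) ‖x‖ * dunklLap R k ψ x * wk R k x =
      ∫ x, p.eval (‖x‖ ^ 2) * ψ x * wk R k x := by
  have hcont : ∀ p : Polynomial ℝ, Continuous fun s : ℝ => p.eval (s ^ 2) := fun p =>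
    p.continuous.comp (continuous_pow 2)
  have hinv : ∀ p : Polynomial ℝ, Continuous fun x : E d =>
      radialInv (dunklDim R k) (fun s => p.eval (s ^ 2)) ‖x‖ := fun p =>
    (continuous_radialInv hm.le (hcont p)).comp continuous_norm
  have hnorm : ∀ p : Polynomial ℝ, Continuous fun x : E d => p.eval (‖x‖ ^ 2) := fun p =>
    (hcont p).comp continuous_norm
  induction p using Polynomial.induction_on' with
  | add p q hp hq =>
    have e : ∀ x : E d, radialInv (dunklDim R k) (fun s => p.eval (s ^ 2) + q.eval (s ^ 2)) ‖x‖ =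
        radialInv (dunklDim R k) (fun s => p.eval (s ^ 2)) ‖x‖ +
          radialInv (dunklDim R k) (fun s => q.eval (s ^ 2)) ‖x‖ := fun x => by
      have := radialInv_add_const_mul hm.le (hcont p) (hcont q) 1 ‖x‖
      simpa using this
    simp only [Polynomial.eval_add, e, add_mul]
    rw [integral_add (integrable_mul_dunklLap hd (hinv p) hψ (Or.inr hρ))
      (integrable_mul_dunklLap hd (hinv q) hψ (Or.inr hρ)), hp, hq,
      integral_add (integrable_mul_mul_wk hd (hnorm p) hψ.continuous hρ)
      (integrable_mul_mul_wk hd (hnorm q) hψ.continuous hρ)]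
  | monomial n a =>
    have hn : (0 : ℝ) ≤ n := n.cast_nonneg
    simp only [Polynomial.eval_monomial, radialInv_const_mul_pow hm]
    rw [integral_mul_dunklLap_comm hd (by
        have := contDiff_norm_sq ℝ (E := E d) (n := 2)
        fun_prop) hψ (hasCompactSupport_of_outside hρ)]
    refine integral_congr_ae ?_
    filter_upwards [ae_dunklExt_eq_dunklLap hd (fun x : E d =>
      a / (2 * (n + 1) * (dunklDim R k + 2 * n)) * (‖x‖ ^ 2) ^ (n + 1))] with x hx
    rw [← hx, dunklExt_const_mul_norm_sq_pow hd, div_mul_cancel₀ _ (by positivity)]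
    ring

/-- `x ↦ radialInv m c ‖x‖` is a distributional solution of `Δ_k u = c(‖x‖)`. -/
theorem integral_radialInv_mul_dunklLap (hd : IsDunklData R k) (hm : 1 < dunklDim R k)
    (hc : Continuous c) (hψ : ContDiff ℝ 2 ψ) (hψs : HasCompactSupport ψ) :
    ∫ x, radialInv (dunklDim R k) c ‖x‖ * dunklLap R k ψ x * wk R k x =
      ∫ x, c ‖x‖ * ψ x * wk R k x := by
  obtain ⟨ρ, hρ⟩ := exists_eq_zero_of_lt_norm hψs
  have hi : ∀ f : E d → ℝ, Continuous f →
      Integrable fun x => f x * dunklLap R k ψ x * wk R k x := fun f hf =>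
    integrable_mul_dunklLap hd hf hψ (Or.inr hρ)
  have hi' : ∀ f : E d → ℝ, Continuous f → Integrable fun x => f x * ψ x * wk R k x :=
    fun f hf => integrable_mul_mul_wk hd hf hψ.continuous hρ
  set J := ∫ x, ‖1 * dunklLap R k ψ x * wk R k x‖ with hJ
  set J' := ∫ x, ‖1 * ψ x * wk R k x‖ with hJ'
  have hbound : ∀ δ : ℝ, 0 < δ →
      |(∫ x, radialInv (dunklDim R k) c ‖x‖ * dunklLap R k ψ x * wk R k x) -
        ∫ x, c ‖x‖ * ψ x * wk R k x| ≤ (ρ * δ * ρ * J + δ * J') := by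
    intro δ hδ
    obtain ⟨p, hp⟩ := exists_polynomial_near_of_continuousOn 0 (ρ ^ 2) (fun s => c (√s))
      (hc.comp Real.continuous_sqrt).continuousOn δ hδ
    have hp' : ∀ s, 0 ≤ s → s ≤ ρ → |c s - p.eval (s ^ 2)| ≤ δ := fun s h1 h2 => by
      have := (hp (s ^ 2) ⟨sq_nonneg s, pow_le_pow_left₀ h1 h2 2⟩).le
      rwa [Real.sqrt_sq h1, abs_sub_comm] at this
    have hpc : Continuous fun s : ℝ => p.eval (s ^ 2) := p.continuous.comp (continuous_pow 2)
    have c1 : Continuous fun x : E d => radialInv (dunklDim R k) c ‖x‖ :=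
      (continuous_radialInv hm.le hc).comp continuous_norm
    have c2 : Continuous fun x : E d =>
        radialInv (dunklDim R k) (fun s => p.eval (s ^ 2)) ‖x‖ :=
      (continuous_radialInv hm.le hpc).comp continuous_norm
    have c3 : Continuous fun x : E d => c ‖x‖ := hc.comp continuous_norm
    have c4 : Continuous fun x : E d => p.eval (‖x‖ ^ 2) := hpc.comp continuous_norm
    have e := integral_radialInv_poly_mul_dunklLap hd hm hψ hρ p
    have e1 : (∫ x, radialInv (dunklDim R k) c ‖x‖ * dunklLap R k ψ x * wk R k x) -
        ∫ x, c ‖x‖ * ψ x * wk R k x =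
        (∫ x, (radialInv (dunklDim R k) c ‖x‖ -
          radialInv (dunklDim R k) (fun s => p.eval (s ^ 2)) ‖x‖) * dunklLap R k ψ x * wk R k x) -
        ∫ x, (c ‖x‖ - p.eval (‖x‖ ^ 2)) * ψ x * wk R k x := by
      simp only [sub_mul]
      rw [integral_sub (hi _ c1) (hi _ c2), integral_sub (hi' _ c3) (hi' _ c4), e]
      ring
    rw [e1]
    refine (abs_sub _ _).trans (add_le_add ?_ ?_)
    · rw [← Real.norm_eq_abs, hJ, ← integral_const_mul]
      refine norm_integral_le_of_norm_le ((hi _ continuous_const).norm.const_mul _)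
        (Eventually.of_forall fun x => ?_)
      rcases le_or_gt ‖x‖ ρ with h | h
      · rw [mul_assoc, norm_mul, one_mul]
        exact mul_le_mul_of_nonneg_right
          (abs_radialInv_sub_le hm.le hc hpc hp' (norm_nonneg x) h) (norm_nonneg _)
      · rw [dunklLap_eq_zero_of_outside hρ h]
        simp
    · rw [← Real.norm_eq_abs, hJ', ← integral_const_mul]
      refine norm_integral_le_of_norm_le ((hi' _ continuous_const).norm.const_mul _)
        (Eventually.of_forall fun x => ?_)
      rcases le_or_gt ‖x‖ ρ with h | h
      · rw [mul_assoc, norm_mul, one_mul]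
        exact mul_le_mul_of_nonneg_right (hp' _ (norm_nonneg x) h) (norm_nonneg _)
      · rw [hρ x h]
        simp
  have hlim : Tendsto (fun δ : ℝ => ρ * δ * ρ * J + δ * J') (𝓝[>] 0) (𝓝 0) := by
    have : Continuous fun δ : ℝ => ρ * δ * ρ * J + δ * J' := by fun_prop
    simpa using (this.tendsto 0).mono_left nhdsWithin_le_nhds
  rw [← sub_eq_zero, ← abs_nonpos_iff]
  exact ge_of_tendsto hlim (by filter_upwards [self_mem_nhdsWithin] with δ hδ using hbound δ hδ)

end RadialWeak

section RadialSolution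

variable {m : ℝ} {φ F F' : ℝ → ℝ}

/-- Under the Keller–Osserman condition, the ordinary differential equation `D²F = φ(F)` has a
nondecreasing solution on `[0, ∞)` with `F(0) = 1`. -/
theorem exists_koMajorant (hc : Continuous φ) (hΦ : ∀ t, 0 < t → 0 < koPrim φ t) {a : ℝ}
    (ha : 0 < a) (hinf : ∫⁻ t in Set.Ioi a, (ENNReal.ofReal (√(koPrim φ t)))⁻¹ = ⊤) :
    ∃ F F' : ℝ → ℝ, F 0 = 1 ∧ (∀ r, 0 ≤ r → 0 ≤ F' r) ∧ (∀ r, 0 ≤ r → HasDerivAt F (F' r) r) ∧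
      ∀ r, 0 ≤ r → HasDerivAt F' (φ (F r)) r := by
  have hhalf : koTime φ (1 / 2) < koTime φ 1 := strictMonoOn_koTime hc hΦ
    (by norm_num [Set.mem_Ioi]) (by norm_num [Set.mem_Ioi]) (by norm_num)
  have h1 : koTime φ 1 = 0 := intervalIntegral.integral_same
  obtain ⟨g, hg⟩ := exists_koFlow hc hΦ (J := Set.Ioi (koTime φ (1 / 2))) isOpen_Ioi
    fun s hs => by
      obtain ⟨t, ht1, ht⟩ := exists_lt_koTime hc hΦ ha hinf s
      exact exists_koTime_eq hc hΦ one_half_pos (by linarith) ⟨le_of_lt hs, ht.le⟩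
  have hmem : ∀ r : ℝ, 0 ≤ r → √2 * r ∈ Set.Ioi (koTime φ (1 / 2)) := fun r hr =>
    (hhalf.trans_eq h1).trans_le (mul_nonneg (Real.sqrt_nonneg 2) hr)
  have hlin : ∀ r : ℝ, HasDerivAt (fun r => √2 * r) √2 r := fun r => by
    simpa using (hasDerivAt_id r).const_mul √2
  refine ⟨fun r => g (√2 * r), fun r => √2 * √(koPrim φ (g (√2 * r))), ?_,
    fun r _ => by positivity, fun r hr => ?_, fun r hr => ?_⟩
  · obtain ⟨h2, h3, -⟩ := hg _ (hmem 0 le_rfl)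
    exact (strictMonoOn_koTime hc hΦ).injOn h2 (Set.mem_Ioi.2 one_pos)
      (by rw [h3, h1, mul_zero])
  · exact ((hg _ (hmem r hr)).2.2.1.comp r (hlin r)).congr_deriv (mul_comm _ _)
  · refine (((hg _ (hmem r hr)).2.2.2.comp r (hlin r)).const_mul √2).congr_deriv ?_
    have := Real.mul_self_sqrt (zero_le_two (α := ℝ))
    linear_combination (φ (g (√2 * r)) / 2) * this

theorem add_radialInv_le_majorant (hm : 1 ≤ m) (hc : Continuous φ) (hφ : ∀ t, 0 ≤ φ t)
    (hF0 : F 0 = 1) (hF'0 : ∀ r, 0 ≤ r → 0 ≤ F' r) (hF : ∀ r, 0 ≤ r → HasDerivAt F (F' r) r)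
    (hF' : ∀ r, 0 ≤ r → HasDerivAt F' (φ (F r)) r) {r : ℝ} (hr : 0 ≤ r) :
    1 + radialInv m (fun s => φ (F (max s 0))) r ≤ F r := by
  have hFc : Continuous fun s => F (max s 0) := continuous_iff_continuousAt.2 fun s =>
    ContinuousAt.comp (f := fun s : ℝ => max s 0) (hF _ (le_max_right s 0)).continuousAt
      (by fun_prop)
  set c : ℝ → ℝ := fun s => φ (F (max s 0)) with hc'
  have hcc : Continuous c := hc.comp hFc
  have hmean : ∀ t, 0 ≤ t → t * radialMean m c t ≤ F' t := by
    intro t ht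
    have h1 : radialMean m c t ≤ ∫ τ in (0 : ℝ)..1, c (t * τ) := by
      refine intervalIntegral.integral_mono_on zero_le_one
        (intervalIntegrable_rpow_mul_comp_mul hm hcc _ _ _)
        ((hcc.comp (continuous_const.mul continuous_id)).intervalIntegrable _ _) fun τ hτ => ?_
      exact mul_le_of_le_one_left (hφ _) (Real.rpow_le_one hτ.1 hτ.2 (by linarith))
    have h2 : ∫ s in (0 : ℝ)..t, c s = F' t - F' 0 := by
      refine intervalIntegral.integral_eq_sub_of_hasDerivAt (fun s hs => ?_)
        (hcc.intervalIntegrable _ _)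
      rw [Set.uIcc_of_le ht] at hs
      exact (hF' s hs.1).congr_deriv (by simp only [hc', max_eq_left hs.1])
    calc t * radialMean m c t ≤ t * ∫ τ in (0 : ℝ)..1, c (t * τ) :=
          mul_le_mul_of_nonneg_left h1 ht
      _ = F' t - F' 0 := by
          rw [intervalIntegral.mul_integral_comp_mul_left, mul_zero, mul_one, h2]
      _ ≤ F' t := sub_le_self _ (hF'0 0 le_rfl)
  have hi : IntervalIntegrable F' volume 0 r := by
    refine ContinuousOn.intervalIntegrable fun s hs => ?_
    rw [Set.uIcc_of_le hr] at hs
    exact (hF' s hs.1).continuousAt.continuousWithinAt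
  have h3 : ∫ t in (0 : ℝ)..r, F' t = F r - F 0 :=
    intervalIntegral.integral_eq_sub_of_hasDerivAt (fun s hs => by
      rw [Set.uIcc_of_le hr] at hs
      exact hF s hs.1) hi
  have h4 : radialInv m c r ≤ ∫ t in (0 : ℝ)..r, F' t :=
    intervalIntegral.integral_mono_on hr (intervalIntegrable_mul_radialMean hm hcc _ _) hi
      fun t ht => hmean t ht.1
  linarith

/-- The Picard iterates of `f ↦ 1 + radialInv m (φ ∘ f)`. -/
def radialIter (m : ℝ) (φ : ℝ → ℝ) : ℕ → ℝ → ℝ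
  | 0, _ => 1
  | n + 1, r => 1 + radialInv m (fun s => φ (radialIter m φ n s)) (max r 0)

theorem continuous_radialIter (hm : 1 ≤ m) (hc : Continuous φ) (n : ℕ) :
    Continuous (radialIter m φ n) := by
  induction n with
  | zero => exact continuous_const
  | succ n ih =>
    exact continuous_const.add ((continuous_radialInv hm (hc.comp ih)).comp (by fun_prop))

theorem one_le_radialIter (hφ : ∀ t, 0 ≤ φ t) (n : ℕ) (r : ℝ) : 1 ≤ radialIter m φ n r := by
  cases n with
  | zero => exact le_rfl
  | succ n => exact le_add_of_nonneg_right (radialInv_nonneg (fun _ _ => hφ _) (le_max_right _ _))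

theorem radialIter_le_succ (hm : 1 ≤ m) (hc : Continuous φ) (hmono : Monotone φ)
    (hφ : ∀ t, 0 ≤ φ t) (n : ℕ) (r : ℝ) : radialIter m φ n r ≤ radialIter m φ (n + 1) r := by
  induction n generalizing r with
  | zero => exact one_le_radialIter hφ 1 r
  | succ n ih =>
    exact add_le_add_right (radialInv_mono hm (hc.comp (continuous_radialIter hm hc n))
      (hc.comp (continuous_radialIter hm hc (n + 1))) (fun s _ => hmono (ih s))
      (le_max_right _ _)) 1

theorem radialIter_le (hm : 1 ≤ m) (hc : Continuous φ) (hmono : Monotone φ)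
    (hF : Continuous fun s => F (max s 0)) (hF1 : ∀ r, 0 ≤ r → 1 ≤ F r)
    (hbound : ∀ r, 0 ≤ r → 1 + radialInv m (fun s => φ (F (max s 0))) r ≤ F r) (n : ℕ) (r : ℝ) :
    radialIter m φ n r ≤ F (max r 0) := by
  induction n generalizing r with
  | zero => exact hF1 _ (le_max_right _ _)
  | succ n ih =>
    refine le_trans (add_le_add_right ?_ 1) (hbound _ (le_max_right _ _))
    exact radialInv_mono hm (hc.comp (continuous_radialIter hm hc n)) (hc.comp hF)
      (fun s _ => hmono (ih s)) (le_max_right _ _)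

theorem exists_radial_solution (hm : 1 ≤ m) (hc : Continuous φ) (hmono : Monotone φ)
    (hφ : ∀ t, 0 ≤ φ t) (hF : Continuous fun s => F (max s 0)) (hF1 : ∀ r, 0 ≤ r → 1 ≤ F r)
    (hbound : ∀ r, 0 ≤ r → 1 + radialInv m (fun s => φ (F (max s 0))) r ≤ F r) :
    ∃ f : ℝ → ℝ, Continuous f ∧ (∀ r, 1 ≤ f r) ∧
      ∀ r, 0 ≤ r → f r = 1 + radialInv m (fun s => φ (f s)) r := by
  have hle := radialIter_le hm hc hmono hF hF1 hbound
  have hcont := continuous_radialIter hm hc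
  have hmon : ∀ r, Monotone fun n => radialIter m φ n r := fun r =>
    monotone_nat_of_le_succ fun n => radialIter_le_succ hm hc hmono hφ n r
  set f : ℝ → ℝ := fun r => ⨆ n, radialIter m φ n r with hf
  have hlim : ∀ r, Tendsto (fun n => radialIter m φ n r) atTop (𝓝 (f r)) := fun r =>
    tendsto_atTop_ciSup (hmon r) ⟨F (max r 0), by
      rintro _ ⟨n, rfl⟩
      exact hle n r⟩
  have hlip : ∀ ρ, 0 ≤ ρ → ∃ K, 0 ≤ K ∧ ∀ r s, r ≤ ρ → s ≤ ρ → |f r - f s| ≤ K * |r - s| := by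
    intro ρ hρ
    obtain ⟨B, hB⟩ := (isCompact_Icc (a := (0 : ℝ)) (b := ρ)).exists_bound_of_continuousOn
      (hc.comp hF).continuousOn
    have hB' : ∀ n s, 0 ≤ s → s ≤ ρ → |φ (radialIter m φ n s)| ≤ B := fun n s h1 h2 => by
      rw [abs_of_nonneg (hφ _)]
      exact (hmono (hle n s)).trans ((le_abs_self _).trans (hB s ⟨h1, h2⟩))
    have hB0 : 0 ≤ B := (abs_nonneg _).trans (hB' 0 0 le_rfl hρ)
    refine ⟨ρ * B, by positivity, fun r s hr hs => ?_⟩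
    refine le_of_tendsto (((hlim r).sub (hlim s)).abs) ?_
    filter_upwards [eventually_ge_atTop 1] with n hn
    obtain ⟨n, rfl⟩ := Nat.exists_eq_add_of_le' hn
    simp only [radialIter, add_sub_add_left_eq_sub]
    refine (abs_radialInv_sub_radialInv_le hm (hc.comp (hcont n)) (hB' n) (le_max_right _ _)
      (max_le hr hρ) (le_max_right _ _) (max_le hs hρ)).trans ?_
    exact mul_le_mul_of_nonneg_left (abs_max_sub_max_le_abs _ _ _) (by positivity)
  have hfc : Continuous f := continuous_iff_continuousAt.2 fun r => by
    obtain ⟨K, -, hK⟩ := hlip (|r| + 1) (by positivity)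
    refine tendsto_iff_dist_tendsto_zero.2 (squeeze_zero' (g := fun s => K * |s - r|)
      (Eventually.of_forall fun _ => dist_nonneg) ?_ ?_)
    · filter_upwards [Iio_mem_nhds (show r < |r| + 1 by linarith [le_abs_self r])] with s hs
      exact hK s r (le_of_lt hs) (by linarith [le_abs_self r])
    · have : Continuous fun s => K * |s - r| := by fun_prop
      simpa using this.tendsto r
  refine ⟨f, hfc, fun r => ge_of_tendsto' (hlim r) fun n => one_le_radialIter hφ n r,
    fun r hr => ?_⟩
  have hunif : TendstoUniformlyOn (fun n s => φ (radialIter m φ n s)) (fun s => φ (f s)) atTop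
      (Set.Icc 0 r) := Monotone.tendstoUniformlyOn_of_forall_tendsto isCompact_Icc
    (fun n => (hc.comp (hcont n)).continuousOn) (fun s _ => hmono.comp (hmon s))
    (hc.comp hfc).continuousOn fun s _ => (hc.tendsto _).comp (hlim s)
  refine tendsto_nhds_unique ((tendsto_add_atTop_iff_nat 1).2 (hlim r)) ?_
  simp only [radialIter, max_eq_left hr]
  refine tendsto_const_nhds.add (Metric.tendsto_atTop.2 fun ε hε => ?_)
  obtain ⟨δ, hδ, hδε⟩ : ∃ δ, 0 < δ ∧ r * δ * r < ε := by
    refine ⟨ε / (r * r + 1), by positivity, ?_⟩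
    rw [mul_div_assoc', div_mul_eq_mul_div, div_lt_iff₀ (by positivity)]
    nlinarith
  obtain ⟨N, hN⟩ := eventually_atTop.1 (Metric.tendstoUniformlyOn_iff.1 hunif δ hδ)
  refine ⟨N, fun n hn => lt_of_le_of_lt ?_ hδε⟩
  rw [Real.dist_eq]
  refine abs_radialInv_sub_le hm (hc.comp (hcont n)) (hc.comp hfc) (fun s h1 h2 => ?_) hr le_rfl
  have := hN n hn s ⟨h1, h2⟩
  rw [dist_comm, Real.dist_eq] at this
  exact this.le

theorem exists_radial_solution_of_lintegral_eq_top (hm : 1 ≤ m) (hc : Continuous φ)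
    (hmono : Monotone φ) (hφ : ∀ t, 0 ≤ φ t) (hΦ : ∀ t, 0 < t → 0 < koPrim φ t) {a : ℝ}
    (ha : 0 < a) (hinf : ∫⁻ t in Set.Ioi a, (ENNReal.ofReal (√(koPrim φ t)))⁻¹ = ⊤) :
    ∃ f : ℝ → ℝ, Continuous f ∧ (∀ r, 1 ≤ f r) ∧
      ∀ r, 0 ≤ r → f r = 1 + radialInv m (fun s => φ (f s)) r := by
  obtain ⟨F, F', hF0, hF'0, hF, hF'⟩ := exists_koMajorant hc hΦ ha hinf
  have hbound := fun r (hr : 0 ≤ r) => add_radialInv_le_majorant hm hc hφ hF0 hF'0 hF hF' hr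
  exact exists_radial_solution hm hc hmono hφ (continuous_iff_continuousAt.2 fun s =>
    ContinuousAt.comp (f := fun s : ℝ => max s 0) (hF _ (le_max_right s 0)).continuousAt
      (by fun_prop)) (fun r hr => le_trans (le_add_of_nonneg_right
        (radialInv_nonneg (fun _ _ => hφ _) hr)) (hbound r hr)) hbound

end RadialSolution

section Existence

variable {d : ℕ} {R : Finset (E d)} {k : E d → ℝ} {φ : ℝ → ℝ}

theorem exists_pos_solution (hd : IsDunklData R k) (hm : 1 < dunklDim R k) (hc : Continuous φ)
    (hmono : Monotone φ) {a : ℝ} (ha : 0 < a)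
    (hinf : ∫⁻ t in Set.Ioi a, (ENNReal.ofReal (√(koPrim φ t)))⁻¹ = ⊤)
    (hφ : ∀ t, 0 ≤ φ t) :
    ∃ v : E d → ℝ, Continuous v ∧ (∀ x, 0 < v x) ∧
      ∀ ψ : E d → ℝ, ContDiff ℝ 2 ψ → HasCompactSupport ψ →
        ∫ x, v x * dunklLap R k ψ x * wk R k x = ∫ x, φ (v x) * ψ x * wk R k x := by
  by_cases hz : ∃ t, 0 < t ∧ φ t = 0
  · obtain ⟨t, ht, hφt⟩ := hz
    refine ⟨fun _ => t, continuous_const, fun _ => ht, fun ψ hψ hψs => ?_⟩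
    simp only [mul_assoc, hφt, zero_mul, integral_zero]
    rw [integral_const_mul, integral_dunklLap_eq_zero hd hψ hψs, mul_zero]
  · push Not at hz
    have hpos : ∀ t, 0 < t → 0 < φ t := fun t ht => (hφ t).lt_of_ne' (hz t ht)
    have hΦ : ∀ t, 0 < t → 0 < koPrim φ t := fun t ht =>
      intervalIntegral.intervalIntegral_pos_of_pos_on (hc.intervalIntegrable _ _)
        (fun s hs => hpos s hs.1) ht
    obtain ⟨f, hfc, hf1, hf⟩ :=
      exists_radial_solution_of_lintegral_eq_top hm.le hc hmono hφ hΦ ha hinf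
    refine ⟨fun x => f ‖x‖, hfc.comp continuous_norm, fun x => one_pos.trans_le (hf1 _),
      fun ψ hψ hψs => ?_⟩
    have hcf : Continuous fun s => φ (f s) := hc.comp hfc
    have hi : ∀ u : E d → ℝ, Continuous u →
        Integrable fun x => u x * dunklLap R k ψ x * wk R k x := by
      intro u hu
      obtain ⟨ρ, hρ⟩ := exists_eq_zero_of_lt_norm hψs
      exact integrable_mul_dunklLap hd hu hψ (Or.inr hρ)
    rw [← integral_radialInv_mul_dunklLap hd hm hcf hψ hψs]
    have e : ∀ x : E d, f ‖x‖ * dunklLap R k ψ x * wk R k x =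
        1 * dunklLap R k ψ x * wk R k x +
          radialInv (dunklDim R k) (fun s => φ (f s)) ‖x‖ * dunklLap R k ψ x * wk R k x := by
      intro x
      rw [hf _ (norm_nonneg x), add_mul, add_mul]
    simp only [e]
    rw [integral_add (hi (fun _ => 1) continuous_const)
      (hi (fun x => radialInv (dunklDim R k) (fun s => φ (f s)) ‖x‖)
        ((continuous_radialInv hm.le hcf).comp continuous_norm))]
    simp only [one_mul]
    rw [integral_dunklLap_eq_zero hd hψ hψs, zero_add]

end Existence

/-- existence of a nontrivial entire nonnegative solution of Δ_k v = φ(v) on ℝ^d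
iff φ satisfies the Keller--Osserman condition. -/
theorem dunkl_entire_solution_iff_keller_osserman
    (d : ℕ) (hd : 1 ≤ d)
    (R : Finset (E d)) (hR0 : ∀ α ∈ R, α ≠ 0)
    (hRline : ∀ α ∈ R, (R : Set (E d)) ∩ {x | ∃ c : ℝ, x = c • α} = {α, -α})
    (hRrefl : ∀ α ∈ R, ∀ β ∈ R, dunklReflect α β ∈ R)
    (k : E d → ℝ) (hkpos : ∀ α ∈ R, 0 < k α)
    (hkinv : ∀ α ∈ R, ∀ β ∈ R, k (dunklReflect α β) = k β)
    (hm : 2 < (d : ℝ) + ∑ α ∈ R, k α)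
    (φ : ℝ → ℝ) (hφ0 : φ 0 = 0)
    (hφmono : MonotoneOn φ (Set.Ici 0))
    (hφnonneg : ∀ t : ℝ, 0 ≤ t → 0 ≤ φ t)
    (hφlip : ∀ x ∈ Set.Ici (0 : ℝ), ∃ K : NNReal, ∃ s ∈ nhdsWithin x (Set.Ici 0),
      LipschitzOnWith K φ s)
 :
    (∃ v : E d → ℝ,
        Continuous v ∧ (∀ x, 0 ≤ v x) ∧ (∃ x, v x ≠ 0) ∧
        IsDunklSol R k φ Set.univ v) ↔
      (∃ a : ℝ, 0 < a ∧
        ∫⁻ t in Set.Ioi a,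
          (ENNReal.ofReal (Real.sqrt (∫ s in (0:ℝ)..t, φ s)))⁻¹ = ⊤) := by
  have hD : IsDunklData R k := ⟨hR0, hRrefl, hkpos, hkinv⟩
  have hdim : 2 < dunklDim R k := hm
  have hcOn : ContinuousOn φ (Set.Ici 0) := fun x hx => by
    obtain ⟨K, s, hs, hK⟩ := hφlip x hx
    exact (hK.continuousOn x (mem_of_mem_nhdsWithin hx hs)).mono_of_mem_nhdsWithin hs
  set φ' : ℝ → ℝ := fun t => φ (max t 0) with hφ'
  have heq : ∀ t, 0 ≤ t → φ' t = φ t := fun t ht => by simp only [hφ', max_eq_left ht]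
  have hc : Continuous φ' := hcOn.comp_continuous (by fun_prop) fun t => le_max_right t 0
  have hmono : Monotone φ' := fun s t hst =>
    hφmono (le_max_right s 0) (le_max_right t 0) (max_le_max_right 0 hst)
  have h0 : φ' 0 = 0 := by rw [heq 0 le_rfl, hφ0]
  have hnn : ∀ t, 0 ≤ φ' t := fun t => hφnonneg _ (le_max_right t 0)
  have hprim : ∀ t, 0 ≤ t → koPrim φ' t = ∫ s in (0 : ℝ)..t, φ s := fun t ht =>
    intervalIntegral.integral_congr fun s hs => by
      rw [Set.uIcc_of_le ht] at hs
      exact heq s hs.1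
  have hInt : ∀ a, 0 < a → ∫⁻ t in Set.Ioi a, (ENNReal.ofReal (√(koPrim φ' t)))⁻¹ =
      ∫⁻ t in Set.Ioi a, (ENNReal.ofReal (√(∫ s in (0 : ℝ)..t, φ s)))⁻¹ := fun a ha =>
    setLIntegral_congr_fun measurableSet_Ioi fun t ht => by
      rw [hprim t (ha.trans ht).le]
  constructor
  · rintro ⟨v, hv, hv0, ⟨x, hx⟩, hsol⟩
    by_contra hne
    have hfin : ∀ a, 0 < a →
        ∫⁻ t in Set.Ioi a, (ENNReal.ofReal (√(koPrim φ' t)))⁻¹ ≠ ⊤ := fun a ha h =>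
      hne ⟨a, ha, (hInt a ha).symm.trans h⟩
    have hΦ : ∀ t, 0 < t → 0 < koPrim φ' t := fun t ht =>
      koPrim_pos_of_lintegral_ne_top hc hmono h0 hfin ht
    obtain ⟨C, hlim, hC⟩ := exists_tendsto_koTime hc hΦ (hfin 1 one_pos)
    refine hx (le_antisymm (le_of_forall_pos_le_add fun a ha => ?_) (hv0 x))
    rw [zero_add]
    refine le_of_koTime_bounded hD (by linarith) hc hmono h0 hΦ hlim hC hv (fun ψ hψ hψs => ?_) ha x
    have h := hsol ψ hψ hψs (Set.subset_univ _)
    simp only [Measure.restrict_univ] at h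
    simp only [h, heq _ (hv0 _)]
  · rintro ⟨a, ha, hinf⟩
    obtain ⟨v, hv, hvpos, hsol⟩ := exists_pos_solution hD (by linarith) hc hmono ha
      ((hInt a ha).trans hinf) hnn
    refine ⟨v, hv, fun x => (hvpos x).le, ⟨0, (hvpos 0).ne'⟩, fun ψ hψ hψs _ => ?_⟩
    simp only [Measure.restrict_univ, hsol ψ (hψ.of_le two_le_coe_top) hψs, heq _ (hvpos _).le]
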